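/- arXiv:math/0301307 — 2 statements merged into one kernel-verified Lean document; each statement's English description precedes it below -/
import Mathlib

section
/- Let p and n be positive integers with 2p ≤ n, let s_1 ≥ ... ≥ s_p ≥ 0, and let λ_1 ≥ ... ≥ λ_n be real numbers. Suppose there exist p×p complex Hermitian matrices A, B, and C such that 2C ≤ A − B, the eigenvalues of C are s_1, ..., s_p, and the eigenvalues of A (respectively, of B), listed in weakly decreasing order with multiplicities, form a subsequence of λ_1, ..., λ_n. Then there exists an n×n complex Hermitian matrix of block form [[P, X],[X*, Q]] with P of size p×p, with eigenvalues λ_1, ..., λ_n, such that the p×(n−p) block X has singular values s_1, ..., s_p. -/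
open scoped ComplexOrder

/-- `M` is a Hermitian matrix whose eigenvalues, with multiplicity, are `{μ i : i}`. -/
def HasEigs {ι : Type} [Fintype ι] [DecidableEq ι] (M : Matrix ι ι ℂ) (μ : ι → ℝ) : Prop :=
  ∃ U : Matrix ι ι ℂ, U * U.conjTranspose = 1 ∧ U.conjTranspose * U = 1 ∧
    M = U * Matrix.diagonal (fun i => (μ i : ℂ)) * U.conjTranspose

/-- `X` has singular values `s 1 ≥ s 2 ≥ ... ≥ s q ≥ 0` where `q = min(#rows, #cols)`:
`s` is weakly decreasing and nonnegative on `1..q`, and the eigenvalues of `Xᴴ * X`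
are `s 1 ^ 2, ..., s q ^ 2` together with `#cols - q` zeros. -/
def HasSVals {ι κ : Type} [Fintype ι] [Fintype κ] [DecidableEq κ]
    (X : Matrix ι κ ℂ) (q : ℕ) (s : ℕ → ℝ) : Prop :=
  q = min (Fintype.card ι) (Fintype.card κ) ∧
  (∀ a b, 1 ≤ a → a ≤ b → b ≤ q → s b ≤ s a) ∧
  (∀ a, 1 ≤ a → a ≤ q → 0 ≤ s a) ∧
  ∃ e : κ ≃ Fin (Fintype.card κ),
    HasEigs (X.conjTranspose * X)
      (fun j => if (e j : ℕ) + 1 ≤ q then s ((e j : ℕ) + 1) ^ 2 else 0)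

section UnitaryOrbits

open Matrix

variable {ι : Type*} [Fintype ι]

/-- The squared Frobenius norm. -/
def frobSq (N : Matrix ι ι ℂ) : ℝ := (Nᴴ * N).trace.re

lemma frobSq_eq_sum (N : Matrix ι ι ℂ) : frobSq N = ∑ j, ∑ i, ‖N i j‖ ^ 2 := by
  simp only [frobSq, trace, diag_apply, mul_apply, conjTranspose_apply, Complex.re_sum]
  refine Finset.sum_congr rfl fun j _ => Finset.sum_congr rfl fun i _ => ?_
  rw [← Complex.normSq_eq_norm_sq, Complex.normSq_apply]
  simp

lemma frobSq_nonneg (N : Matrix ι ι ℂ) : 0 ≤ frobSq N := by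
  rw [frobSq_eq_sum]; positivity

lemma frobSq_eq_zero {N : Matrix ι ι ℂ} : frobSq N = 0 ↔ N = 0 := by
  constructor
  · intro h
    rw [frobSq_eq_sum, Finset.sum_eq_zero_iff_of_nonneg fun _ _ => by positivity] at h
    ext i j
    have hj := h j (Finset.mem_univ j)
    rw [Finset.sum_eq_zero_iff_of_nonneg fun _ _ => by positivity] at hj
    simpa using hj i (Finset.mem_univ i)
  · rintro rfl
    simp [frobSq]

lemma frobSq_add (M N : Matrix ι ι ℂ) :
    frobSq (M + N) = frobSq M + 2 * (Mᴴ * N).trace.re + frobSq N := by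
  have h : (Nᴴ * M).trace.re = (Mᴴ * N).trace.re := by
    rw [← Complex.conj_re, ← Complex.star_def, ← trace_conjTranspose]
    simp
  simp only [frobSq, conjTranspose_add, add_mul, mul_add, trace_add, Complex.add_re, h]
  ring

lemma frobSq_smul (r : ℝ) (N : Matrix ι ι ℂ) : frobSq ((r : ℂ) • N) = r ^ 2 * frobSq N := by
  simp only [frobSq_eq_sum, Matrix.smul_apply, smul_eq_mul, norm_mul, mul_pow, Complex.norm_real,
    Finset.mul_sum, Real.norm_eq_abs, sq_abs]

lemma frobSq_neg (N : Matrix ι ι ℂ) : frobSq (-N) = frobSq N := by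
  simp [frobSq]

lemma continuous_frobSq : Continuous (frobSq : Matrix ι ι ℂ → ℝ) := by
  unfold frobSq
  fun_prop

lemma isCompact_frobSq_le (c : ℝ) : IsCompact {N : Matrix ι ι ℂ | frobSq N ≤ c} := by
  have hK : IsCompact (Set.univ.pi fun _ : ι => Set.univ.pi fun _ : ι =>
      Metric.closedBall (0 : ℂ) (Real.sqrt c)) :=
    isCompact_univ_pi fun _ => isCompact_univ_pi fun _ => isCompact_closedBall _ _
  refine hK.of_isClosed_subset (isClosed_le continuous_frobSq continuous_const) ?_
  intro (N : Matrix ι ι ℂ) hN i _ j _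
  replace hN : frobSq (N : Matrix ι ι ℂ) ≤ c := hN
  rw [frobSq_eq_sum] at hN
  rw [mem_closedBall_zero_iff]
  refine Real.le_sqrt_of_sq_le (le_trans ?_ hN)
  calc ‖N i j‖ ^ 2 ≤ ∑ i, ‖N i j‖ ^ 2 :=
        Finset.single_le_sum (f := fun i => ‖N i j‖ ^ 2) (fun _ _ => by positivity)
          (Finset.mem_univ i)
    _ ≤ _ := Finset.single_le_sum (f := fun j => ∑ i, ‖N i j‖ ^ 2)
          (fun _ _ => by positivity) (Finset.mem_univ j)

lemma isClosed_posSemidef : IsClosed {M : Matrix ι ι ℂ | M.PosSemidef} := by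
  simp only [posSemidef_iff_dotProduct_mulVec, IsHermitian, Set.ofPred_and, Set.ofPred_forall]
  refine (isClosed_eq (by fun_prop) continuous_id).inter (isClosed_iInter fun x => ?_)
  exact isClosed_le continuous_const (by fun_prop)

lemma isCompact_isometry [DecidableEq ι] : IsCompact {U : Matrix ι ι ℂ | Uᴴ * U = 1} := by
  refine (isCompact_frobSq_le (ι := ι) (Fintype.card ι)).of_isClosed_subset
    (isClosed_eq (by fun_prop) continuous_const) ?_
  intro U hU
  have hU' : Uᴴ * U = 1 := hU
  simp [frobSq, hU']

lemma eq_zero_of_forall_sq_mul_le {k y : ℝ} (h : ∀ τ : ℝ, τ ^ 2 * k ≤ τ * y) : y = 0 := by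
  by_contra hy
  have hk : 0 < 1 + |k| := by positivity
  have h1 := h (-(y / (1 + |k|)))
  have h2 : y ^ 2 * (k + (1 + |k|)) ≤ 0 := by
    have := mul_le_mul_of_nonneg_right h1 (sq_nonneg (1 + |k|))
    field_simp at this
    nlinarith
  have h3 : 0 < k + (1 + |k|) := by linarith [neg_abs_le k]
  have : 0 < y ^ 2 * (k + (1 + |k|)) := by positivity
  linarith

lemma trace_vecMulVec_star_mul (v : ι → ℂ) (M : Matrix ι ι ℂ) :
    (vecMulVec v (star v) * M).trace = star v ⬝ᵥ M *ᵥ v := by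
  rw [vecMulVec_mul, trace_vecMulVec, dotProduct_comm, dotProduct_mulVec]

lemma eq_zero_of_dotProduct_mulVec_eq_zero {M : Matrix ι ι ℂ} (hM : M.IsHermitian)
    (h : ∀ v, star v ⬝ᵥ M *ᵥ v = 0) : M = 0 := by
  have hp : M.PosSemidef := .of_dotProduct_mulVec_nonneg hM fun v => (h v).ge
  classical
  refine ext_of_mulVec_single fun i => ?_
  rw [(hp.dotProduct_mulVec_zero_iff _).1 (h _), zero_mulVec]

/-- A Hermitian matrix whose distance to `Y` is minimal on its unitary orbit commutes with `Y`. -/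
lemma commute_of_frobSq_le_of_isometry [DecidableEq ι] {A Y : Matrix ι ι ℂ} (hA : A.IsHermitian)
    (hY : Y.IsHermitian)
    (h : ∀ U : Matrix ι ι ℂ, Uᴴ * U = 1 → frobSq (A - Y) ≤ frobSq (U * A * Uᴴ - Y)) :
    A * Y = Y * A := by
  have key : ∀ U : Matrix ι ι ℂ, Uᴴ * U = 1 →
      (U * A * Uᴴ * Y).trace.re ≤ (A * Y).trace.re := by
    intro U hU
    have h1 := h U hU
    have hU' : frobSq (U * A * Uᴴ) = frobSq A := by
      have : (U * A * Uᴴ)ᴴ * (U * A * Uᴴ) = U * (Aᴴ * (Uᴴ * U) * A) * Uᴴ := by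
        simp [Matrix.mul_assoc]
      rw [frobSq, this, trace_mul_comm, ← Matrix.mul_assoc, hU, frobSq]
      simp
    have hH : (U * A * Uᴴ)ᴴ = U * A * Uᴴ := by
      simp [Matrix.mul_assoc, hA.eq]
    rw [sub_eq_add_neg, sub_eq_add_neg, frobSq_add, frobSq_add, hU', hH, hA.eq] at h1
    simp only [Matrix.mul_neg, trace_neg, Complex.neg_re] at h1
    linarith
  have him : ∀ v : ι → ℂ, (star v ⬝ᵥ (A * Y) *ᵥ v).im = 0 := by
    intro v
    set E := vecMulVec v (star v) with hE
    have hEH : Eᴴ = E := by simp [hE, conjTranspose_vecMulVec]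
    set n : ℝ := (star v ⬝ᵥ v).re with hn
    have hnn : star v ⬝ᵥ v = (n : ℂ) := by
      have : 0 ≤ star v ⬝ᵥ v := dotProduct_star_self_nonneg v
      rw [Complex.le_def] at this
      apply Complex.ext
      · simp [hn]
      · simpa using this.2.symm
    have hEE : E * E = (n : ℂ) • E := by
      rw [hE, vecMulVec_mul_vecMulVec, hnn, vecMulVec_smul]
    set w := (E * (A * Y)).trace with hw
    have hw' : (A * E * Y).trace = star w := by
      rw [hw, ← trace_conjTranspose]
      simp only [conjTranspose_mul, hEH, hA.eq, hY.eq]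
      rw [trace_mul_comm (A * E) Y, Matrix.mul_assoc]
    set ρ := (E * A * E * Y).trace with hρ
    suffices w.im = 0 by rwa [hw, hE, trace_vecMulVec_star_mul] at this
    refine eq_zero_of_forall_sq_mul_le (k := ρ.re - n * w.re) fun τ => ?_
    have hm : (0 : ℝ) < 1 + τ ^ 2 * n ^ 2 := by positivity
    set c : ℂ := ⟨-2 * τ ^ 2 * n / (1 + τ ^ 2 * n ^ 2), 2 * τ / (1 + τ ^ 2 * n ^ 2)⟩ with hc
    have hcc : star c + c + star c * c * n = 0 := by
      apply Complex.ext
      · simp [hc]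
        field_simp
        ring
      · simp [hc, mul_comm]
    have hU : (1 + c • E)ᴴ * (1 + c • E) = 1 := by
      simp only [conjTranspose_add, conjTranspose_one, conjTranspose_smul, hEH, add_mul, mul_add,
        one_mul, mul_one, smul_mul_smul_comm, hEE, smul_smul]
      rw [add_assoc, ← add_smul, ← add_smul]
      rw [show star c + (c + star c * c * n) = 0 by rw [← hcc]; ring]
      simp
    have h2 := key _ hU
    have h3 : (1 + c • E) * A * (1 + c • E)ᴴ * Y
        = A * Y + c • (E * (A * Y)) + star c • (A * E * Y) + (c * star c) • (E * A * E * Y) := by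
      simp only [conjTranspose_add, conjTranspose_one, conjTranspose_smul, hEH, add_mul, mul_add,
        one_mul, mul_one, smul_mul_assoc, mul_smul_comm, smul_add, smul_smul, Matrix.mul_assoc]
      rw [mul_comm (star c) c]
      abel
    rw [h3] at h2
    simp only [trace_add, trace_smul, ← hw, hw', ← hρ, Complex.add_re, smul_eq_mul] at h2
    have h4 : (c * w + star c * star w + c * star c * ρ).re ≤ 0 := by
      simp only [Complex.add_re]; linarith
    have h5 : (c * w + star c * star w + c * star c * ρ).re
        = 4 / (1 + τ ^ 2 * n ^ 2) * (τ ^ 2 * (ρ.re - n * w.re) - τ * w.im) := by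
      simp [hc]
      field_simp
      ring
    rw [h5] at h4
    exact sub_nonpos.1 (nonpos_of_mul_nonpos_right h4 (by positivity))
  have hK : (Complex.I • (A * Y - Y * A)).IsHermitian := by
    rw [IsHermitian, conjTranspose_smul]
    simp only [conjTranspose_sub, conjTranspose_mul, hA.eq, hY.eq, Complex.star_def,
      Complex.conj_I]
    rw [neg_smul, ← smul_neg, neg_sub]
  have hz := eq_zero_of_dotProduct_mulVec_eq_zero hK fun v => by
    have h1 : star v ⬝ᵥ (Y * A) *ᵥ v = star (star v ⬝ᵥ (A * Y) *ᵥ v) := by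
      rw [← star_dotProduct, star_mulVec, ← dotProduct_mulVec]
      simp [hA.eq, hY.eq]
    rw [smul_mulVec, dotProduct_smul, sub_mulVec, dotProduct_sub, h1]
    have := him v
    rw [Complex.star_def, Complex.conj_eq_iff_im.2 this]
    simp
  exact sub_eq_zero.1 ((smul_eq_zero.1 hz).resolve_left Complex.I_ne_zero)

lemma PosSemidef.mul_eq_zero_of_trace_re_nonpos {M N : Matrix ι ι ℂ} (hM : M.PosSemidef)
    (hN : N.PosSemidef) (h : (M * N).trace.re ≤ 0) : M * N = 0 := by
  classical
  open scoped MatrixOrder in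
  obtain ⟨X, rfl⟩ := CStarAlgebra.nonneg_iff_eq_star_mul_self.1 (nonneg_iff_posSemidef.2 hM)
  open scoped MatrixOrder in
  obtain ⟨Y, rfl⟩ := CStarAlgebra.nonneg_iff_eq_star_mul_self.1 (nonneg_iff_posSemidef.2 hN)
  simp only [star_eq_conjTranspose] at *
  have h1 : (Xᴴ * X * (Yᴴ * Y)).trace = ((X * Yᴴ)ᴴ * (X * Yᴴ)).trace := by
    rw [← Matrix.mul_assoc, trace_mul_comm]
    simp [Matrix.mul_assoc]
  rw [h1] at h
  have h2 := frobSq_eq_zero.1 (le_antisymm h (frobSq_nonneg (X * Yᴴ)))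
  calc Xᴴ * X * (Yᴴ * Y) = Xᴴ * (X * Yᴴ) * Y := by simp [Matrix.mul_assoc]
    _ = 0 := by simp [h2]

lemma nonneg_of_forall_small {y k : ℝ} (h : ∀ ε : ℝ, 0 < ε → ε ≤ 1 → 0 ≤ 2 * (ε * y) + ε ^ 2 * k) :
    0 ≤ y := by
  by_contra! hy
  have hy' : 0 < |y| := abs_pos.2 hy.ne
  have hk : 0 < |k| + |y| := add_pos_of_nonneg_of_pos (abs_nonneg k) hy'
  have h1 := h (|y| / (|k| + |y|)) (by positivity) (by
    rw [div_le_one hk]; linarith [abs_nonneg k])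
  have h2 : 0 ≤ |y| / (|k| + |y|) * (2 * y + |y| / (|k| + |y|) * k) := by linarith
  have h3 := nonneg_of_mul_nonneg_right h2 (by positivity)
  have h4 : |y| / (|k| + |y|) * k ≤ |y| := by
    rw [div_mul_eq_mul_div, div_le_iff₀ hk]
    nlinarith [abs_nonneg y, le_abs_self k]
  linarith [abs_of_neg hy]

section Perturbation

variable [DecidableEq ι]

/-- Among all `N` for which some unitary conjugates of `A` and `B` satisfy
`U A U* - V B V* - D + N ≥ 0`, there is one of minimal Frobenius norm. -/
lemma exists_minimal_defect {A B D N₀ U₀ V₀ : Matrix ι ι ℂ} (hU₀ : U₀ᴴ * U₀ = 1)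
    (hV₀ : V₀ᴴ * V₀ = 1) (h₀ : (U₀ * A * U₀ᴴ - V₀ * B * V₀ᴴ - D + N₀).PosSemidef) :
    ∃ U V N : Matrix ι ι ℂ, Uᴴ * U = 1 ∧ Vᴴ * V = 1 ∧
      (U * A * Uᴴ - V * B * Vᴴ - D + N).PosSemidef ∧
      ∀ U' V' N' : Matrix ι ι ℂ, U'ᴴ * U' = 1 → V'ᴴ * V' = 1 →
        (U' * A * U'ᴴ - V' * B * V'ᴴ - D + N').PosSemidef → frobSq N ≤ frobSq N' := by
  let K : Set (Matrix ι ι ℂ × Matrix ι ι ℂ × Matrix ι ι ℂ) :=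
    {U | Uᴴ * U = 1} ×ˢ {V | Vᴴ * V = 1} ×ˢ {N | frobSq N ≤ frobSq N₀}
  let F : Matrix ι ι ℂ × Matrix ι ι ℂ × Matrix ι ι ℂ → Matrix ι ι ℂ :=
    fun x => x.1 * A * (x.1)ᴴ - x.2.1 * B * (x.2.1)ᴴ - D + x.2.2
  have hK : IsCompact K :=
    isCompact_isometry.prod (isCompact_isometry.prod (isCompact_frobSq_le _))
  have hF : Continuous F := by fun_prop
  have hS : IsCompact (K ∩ F ⁻¹' {M | M.PosSemidef}) :=
    hK.inter_right (isClosed_posSemidef.preimage hF)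
  have hmem : ∀ U V N : Matrix ι ι ℂ, (U, V, N) ∈ K ∩ F ⁻¹' {M | M.PosSemidef} ↔
      (Uᴴ * U = 1 ∧ Vᴴ * V = 1 ∧ frobSq N ≤ frobSq N₀) ∧
        (U * A * Uᴴ - V * B * Vᴴ - D + N).PosSemidef := fun _ _ _ => Iff.rfl
  have hf : Continuous fun x : Matrix ι ι ℂ × Matrix ι ι ℂ × Matrix ι ι ℂ => frobSq x.2.2 :=
    continuous_frobSq.comp (continuous_snd.comp continuous_snd)
  obtain ⟨⟨U, V, N⟩, hx, hmin⟩ := hS.exists_isMinOn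
    ⟨(U₀, V₀, N₀), (hmem _ _ _).2 ⟨⟨hU₀, hV₀, le_refl _⟩, h₀⟩⟩ hf.continuousOn
  obtain ⟨⟨hU, hV, hN⟩, hP⟩ := (hmem _ _ _).1 hx
  refine ⟨U, V, N, hU, hV, hP, fun U' V' N' hU' hV' hP' => ?_⟩
  rcases le_total (frobSq N') (frobSq N₀) with h | h
  · exact isMinOn_iff.1 hmin (U', V', N') ((hmem _ _ _).2 ⟨⟨hU', hV', h⟩, hP'⟩)
  · exact hN.trans h

/-- Among all `N` for which some unitary conjugates of `A` and `B` satisfy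
`U A U* - V B V* - D + N ≥ 0`, one of minimal Frobenius norm is positive semidefinite, commutes with
the conjugates of `A` and `B`, and is annihilated by the resulting positive semidefinite matrix. -/
lemma exists_commuting_defect {A B D N₀ U₀ V₀ : Matrix ι ι ℂ} (hA : A.IsHermitian)
    (hB : B.IsHermitian) (hD : D.IsHermitian) (hU₀ : U₀ᴴ * U₀ = 1) (hV₀ : V₀ᴴ * V₀ = 1)
    (h₀ : (U₀ * A * U₀ᴴ - V₀ * B * V₀ᴴ - D + N₀).PosSemidef) :
    ∃ U V N : Matrix ι ι ℂ, Uᴴ * U = 1 ∧ Vᴴ * V = 1 ∧ frobSq N ≤ frobSq N₀ ∧ N.PosSemidef ∧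
      (U * A * Uᴴ - V * B * Vᴴ - D + N).PosSemidef ∧
      N * (U * A * Uᴴ - V * B * Vᴴ - D + N) = 0 ∧
      Commute N (U * A * Uᴴ) ∧ Commute N (V * B * Vᴴ) := by
  obtain ⟨U, V, N, hU, hV, hP, hmin'⟩ := exists_minimal_defect hU₀ hV₀ h₀
  have hN := hmin' U₀ V₀ N₀ hU₀ hV₀ h₀
  have hAH : (U * A * Uᴴ).IsHermitian := by simp [IsHermitian, hA.eq, Matrix.mul_assoc]
  have hBH : (V * B * Vᴴ).IsHermitian := by simp [IsHermitian, hB.eq, Matrix.mul_assoc]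
  have hNH : N.IsHermitian := by
    have := hP.isHermitian.sub ((hAH.sub hBH).sub hD)
    simpa using this
  have hNP : ∀ H : Matrix ι ι ℂ,
      (∀ ε : ℝ, 0 < ε → ε ≤ 1 → (U * A * Uᴴ - V * B * Vᴴ - D + N + (ε : ℂ) • H).PosSemidef) →
      0 ≤ (N * H).trace.re := by
    intro H hH
    refine nonneg_of_forall_small (k := frobSq H) fun ε h0 h1 => ?_
    have h2 := hmin' U V (N + (ε : ℂ) • H) hU hV (by rw [← add_assoc]; exact hH ε h0 h1)
    rw [frobSq_add, frobSq_smul, hNH.eq] at h2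
    simp only [Matrix.mul_smul, trace_smul, smul_eq_mul, Complex.re_ofReal_mul] at h2
    linarith
  have hNpsd : N.PosSemidef := by
    refine .of_dotProduct_mulVec_nonneg hNH fun v => ?_
    have h1 := hNP (vecMulVec v (star v)) fun ε h0 _ =>
      hP.add ((posSemidef_vecMulVec_self_star v).smul (by exact_mod_cast h0.le))
    rw [trace_mul_comm, trace_vecMulVec_star_mul] at h1
    rw [Complex.le_def]
    exact ⟨h1, (hNH.im_star_dotProduct_mulVec_self v).symm⟩
  refine ⟨U, V, N, hU, hV, hN, hNpsd, hP, ?_, ?_, ?_⟩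
  · refine PosSemidef.mul_eq_zero_of_trace_re_nonpos hNpsd hP ?_
    have h1 := hNP (-(U * A * Uᴴ - V * B * Vᴴ - D + N)) fun ε _ h1 => by
      have := hP.smul (show (0 : ℂ) ≤ ((1 - ε : ℝ) : ℂ) by exact_mod_cast sub_nonneg.2 h1)
      convert this using 1
      push_cast
      module
    rw [Matrix.mul_neg, trace_neg, Complex.neg_re] at h1
    linarith
  · have h1 := commute_of_frobSq_le_of_isometry (A := U * A * Uᴴ) (Y := U * A * Uᴴ + N) hAH
      (hAH.add hNH) fun W hW => by
        have h2 := hmin' (W * U) V (U * A * Uᴴ + N - W * (U * A * Uᴴ) * Wᴴ)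
          (by rw [conjTranspose_mul, Matrix.mul_assoc, ← Matrix.mul_assoc Wᴴ, hW, one_mul, hU]) hV
          (by convert hP using 1; simp only [conjTranspose_mul, Matrix.mul_assoc]; abel)
        rwa [← neg_sub (U * A * Uᴴ + N) (W * _ * _), frobSq_neg, ← neg_sub, add_sub_cancel_left,
          frobSq_neg]
    rw [mul_add, add_mul] at h1
    exact (add_left_cancel h1).symm
  · have h1 := commute_of_frobSq_le_of_isometry (A := V * B * Vᴴ) (Y := V * B * Vᴴ - N) hBH
      (hBH.sub hNH) fun W hW => by
        have h2 := hmin' U (W * V) (W * (V * B * Vᴴ) * Wᴴ - (V * B * Vᴴ - N)) hU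
          (by rw [conjTranspose_mul, Matrix.mul_assoc, ← Matrix.mul_assoc Wᴴ, hW, one_mul, hV])
          (by convert hP using 1; simp only [conjTranspose_mul, Matrix.mul_assoc]; abel)
        simpa using h2
    rw [mul_sub, sub_mul] at h1
    exact (sub_right_injective h1).symm

/-- Scaling `D` up as far as unitary conjugates of `A` and `B` permit, one reaches a situation in
which `A - B = t D` holds on the range of some `L ≠ 0` that commutes with the conjugates. -/
lemma exists_scaling_tight {A B D : Matrix ι ι ℂ} (hA : A.IsHermitian)
    (hB : B.IsHermitian) (hD : D.PosSemidef) (hD0 : D ≠ 0) (h : (A - B - D).PosSemidef) :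
    ∃ (t : ℝ) (U V L : Matrix ι ι ℂ), 1 ≤ t ∧ Uᴴ * U = 1 ∧ Vᴴ * V = 1 ∧ L.PosSemidef ∧ L ≠ 0 ∧
      (U * A * Uᴴ - V * B * Vᴴ - (t : ℂ) • D).PosSemidef ∧
      L * (U * A * Uᴴ - V * B * Vᴴ - (t : ℂ) • D) = 0 ∧
      Commute L (U * A * Uᴴ) ∧ Commute L (V * B * Vᴴ) := by
  have htD : 0 < D.trace.re := by
    have h1 := hD.trace_nonneg
    rw [Complex.le_def] at h1
    refine lt_of_le_of_ne h1.1 fun h2 => hD0 (hD.trace_eq_zero_iff.1 ?_)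
    exact Complex.ext h2.symm h1.2.symm
  have hbd : ∀ (t : ℝ) (U V : Matrix ι ι ℂ), Uᴴ * U = 1 → Vᴴ * V = 1 →
      (U * A * Uᴴ - V * B * Vᴴ - (t : ℂ) • D).PosSemidef →
      t ≤ (A.trace.re - B.trace.re) / D.trace.re := by
    intro t U V hU hV hP
    rw [le_div_iff₀ htD]
    have h1 := (Complex.le_def.1 hP.trace_nonneg).1
    rw [trace_sub, trace_sub, trace_mul_comm, ← Matrix.mul_assoc, hU, trace_mul_comm (V * B),
      ← Matrix.mul_assoc, hV] at h1
    simp at h1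
    linarith
  let S : Set (ℝ × Matrix ι ι ℂ × Matrix ι ι ℂ) :=
    (Set.Icc 1 ((A.trace.re - B.trace.re) / D.trace.re) ×ˢ
      {U | Uᴴ * U = 1} ×ˢ {V | Vᴴ * V = 1}) ∩
      (fun x => x.2.1 * A * (x.2.1)ᴴ - x.2.2 * B * (x.2.2)ᴴ - (x.1 : ℂ) • D) ⁻¹' {M | M.PosSemidef}
  have hS : IsCompact S :=
    (isCompact_Icc.prod (isCompact_isometry.prod isCompact_isometry)).inter_right
      (isClosed_posSemidef.preimage (by fun_prop))
  have h1P : ((1 : Matrix ι ι ℂ) * A * (1)ᴴ - 1 * B * (1)ᴴ - ((1 : ℝ) : ℂ) • D).PosSemidef := by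
    simpa using h
  obtain ⟨⟨t₀, U₀, V₀⟩, ⟨⟨ht₀, hU₀, hV₀⟩, hP₀⟩, hmax⟩ := hS.exists_isMaxOn
    ⟨(1, 1, 1), ⟨⟨le_refl _, hbd 1 1 1 (by simp) (by simp) h1P⟩,
      (by simp : (1 : Matrix ι ι ℂ)ᴴ * 1 = 1), (by simp : (1 : Matrix ι ι ℂ)ᴴ * 1 = 1)⟩, h1P⟩
    (f := fun x => x.1) continuous_fst.continuousOn
  change U₀ᴴ * U₀ = 1 at hU₀
  change V₀ᴴ * V₀ = 1 at hV₀
  change (U₀ * A * U₀ᴴ - V₀ * B * V₀ᴴ - (t₀ : ℂ) • D).PosSemidef at hP₀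
  have hlt : ∀ (t : ℝ) (U V : Matrix ι ι ℂ), Uᴴ * U = 1 → Vᴴ * V = 1 → t₀ < t →
      ¬ (U * A * Uᴴ - V * B * Vᴴ - (t : ℂ) • D).PosSemidef := by
    intro t U V hU hV ht hP
    have := hmax (show (t, U, V) ∈ S from
      ⟨⟨⟨ht₀.1.trans ht.le, hbd t U V hU hV hP⟩, hU, hV⟩, hP⟩)
    exact absurd this (not_le.2 ht)
  let δ : ℕ → ℝ := fun k => 1 / ((k : ℝ) + 1)
  have hδpos : ∀ k, 0 < δ k := fun k => by positivity
  have hδ : Filter.Tendsto δ Filter.atTop (nhds 0) := tendsto_one_div_add_atTop_nhds_zero_nat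
  have hex : ∀ k, ∃ U V N : Matrix ι ι ℂ, Uᴴ * U = 1 ∧ Vᴴ * V = 1 ∧
      frobSq N ≤ frobSq ((δ k : ℂ) • D) ∧ N.PosSemidef ∧
      (U * A * Uᴴ - V * B * Vᴴ - ((t₀ + δ k : ℝ) : ℂ) • D + N).PosSemidef ∧
      N * (U * A * Uᴴ - V * B * Vᴴ - ((t₀ + δ k : ℝ) : ℂ) • D + N) = 0 ∧
      Commute N (U * A * Uᴴ) ∧ Commute N (V * B * Vᴴ) := by
    intro k
    refine exists_commuting_defect hA hB ?_ hU₀ hV₀ ?_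
    · simp [IsHermitian, conjTranspose_smul, hD.isHermitian.eq]
    · convert hP₀ using 1
      push_cast
      module
  choose U V N hU hV hN hNp hP hNP hNA hNB using hex
  let r : ℕ → ℝ := fun k => Real.sqrt (frobSq (N k))
  have hrpos : ∀ k, 0 < r k := by
    intro k
    refine Real.sqrt_pos.2 (lt_of_le_of_ne (frobSq_nonneg _) fun h0 => ?_)
    have hN0 := frobSq_eq_zero.1 h0.symm
    have h1 := hP k
    rw [hN0, add_zero] at h1
    exact hlt _ _ _ (hU k) (hV k) (by linarith [hδpos k]) h1
  have hr : Filter.Tendsto r Filter.atTop (nhds 0) := by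
    have h1 : Filter.Tendsto (fun k => δ k * Real.sqrt (frobSq D)) Filter.atTop (nhds 0) := by
      simpa using hδ.mul_const (Real.sqrt (frobSq D))
    refine squeeze_zero (fun k => (hrpos k).le) (fun k => ?_) h1
    refine (Real.sqrt_le_sqrt (hN k)).trans_eq ?_
    rw [frobSq_smul, Real.sqrt_mul (sq_nonneg _), Real.sqrt_sq (hδpos k).le]
  let L : ℕ → Matrix ι ι ℂ := fun k => (((r k)⁻¹ : ℝ) : ℂ) • N k
  have hLN : ∀ k, N k = (r k : ℂ) • L k := by
    intro k
    simp only [L, smul_smul, ← Complex.ofReal_mul, mul_inv_cancel₀ (hrpos k).ne',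
      Complex.ofReal_one, one_smul]
  have hL1 : ∀ k, frobSq (L k) = 1 := by
    intro k
    have h2 : frobSq (N k) = r k ^ 2 := (Real.sq_sqrt (frobSq_nonneg _)).symm
    simp only [L]
    rw [frobSq_smul, h2, ← mul_pow, inv_mul_cancel₀ (hrpos k).ne', one_pow]
  have hK : IsCompact ({U | Uᴴ * U = 1} ×ˢ {V | Vᴴ * V = 1} ×ˢ {M | frobSq M ≤ 1} :
      Set (Matrix ι ι ℂ × Matrix ι ι ℂ × Matrix ι ι ℂ)) :=
    isCompact_isometry.prod (isCompact_isometry.prod (isCompact_frobSq_le 1))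
  have : FirstCountableTopology (Matrix ι ι ℂ) :=
    inferInstanceAs (FirstCountableTopology (ι → ι → ℂ))
  obtain ⟨⟨U', V', L'⟩, ⟨hU', hV', -⟩, φ, hφ, hlim⟩ :=
    hK.tendsto_subseq (x := fun k => (U k, V k, L k)) fun k => ⟨hU k, hV k, (hL1 k).le⟩
  have hlU : Filter.Tendsto (fun k => U (φ k)) Filter.atTop (nhds U') :=
    (continuous_fst.tendsto _).comp hlim
  have hlV : Filter.Tendsto (fun k => V (φ k)) Filter.atTop (nhds V') :=
    ((continuous_fst.comp continuous_snd).tendsto _).comp hlim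
  have hlL : Filter.Tendsto (fun k => L (φ k)) Filter.atTop (nhds L') :=
    ((continuous_snd.comp continuous_snd).tendsto _).comp hlim
  have hlr : Filter.Tendsto (fun k => (r (φ k) : ℂ)) Filter.atTop (nhds 0) := by
    have := (Complex.continuous_ofReal.tendsto 0).comp (hr.comp hφ.tendsto_atTop)
    rwa [Complex.ofReal_zero] at this
  have hlt' : Filter.Tendsto (fun k => ((t₀ + δ (φ k) : ℝ) : ℂ)) Filter.atTop (nhds (t₀ : ℂ)) := by
    have := (Complex.continuous_ofReal.tendsto _).comp
      ((hδ.comp hφ.tendsto_atTop).const_add t₀)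
    rwa [add_zero] at this
  have hlA : Filter.Tendsto (fun k => U (φ k) * A * (U (φ k))ᴴ) Filter.atTop
      (nhds (U' * A * U'ᴴ)) :=
    ((by fun_prop : Continuous fun W : Matrix ι ι ℂ => W * A * Wᴴ).tendsto U').comp hlU
  have hlB : Filter.Tendsto (fun k => V (φ k) * B * (V (φ k))ᴴ) Filter.atTop
      (nhds (V' * B * V'ᴴ)) :=
    ((by fun_prop : Continuous fun W : Matrix ι ι ℂ => W * B * Wᴴ).tendsto V').comp hlV
  have hlP : Filter.Tendsto (fun k => U (φ k) * A * (U (φ k))ᴴ - V (φ k) * B * (V (φ k))ᴴ -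
      ((t₀ + δ (φ k) : ℝ) : ℂ) • D + N (φ k)) Filter.atTop
      (nhds (U' * A * U'ᴴ - V' * B * V'ᴴ - (t₀ : ℂ) • D)) := by
    have h1 := ((hlA.sub hlB).sub (hlt'.smul_const D)).add (hlr.smul hlL)
    rw [zero_smul, add_zero] at h1
    exact h1.congr fun k => by rw [hLN (φ k)]
  have hLP : ∀ k, L k * (U k * A * (U k)ᴴ - V k * B * (V k)ᴴ -
      ((t₀ + δ k : ℝ) : ℂ) • D + N k) = 0 := fun k => by
    simp only [L, smul_mul_assoc, hNP k, smul_zero]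
  refine ⟨t₀, U', V', L', ht₀.1, hU', hV', ?_, ?_, ?_, ?_, ?_, ?_⟩
  · refine isClosed_posSemidef.mem_of_tendsto hlL (.of_forall fun k => ?_)
    exact (hNp _).smul (by exact_mod_cast (inv_pos.2 (hrpos _)).le)
  · rintro rfl
    have h1 := (continuous_frobSq.tendsto _).comp hlL
    simp only [Function.comp_def, hL1, frobSq_eq_zero.2 rfl] at h1
    exact one_ne_zero (tendsto_nhds_unique tendsto_const_nhds h1)
  · exact isClosed_posSemidef.mem_of_tendsto hlP (.of_forall fun k => hP _)
  · refine tendsto_nhds_unique (hlL.mul hlP) ?_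
    simp only [hLP]
    exact tendsto_const_nhds
  · refine tendsto_nhds_unique (hlL.mul hlA) ((hlA.mul hlL).congr fun k => ?_)
    exact ((hNA (φ k)).smul_left _).eq.symm
  · refine tendsto_nhds_unique (hlL.mul hlB) ((hlB.mul hlL).congr fun k => ?_)
    exact ((hNB (φ k)).smul_left _).eq.symm

end Perturbation

lemma submatrix_sumCompl_eq_fromBlocks {ι : Type*} {q : ι → Prop} [DecidablePred q] {M : Matrix ι ι ℂ}
    (hM : M.IsHermitian) (h : ∀ i j, q i → ¬ q j → M i j = 0) :
    M.submatrix (Equiv.sumCompl q) (Equiv.sumCompl q) =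
      Matrix.fromBlocks (M.submatrix ((↑) : {i // q i} → ι) (↑)) 0 0
        (M.submatrix ((↑) : {i // ¬ q i} → ι) (↑)) := by
  ext (i | i) (j | j)
  · rfl
  · exact h _ _ i.2 j.2
  · simp only [submatrix_apply, Equiv.sumCompl_apply_inl, Equiv.sumCompl_apply_inr,
      fromBlocks_apply₂₁, Matrix.zero_apply]
    rw [← hM.apply, h _ _ j.2 i.2, star_zero]
  · rfl

section Rotation

/-- Some unitary matrix `[[a, b], [c, d]]` conjugates `A ⊕ B` to a matrix with upper right
block `C`. -/
def HasRotation [DecidableEq ι] (A B C : Matrix ι ι ℂ) : Prop :=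
  ∃ a b c d : Matrix ι ι ℂ, a * aᴴ + b * bᴴ = 1 ∧ c * cᴴ + d * dᴴ = 1 ∧ a * cᴴ + b * dᴴ = 0 ∧
    a * A * cᴴ + b * B * dᴴ = C

variable {κ : Type*} [Fintype κ] [DecidableEq ι] [DecidableEq κ]

lemma HasRotation.of_conj {A B C U V : Matrix ι ι ℂ} (hU : Uᴴ * U = 1) (hV : Vᴴ * V = 1)
    (h : HasRotation (U * A * Uᴴ) (V * B * Vᴴ) C) : HasRotation A B C := by
  obtain ⟨a, b, c, d, h1, h2, h3, h4⟩ := h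
  rw [mul_eq_one_comm] at hU hV
  have hU' (x y : Matrix ι ι ℂ) : x * U * (y * U)ᴴ = x * yᴴ := by
    rw [conjTranspose_mul, Matrix.mul_assoc, ← Matrix.mul_assoc U, hU, one_mul]
  have hV' (x y : Matrix ι ι ℂ) : x * V * (y * V)ᴴ = x * yᴴ := by
    rw [conjTranspose_mul, Matrix.mul_assoc, ← Matrix.mul_assoc V, hV, one_mul]
  refine ⟨a * U, b * V, c * U, d * V, ?_, ?_, ?_, ?_⟩
  · rw [hU', hV', h1]
  · rw [hU', hV', h2]
  · rw [hU', hV', h3]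
  · rw [← h4]
    simp only [conjTranspose_mul, Matrix.mul_assoc]

lemma HasRotation.conj {A B C Z : Matrix ι ι ℂ} (hZ : Zᴴ * Z = 1) (h : HasRotation A B C) :
    HasRotation (Z * A * Zᴴ) (Z * B * Zᴴ) (Z * C * Zᴴ) := by
  obtain ⟨a, b, c, d, h1, h2, h3, h4⟩ := h
  have hZ' := mul_eq_one_comm.1 hZ
  have hm (x y : Matrix ι ι ℂ) : Z * x * Zᴴ * (Z * y * Zᴴ) = Z * (x * y) * Zᴴ := by
    rw [Matrix.mul_assoc, ← Matrix.mul_assoc Zᴴ, ← Matrix.mul_assoc Zᴴ, hZ, one_mul]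
    simp only [Matrix.mul_assoc]
  have hs (x : Matrix ι ι ℂ) : (Z * x * Zᴴ)ᴴ = Z * xᴴ * Zᴴ := by
    simp [Matrix.mul_assoc]
  refine ⟨Z * a * Zᴴ, Z * b * Zᴴ, Z * c * Zᴴ, Z * d * Zᴴ, ?_, ?_, ?_, ?_⟩ <;>
    simp only [hs, hm, ← Matrix.add_mul, ← Matrix.mul_add, h1, h2, h3, h4] <;> simp [hZ']

lemma HasRotation.submatrix {A B C : Matrix ι ι ℂ} (h : HasRotation A B C) (e : κ ≃ ι) :
    HasRotation (A.submatrix e e) (B.submatrix e e) (C.submatrix e e) := by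
  obtain ⟨a, b, c, d, h1, h2, h3, h4⟩ := h
  refine ⟨a.submatrix e e, b.submatrix e e, c.submatrix e e, d.submatrix e e, ?_, ?_, ?_, ?_⟩ <;>
    simp only [conjTranspose_submatrix, submatrix_mul_equiv, ← Matrix.submatrix_add, ← Pi.add_apply,
      h1, h2, h3, h4] <;> simp

lemma HasRotation.fromBlocks {A B C : Matrix ι ι ℂ} {A' B' C' : Matrix κ κ ℂ}
    (h : HasRotation A B C) (h' : HasRotation A' B' C') :
    HasRotation (Matrix.fromBlocks A 0 0 A') (Matrix.fromBlocks B 0 0 B')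
      (Matrix.fromBlocks C 0 0 C') := by
  obtain ⟨a, b, c, d, h1, h2, h3, h4⟩ := h
  obtain ⟨a', b', c', d', h1', h2', h3', h4'⟩ := h'
  refine ⟨Matrix.fromBlocks a 0 0 a', Matrix.fromBlocks b 0 0 b', Matrix.fromBlocks c 0 0 c',
    Matrix.fromBlocks d 0 0 d', ?_, ?_, ?_, ?_⟩ <;>
    simp [fromBlocks_conjTranspose, fromBlocks_multiply, fromBlocks_add, *]

/-- If `A - B` is a large multiple of `C`, a scalar rotation does the job. -/
lemma HasRotation.of_sub_eq_smul {A B C : Matrix ι ι ℂ} {t : ℝ} (ht : 1 ≤ t)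
    (h : A - B = (t : ℂ) • (C + C)) : HasRotation A B C := by
  obtain ⟨x, y, h1, h2⟩ : ∃ x y : ℝ, x ^ 2 + y ^ 2 = 1 ∧ 2 * (x * y) * t = 1 := by
    refine ⟨Real.cos (Real.arcsin t⁻¹ / 2), Real.sin (Real.arcsin t⁻¹ / 2),
      Real.cos_sq_add_sin_sq _, ?_⟩
    have h0 : (0 : ℝ) < t⁻¹ := inv_pos.2 (by linarith)
    have := Real.sin_two_mul (Real.arcsin t⁻¹ / 2)
    rw [mul_div_cancel₀ _ two_ne_zero, Real.sin_arcsin (by linarith) (inv_le_one_of_one_le₀ ht)]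
      at this
    rw [mul_comm (Real.cos _), ← mul_assoc, ← this, inv_mul_cancel₀ (by linarith)]
  have h1' : (x : ℂ) * x + y * y = 1 := by exact_mod_cast (by linarith : x * x + y * y = 1)
  have h2' : (2 : ℂ) * (x * y) * t = 1 := by exact_mod_cast h2
  refine ⟨(x : ℂ) • 1, (y : ℂ) • 1, (y : ℂ) • 1, -(x : ℂ) • 1, ?_, ?_, ?_, ?_⟩ <;>
    simp only [conjTranspose_smul, conjTranspose_one, Matrix.mul_one,
      Matrix.one_mul, star_neg, Complex.star_def, Complex.conj_ofReal, ← add_smul, smul_mul_assoc,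
      Matrix.mul_smul, smul_smul]
  · rw [h1', one_smul]
  · rw [neg_mul_neg, add_comm, h1', one_smul]
  · rw [mul_neg, mul_comm, add_neg_cancel, zero_smul]
  · calc _ = ((x : ℂ) * y) • (A - B) := by module
      _ = (2 * (x * y) * t : ℂ) • C := by rw [h]; module
      _ = C := by rw [h2', one_smul]

end Rotation

/-- If `2 C ≤ A - B` with `C ≥ 0` then `C` is an off-diagonal block of a unitary conjugate of
`A ⊕ B`. -/
theorem hasRotation_of_posSemidef [DecidableEq ι] {A B C : Matrix ι ι ℂ} (hA : A.IsHermitian)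
    (hB : B.IsHermitian) (hC : C.PosSemidef) (h : (A - B - (C + C)).PosSemidef) :
    HasRotation A B C := by
  induction hn : Fintype.card ι using Nat.strong_induction_on generalizing ι with
  | _ n ih
  subst hn
  by_cases hC0 : C = 0
  · exact ⟨1, 0, 0, 1, by simp, by simp, by simp, by simp [hC0]⟩
  have hCC : C + C ≠ 0 := by
    rw [← two_smul ℂ]
    exact smul_ne_zero two_ne_zero hC0
  obtain ⟨t, U, V, L, ht, hU, hV, hL, hL0, hP, hLP, hLA, hLB⟩ :=
    exists_scaling_tight hA hB (hC.add hC) hCC h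
  refine HasRotation.of_conj hU hV ?_
  have hA₁ : (U * A * Uᴴ).IsHermitian := by simp [IsHermitian, hA.eq, Matrix.mul_assoc]
  have hB₁ : (V * B * Vᴴ).IsHermitian := by simp [IsHermitian, hB.eq, Matrix.mul_assoc]
  generalize U * A * Uᴴ = A₁ at *
  generalize V * B * Vᴴ = B₁ at *
  clear hU hV hA hB h
  obtain ⟨Z, ℓ, hZ, hLZ⟩ : ∃ (Z : Matrix ι ι ℂ) (ℓ : ι → ℂ), Zᴴ * Z = 1 ∧
      L = Z * diagonal ℓ * Zᴴ := by
    refine ⟨hL.isHermitian.eigenvectorUnitary, _, ?_, hL.isHermitian.spectral_theorem⟩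
    exact (mem_unitaryGroup_iff'.1 (hL.isHermitian.eigenvectorUnitary).2)
  have hZ' := mul_eq_one_comm.1 hZ
  have hcancel (M : Matrix ι ι ℂ) : Z * (Zᴴ * M * Z) * Zᴴ = M := by
    rw [Matrix.mul_assoc Zᴴ, ← Matrix.mul_assoc Z, hZ', one_mul, Matrix.mul_assoc, hZ', mul_one]
  have hm (M N : Matrix ι ι ℂ) : Zᴴ * M * Z * (Zᴴ * N * Z) = Zᴴ * (M * N) * Z := by
    rw [Matrix.mul_assoc Zᴴ, Matrix.mul_assoc Zᴴ, Matrix.mul_assoc M, ← Matrix.mul_assoc Z,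
      ← Matrix.mul_assoc Z, hZ', one_mul]
    simp only [Matrix.mul_assoc]
  have hd : Zᴴ * L * Z = diagonal ℓ := by
    rw [hLZ, Matrix.mul_assoc, Matrix.mul_assoc, hZ, mul_one, ← Matrix.mul_assoc, hZ, one_mul]
  suffices HasRotation (Zᴴ * A₁ * Z) (Zᴴ * B₁ * Z) (Zᴴ * C * Z) by
    simpa only [hcancel] using this.conj hZ
  have hℓA : Commute (diagonal ℓ) (Zᴴ * A₁ * Z) := by
    rw [commute_iff_eq, ← hd, hm, hm, hLA.eq]
  have hℓB : Commute (diagonal ℓ) (Zᴴ * B₁ * Z) := by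
    rw [commute_iff_eq, ← hd, hm, hm, hLB.eq]
  have hsub : Zᴴ * A₁ * Z - Zᴴ * B₁ * Z - (t : ℂ) • (Zᴴ * C * Z + Zᴴ * C * Z) =
      Zᴴ * (A₁ - B₁ - (t : ℂ) • (C + C)) * Z := by
    simp only [Matrix.mul_sub, Matrix.sub_mul, Matrix.mul_smul, smul_mul_assoc, Matrix.mul_add,
      Matrix.add_mul]
  have hℓP : diagonal ℓ * (Zᴴ * A₁ * Z - Zᴴ * B₁ * Z - (t : ℂ) • (Zᴴ * C * Z + Zᴴ * C * Z)) =
      0 := by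
    rw [hsub, ← hd, hm, hLP, Matrix.mul_zero, Matrix.zero_mul]
  have hA₂ : (Zᴴ * A₁ * Z).IsHermitian := by simp [IsHermitian, hA₁.eq, Matrix.mul_assoc]
  have hB₂ : (Zᴴ * B₁ * Z).IsHermitian := by simp [IsHermitian, hB₁.eq, Matrix.mul_assoc]
  have hC₂ : (Zᴴ * C * Z).PosSemidef := hC.conjTranspose_mul_mul_same Z
  have hP₂ := hP.conjTranspose_mul_mul_same Z
  rw [← hsub] at hP₂
  have hℓ0 : ∃ i, ℓ i ≠ 0 := by
    by_contra! h0
    exact hL0 (by simp [hLZ, funext h0])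
  generalize Zᴴ * A₁ * Z = A₂ at *
  generalize Zᴴ * B₁ * Z = B₂ at *
  generalize Zᴴ * C * Z = C₂ at *
  clear hsub hP hLP hLA hLB hA₁ hB₁ hC hC0 hCC hL hL0 hLZ hcancel hm hd hZ hZ'
  have hPz : ∀ i j, ℓ i ≠ 0 → (A₂ - B₂ - (t : ℂ) • (C₂ + C₂)) i j = 0 := by
    intro i j hi
    have := congr_fun₂ hℓP i j
    rw [diagonal_mul, Matrix.zero_apply] at this
    exact (mul_eq_zero.1 this).resolve_left hi
  have hoff : ∀ M : Matrix ι ι ℂ, Commute (diagonal ℓ) M → ∀ i j, ℓ i ≠ 0 → ¬ ℓ j ≠ 0 →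
      M i j = 0 := by
    intro M hM i j hi hj
    have := congr_fun₂ hM.eq i j
    rw [diagonal_mul, mul_diagonal, not_not.1 hj, mul_zero] at this
    exact (mul_eq_zero.1 this).resolve_left hi
  have hCoff : ∀ i j, ℓ i ≠ 0 → ¬ ℓ j ≠ 0 → C₂ i j = 0 := by
    intro i j hi hj
    have h1 := hPz i j hi
    simp only [Matrix.sub_apply, hoff _ hℓA i j hi hj, hoff _ hℓB i j hi hj, Matrix.smul_apply,
      Matrix.add_apply, sub_self, zero_sub, neg_eq_zero, smul_eq_mul, mul_eq_zero,
      Complex.ofReal_eq_zero, add_self_eq_zero] at h1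
    exact h1.resolve_left (by linarith)
  classical
  let e := Equiv.sumCompl fun i => ℓ i ≠ 0
  suffices HasRotation (A₂.submatrix e e) (B₂.submatrix e e) (C₂.submatrix e e) by
    simpa using this.submatrix e.symm
  rw [submatrix_sumCompl_eq_fromBlocks hA₂ (hoff _ hℓA),
    submatrix_sumCompl_eq_fromBlocks hB₂ (hoff _ hℓB),
    submatrix_sumCompl_eq_fromBlocks hC₂.isHermitian hCoff]
  refine HasRotation.fromBlocks (HasRotation.of_sub_eq_smul ht ?_) ?_
  · ext i j
    exact sub_eq_zero.1 (hPz i j i.2)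
  · obtain ⟨i, hi⟩ := hℓ0
    refine ih _ (Fintype.card_subtype_lt (x := i) (not_not.2 hi)) (hA₂.submatrix _)
      (hB₂.submatrix _) (hC₂.submatrix _) ?_ rfl
    have h1 := hP₂.add ((hC₂.add hC₂).smul
      (show (0 : ℂ) ≤ ((t - 1 : ℝ) : ℂ) by exact_mod_cast sub_nonneg.2 ht))
    have h2 : A₂ - B₂ - (t : ℂ) • (C₂ + C₂) + ((t - 1 : ℝ) : ℂ) • (C₂ + C₂) =
        A₂ - B₂ - (C₂ + C₂) := by
      push_cast
      module
    rw [h2] at h1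
    exact h1.submatrix _

lemma posSemidef_diagonal_sub {ι : Type*} [DecidableEq ι] {μ ν : ι → ℝ} (h : ∀ i, μ i ≤ ν i) :
    (diagonal (fun i => (ν i : ℂ)) - diagonal fun i => (μ i : ℂ)).PosSemidef := by
  rw [diagonal_sub, posSemidef_diagonal_iff]
  intro i
  rw [← Complex.ofReal_sub]
  exact_mod_cast sub_nonneg.2 (h i)

section Spectrum

variable {ι κ : Type} [Fintype ι] [Fintype κ] [DecidableEq ι] [DecidableEq κ]

lemma HasEigs.isHermitian {M : Matrix ι ι ℂ} {μ : ι → ℝ} (h : HasEigs M μ) : M.IsHermitian := by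
  obtain ⟨U, -, -, rfl⟩ := h
  simp [IsHermitian, Matrix.mul_assoc, Pi.star_def]

lemma HasEigs.posSemidef {M : Matrix ι ι ℂ} {μ : ι → ℝ} (h : HasEigs M μ) (hμ : ∀ i, 0 ≤ μ i) :
    M.PosSemidef := by
  obtain ⟨U, -, -, rfl⟩ := h
  exact (posSemidef_diagonal_iff.2 fun i => by exact_mod_cast hμ i).mul_mul_conjTranspose_same U

/-- Raising eigenvalues raises the matrix. -/
lemma HasEigs.exists_ge {M : Matrix ι ι ℂ} {μ ν : ι → ℝ} (h : HasEigs M μ) (hμ : ∀ i, μ i ≤ ν i) :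
    ∃ N, HasEigs N ν ∧ (N - M).PosSemidef := by
  obtain ⟨U, h1, h2, rfl⟩ := h
  refine ⟨_, ⟨U, h1, h2, rfl⟩, ?_⟩
  rw [← Matrix.sub_mul, ← Matrix.mul_sub]
  exact (posSemidef_diagonal_sub hμ).mul_mul_conjTranspose_same U

/-- Lowering eigenvalues lowers the matrix. -/
lemma HasEigs.exists_le {M : Matrix ι ι ℂ} {μ ν : ι → ℝ} (h : HasEigs M μ) (hμ : ∀ i, ν i ≤ μ i) :
    ∃ N, HasEigs N ν ∧ (M - N).PosSemidef := by
  obtain ⟨U, h1, h2, rfl⟩ := h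
  refine ⟨_, ⟨U, h1, h2, rfl⟩, ?_⟩
  rw [← Matrix.sub_mul, ← Matrix.mul_sub]
  exact (posSemidef_diagonal_sub hμ).mul_mul_conjTranspose_same U

lemma HasEigs.submatrix {M : Matrix ι ι ℂ} {μ : ι → ℝ} (h : HasEigs M μ) (e : κ ≃ ι) :
    HasEigs (M.submatrix e e) (μ ∘ e) := by
  obtain ⟨U, h1, h2, rfl⟩ := h
  refine ⟨U.submatrix e e, ?_, ?_, ?_⟩
  · rw [conjTranspose_submatrix, submatrix_mul_equiv, h1, submatrix_one_equiv]
  · rw [conjTranspose_submatrix, submatrix_mul_equiv, h2, submatrix_one_equiv]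
  · rw [conjTranspose_submatrix, ← submatrix_mul_equiv _ _ e e e, ← submatrix_mul_equiv _ _ e e e,
      submatrix_diagonal_equiv]
    rfl

lemma HasEigs.conjTranspose_mul_self {M : Matrix ι ι ℂ} {μ : ι → ℝ} (h : HasEigs M μ) :
    HasEigs (Mᴴ * M) fun i => μ i ^ 2 := by
  rw [h.isHermitian.eq]
  obtain ⟨U, h1, h2, rfl⟩ := h
  refine ⟨U, h1, h2, ?_⟩
  have : diagonal (fun i => ((μ i ^ 2 : ℝ) : ℂ)) =
      diagonal (fun i => (μ i : ℂ)) * diagonal (fun i => (μ i : ℂ)) := by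
    simp [pow_two]
  rw [this]
  simp only [Matrix.mul_assoc]
  rw [← Matrix.mul_assoc Uᴴ U, h2, one_mul]

lemma HasEigs.fromBlocks_zero {M : Matrix ι ι ℂ} {μ : ι → ℝ} (h : HasEigs M μ) :
    HasEigs (fromBlocks (0 : Matrix κ κ ℂ) 0 0 M) (Sum.elim 0 μ) := by
  obtain ⟨U, h1, h2, rfl⟩ := h
  have hd : diagonal (fun i => ((Sum.elim (0 : κ → ℝ) μ i : ℝ) : ℂ)) =
      fromBlocks 0 0 0 (diagonal fun i => (μ i : ℂ)) := by
    rw [← diagonal_zero, fromBlocks_diagonal]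
    congr 1
    ext (i | i) <;> simp
  refine ⟨fromBlocks 1 0 0 U, ?_, ?_, ?_⟩
  · simp [fromBlocks_conjTranspose, fromBlocks_multiply, h1]
  · simp [fromBlocks_conjTranspose, fromBlocks_multiply, h2]
  · simp [hd, fromBlocks_conjTranspose, fromBlocks_multiply]

/-- If `2 C ≤ A - B` and `C ≥ 0`, then `[0, C]` is an off-diagonal block of a Hermitian matrix whose
spectrum is that of `A`, that of `B`, and any prescribed further eigenvalues. -/
lemma exists_hasEigs_fromBlocks {A B C : Matrix ι ι ℂ} {μ ν : ι → ℝ} (hA : HasEigs A μ)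
    (hB : HasEigs B ν) (hC : C.PosSemidef) (h : (A - B - (C + C)).PosSemidef) (η : κ → ℝ) :
    ∃ (P : Matrix ι ι ℂ) (Q : Matrix (κ ⊕ ι) (κ ⊕ ι) ℂ),
      HasEigs (fromBlocks P (fromCols 0 C) (fromCols 0 C)ᴴ Q) (Sum.elim μ (Sum.elim η ν)) := by
  have hR := hasRotation_of_posSemidef hA.isHermitian hB.isHermitian hC h
  obtain ⟨U, -, hU, rfl⟩ := hA
  obtain ⟨V, -, hV, rfl⟩ := hB
  obtain ⟨a, b, c, d, h1, h2, h3, h4⟩ := hR.of_conj hU hV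
  have h3' : c * aᴴ + d * bᴴ = 0 := by
    simpa using congr_arg conjTranspose h3
  let W : Matrix (ι ⊕ (κ ⊕ ι)) (ι ⊕ (κ ⊕ ι)) ℂ :=
    fromBlocks a (fromCols 0 b) (fromRows 0 c) (fromBlocks 1 0 0 d)
  have hWs : Wᴴ = fromBlocks aᴴ (fromCols 0 cᴴ) (fromRows 0 bᴴ) (fromBlocks 1 0 0 dᴴ) := by
    simp [W, fromBlocks_conjTranspose, conjTranspose_fromRows_eq_fromCols_conjTranspose,
      conjTranspose_fromCols_eq_fromRows_conjTranspose]
  have hW : W * Wᴴ = 1 := by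
    rw [hWs]
    simp only [W, fromBlocks_multiply, fromCols_mul_fromRows, mul_fromCols, fromRows_mul,
      fromBlocks_mul_fromRows, fromCols_mul_fromBlocks, Matrix.mul_zero, Matrix.zero_mul,
      Matrix.mul_one, zero_add, add_zero]
    rw [h1, ← fromBlocks_one]
    congr 1
    · ext i (j | j)
      · simp
      · exact congr_fun₂ h3 i j
    · ext (i | i) j
      · simp
      · exact congr_fun₂ h3' i j
    · rw [← fromBlocks_one, ← h2]
      ext (i | i) (j | j) <;> simp
  have hd : diagonal (fun i => ((Sum.elim μ (Sum.elim η ν) i : ℝ) : ℂ)) =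
      fromBlocks (diagonal fun i => (μ i : ℂ)) 0 0
        (fromBlocks (diagonal fun i => (η i : ℂ)) 0 0 (diagonal fun i => (ν i : ℂ))) := by
    rw [fromBlocks_diagonal, fromBlocks_diagonal]
    congr 1
    ext (i | i | i) <;> rfl
  let M := W * diagonal (fun i => ((Sum.elim μ (Sum.elim η ν) i : ℝ) : ℂ)) * Wᴴ
  have hM : HasEigs M (Sum.elim μ (Sum.elim η ν)) := ⟨W, hW, mul_eq_one_comm.1 hW, rfl⟩
  have hX : M.toBlocks₁₂ = fromCols 0 C := by
    simp only [M, hd, hWs, W, fromBlocks_multiply, toBlocks_fromBlocks₁₂, fromCols_mul_fromBlocks,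
      mul_fromCols, Matrix.mul_zero, Matrix.zero_mul, Matrix.mul_one, zero_add, add_zero, ← h4]
    ext i (j | j) <;> simp
  have hX' : M.toBlocks₂₁ = (fromCols 0 C)ᴴ := by
    rw [← hX]
    ext i j
    exact (hM.isHermitian.apply _ _).symm
  refine ⟨M.toBlocks₁₁, M.toBlocks₂₂, ?_⟩
  rwa [← hX', ← hX, fromBlocks_toBlocks]

end Spectrum

lemma StrictMono.val_le_val_fin {p n : ℕ} {f : Fin p → Fin n} (hf : StrictMono f) (i : Fin p) :
    (i : ℕ) ≤ f i := by
  obtain ⟨k, hk⟩ := i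
  induction k with
  | zero => exact Nat.zero_le _
  | succ k ih =>
    have h1 : f ⟨k, by omega⟩ < f ⟨k + 1, hk⟩ := hf (Fin.mk_lt_mk.2 k.lt_succ_self)
    exact (Nat.succ_le_succ (ih _)).trans h1

lemma StrictMono.val_fin_add_le {p n : ℕ} {f : Fin p → Fin n} (hf : StrictMono f) (k : ℕ)
    (i : Fin p) (hi : (i : ℕ) + k < p) : (f i : ℕ) + k < n := by
  induction k generalizing i with
  | zero => exact (f i).2
  | succ k ih =>
    have h1 : f i < f ⟨i + 1, by omega⟩ := hf (Fin.lt_def.2 (Nat.lt_succ_self _))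
    have h2 := ih ⟨i + 1, by omega⟩ (by simp only; omega)
    have h3 := Fin.lt_def.1 h1
    omega

lemma hasSVals_fromCols_zero {p m : ℕ} {s : ℕ → ℝ} {C : Matrix (Fin p) (Fin p) ℂ}
    (hsmono : ∀ a b, 1 ≤ a → a ≤ b → b ≤ p → s b ≤ s a) (hsnn : ∀ a, 1 ≤ a → a ≤ p → 0 ≤ s a)
    (hC : HasEigs C (fun i => s ((i : ℕ) + 1))) :
    HasSVals ((fromCols (0 : Matrix (Fin p) (Fin m) ℂ) C).submatrix id finSumFinEquiv.symm) p s := by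
  refine ⟨by simp, hsmono, hsnn, (finSumFinEquiv.symm.trans
    ((Equiv.sumComm (Fin m) (Fin p)).trans finSumFinEquiv)).trans
      (finCongr (by simp [Nat.add_comm])), ?_⟩
  have h1 : ((fromCols (0 : Matrix (Fin p) (Fin m) ℂ) C).submatrix id finSumFinEquiv.symm)ᴴ *
      (fromCols (0 : Matrix (Fin p) (Fin m) ℂ) C).submatrix id finSumFinEquiv.symm =
      (fromBlocks 0 0 0 (Cᴴ * C)).submatrix finSumFinEquiv.symm finSumFinEquiv.symm := by
    rw [conjTranspose_submatrix, conjTranspose_fromCols_eq_fromRows_conjTranspose]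
    refine (submatrix_mul_equiv _ _ _ (Equiv.refl _) _).trans ?_
    rw [fromRows_mul_fromCols]
    simp
  rw [h1]
  convert (hC.conjTranspose_mul_self.fromBlocks_zero (κ := Fin m)).submatrix finSumFinEquiv.symm
    using 1
  ext j
  obtain ⟨i | i, rfl⟩ := finSumFinEquiv.surjective j
  · simp
  · simp

end UnitaryOrbits

theorem stmt7 (p n : ℕ) (hp : 0 < p) (hpn : 2 * p ≤ n) (lam s : ℕ → ℝ)
    (hlmono : ∀ a b, 1 ≤ a → a ≤ b → b ≤ n → lam b ≤ lam a)
    (hsmono : ∀ a b, 1 ≤ a → a ≤ b → b ≤ p → s b ≤ s a)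
    (hsnn : ∀ a, 1 ≤ a → a ≤ p → 0 ≤ s a)
    (A B C : Matrix (Fin p) (Fin p) ℂ) (f g : Fin p → Fin n)
    (hf : StrictMono f) (hg : StrictMono g)
    (hA : HasEigs A (fun i => lam ((f i : ℕ) + 1)))
    (hB : HasEigs B (fun i => lam ((g i : ℕ) + 1)))
    (hC : HasEigs C (fun i => s ((i : ℕ) + 1)))
    (hle : (A - B - (C + C)).PosSemidef) :
    ∃ (P : Matrix (Fin p) (Fin p) ℂ) (X : Matrix (Fin p) (Fin (n - p)) ℂ)
      (Q : Matrix (Fin (n - p)) (Fin (n - p)) ℂ),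
      HasEigs (Matrix.fromBlocks P X X.conjTranspose Q)
        (fun i => lam ((finSumFinEquiv i : ℕ) + 1)) ∧
      HasSVals X p s := by
  have hA' : ∀ i : Fin p, lam ((f i : ℕ) + 1) ≤ lam ((i : ℕ) + 1) := fun i =>
    hlmono _ _ (by omega) (Nat.succ_le_succ (hf.val_le_val_fin i)) (f i).2
  obtain ⟨A', hA', hAA⟩ := hA.exists_ge hA'
  obtain ⟨m, hm⟩ : ∃ m, n - p = m + p := ⟨n - p - p, by omega⟩
  have hB' : ∀ i : Fin p, lam (p + (m + i) + 1) ≤ lam ((g i : ℕ) + 1) := fun i => by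
    have := hg.val_fin_add_le (p - 1 - i) i (by omega)
    exact hlmono _ _ (by omega) (by omega) (by omega)
  obtain ⟨B', hB', hBB⟩ := hB.exists_le hB'
  have hCp : C.PosSemidef := hC.posSemidef fun i => hsnn _ (by omega) i.2
  have hle' : (A' - B' - (C + C)).PosSemidef := by
    convert (hle.add hAA).add hBB using 1
    abel
  obtain ⟨P, Q, h⟩ := exists_hasEigs_fromBlocks hA' hB' hCp hle'
    fun i : Fin m => lam (p + i + 1)
  generalize n - p = q at *
  subst hm
  refine ⟨P, _, Q.submatrix finSumFinEquiv.symm finSumFinEquiv.symm, ?_,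
    hasSVals_fromCols_zero (m := m) hsmono hsnn hC⟩
  convert h.submatrix ((Equiv.refl (Fin p)).sumCongr finSumFinEquiv.symm) using 1
  · ext (i | i) (j | j) <;> rfl
  · ext (i | i)
    · simp
    · obtain ⟨i | i, rfl⟩ := finSumFinEquiv.surjective i <;> simp
end

section
/- Let λ, μ, ν be partitions with |λ| + |μ| = |ν|. Then c^ν_{λμ} ≤ c^{τ(ν,ν)}_{τ(λ,μ) τ(λ,μ)}, i.e., the Littlewood–Richardson coefficient of ν in the product indexed by (λ, μ) is at most the Littlewood–Richardson coefficient of τ(ν,ν) in the product indexed by (τ(λ,μ), τ(λ,μ)). -/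
/-- Cell `(i, j)` (0-indexed row `i`, column `j`) lies in the skew shape `ν/λ`. -/
def IsCell (lam nu : ℕ → ℕ) (i j : ℕ) : Prop := lam i ≤ j ∧ j < nu i

/-- `(i', j')` is weakly before `(i, j)` in the reverse reading order
(rows top to bottom, each row read right to left). -/
def ReadLE (i j i' j' : ℕ) : Prop := i' < i ∨ (i' = i ∧ j ≤ j')

/-- `T` is a semistandard skew tableau of shape `ν/λ` and content `μ` whose reverse
reading word is a lattice word.  Entries are positive on the shape, zero off the shape.
Parts of partitions are indexed from `0`; `μ k` is the number of entries equal to `k + 1`. -/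
def IsLRTableau (lam mu nu : ℕ → ℕ) (T : ℕ → ℕ → ℕ) : Prop :=
  (∀ i j, ¬ IsCell lam nu i j → T i j = 0) ∧
  (∀ i j, IsCell lam nu i j → 1 ≤ T i j) ∧
  (∀ i j j', IsCell lam nu i j → IsCell lam nu i j' → j ≤ j' → T i j ≤ T i j') ∧
  (∀ i j, IsCell lam nu i j → IsCell lam nu (i + 1) j → T i j < T (i + 1) j) ∧
  (∀ k : ℕ, {c : ℕ × ℕ | IsCell lam nu c.1 c.2 ∧ T c.1 c.2 = k + 1}.ncard = mu k) ∧
  (∀ i j k, IsCell lam nu i j →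
    {c : ℕ × ℕ | IsCell lam nu c.1 c.2 ∧ T c.1 c.2 = k + 2 ∧ ReadLE i j c.1 c.2}.ncard ≤
    {c : ℕ × ℕ | IsCell lam nu c.1 c.2 ∧ T c.1 c.2 = k + 1 ∧ ReadLE i j c.1 c.2}.ncard)

/-- The Littlewood–Richardson coefficient `c^ν_{λμ}`. -/
noncomputable def lrCoeff (lam mu nu : ℕ → ℕ) : ℕ :=
  Nat.card {T : ℕ → ℕ → ℕ // IsLRTableau lam mu nu T}

/-- The partition `λ(I) = (i_r - r, ..., i_2 - 2, i_1 - 1)` (parts indexed from 0)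
associated with a finite set `I = {i_1 < ... < i_r}` of positive integers. -/
def partOfSet (I : Finset ℕ) : ℕ → ℕ := fun t =>
  if t < I.card then (I.sort (· ≤ ·)).getD (I.card - 1 - t) 0 - (I.card - t) else 0

/-- `(I, J, K) ∈ LR_r^p` : triples of `r`-element subsets of `{1, ..., p}` with
`c^{λ(K)}_{λ(I) λ(J)} > 0`. -/
def LRTriple (r p : ℕ) (I J K : Finset ℕ) : Prop :=
  I ⊆ Finset.Icc 1 p ∧ J ⊆ Finset.Icc 1 p ∧ K ⊆ Finset.Icc 1 p ∧
  I.card = r ∧ J.card = r ∧ K.card = r ∧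
  0 < lrCoeff (partOfSet I) (partOfSet J) (partOfSet K)

/-- For finite sets `I = {i_1 < ... < i_r}` and `J = {j_1 < ... < j_r}` of positive
integers, `τ(I, J) = {2i_1 - 1, ..., 2i_r - 1} ∪ {2j_1, ..., 2j_r}`. -/
def tauSet (I J : Finset ℕ) : Finset ℕ :=
  I.image (fun i => 2 * i - 1) ∪ J.image (fun j => 2 * j)

/-- `f` is a partition: weakly decreasing with finitely many nonzero parts. -/
def IsPartition (f : ℕ → ℕ) : Prop :=
  (∀ i j, i ≤ j → f j ≤ f i) ∧ ∃ N, ∀ i, N ≤ i → f i = 0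

/-- The size `|λ|` of a partition: the sum of its parts. -/
noncomputable def partSize (f : ℕ → ℕ) : ℕ := ∑ᶠ i, f i

open Representation in
/-- The characters of the irreducible complex representations of `G`. -/
def irreducibleCharacters (G : Type) [Group G] : Set (G → ℂ) :=
  {f | ∃ (V : Type) (_ : AddCommGroup V) (_ : Module ℂ V) (_ : FiniteDimensional ℂ V)
    (ρ : Representation ℂ G V), IsIrreducible ρ ∧ f = ρ.character}

theorem trace_eq_add_trace_restrict {V : Type*} [AddCommGroup V] [Module ℂ V]
    [FiniteDimensional ℂ V] {p q : Submodule ℂ V} (h : IsCompl p q) (f : V →ₗ[ℂ] V)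
    (hp : ∀ v ∈ p, f v ∈ p) (hq : ∀ v ∈ q, f v ∈ q) :
    LinearMap.trace ℂ V f =
      LinearMap.trace ℂ p (f.restrict hp) + LinearMap.trace ℂ q (f.restrict hq) := by
  have hinternal : DirectSum.IsInternal (fun b : Bool => cond b p q) := by
    rw [DirectSum.isInternal_submodule_iff_isCompl _ (i := true) (j := false) (by simp)]
    · exact h
    · ext b; cases b <;> simp
  rw [LinearMap.trace_eq_sum_trace_restrict hinternal (f := f)
    (by rintro (_ | _) <;> [exact hq; exact hp])]
  simp

open Representation in
theorem character_mem_closure_irreducibleCharacters {G : Type} [Group G] [Finite G] (n : ℕ) :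
    ∀ (V : Type) [AddCommGroup V] [Module ℂ V] [FiniteDimensional ℂ V]
      (ρ : Representation ℂ G V), Module.finrank ℂ V = n →
      ρ.character ∈ AddSubgroup.closure (irreducibleCharacters G) := by
  induction n using Nat.strong_induction_on with
  | _ n ih =>
    intro V _ _ _ ρ hn
    by_cases hirr : IsIrreducible ρ
    · exact AddSubgroup.subset_closure ⟨V, _, _, inferInstance, ρ, hirr, rfl⟩
    by_cases htriv : Subsingleton V
    · have : ρ.character = 0 := by
        ext g
        simp [character, Subsingleton.elim (ρ g) 0]
      rw [this]
      exact zero_mem _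
    rw [not_subsingleton_iff_nontrivial] at htriv
    have hnt : Nontrivial (Subrepresentation ρ) := by
      refine ⟨⊥, ⊤, fun h => ?_⟩
      have := congrArg Subrepresentation.toSubmodule h
      exact bot_ne_top (α := Submodule ℂ V) this
    obtain ⟨W, hbot, htop⟩ : ∃ W : Subrepresentation ρ, W ≠ ⊥ ∧ W ≠ ⊤ := by
      by_contra! hcon
      exact hirr ⟨fun W => or_iff_not_imp_left.2 (hcon W)⟩
    have : NeZero (Nat.card G : ℂ) := ⟨by exact_mod_cast Nat.card_pos.ne'⟩
    obtain ⟨W', hW⟩ := exists_isCompl W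
    have hc : IsCompl W.toSubmodule W'.toSubmodule := by
      constructor
      · rw [disjoint_iff]
        exact congrArg Subrepresentation.toSubmodule hW.inf_eq_bot
      · rw [codisjoint_iff]
        exact congrArg Subrepresentation.toSubmodule hW.sup_eq_top
    have hchar : ρ.character = W.toRepresentation.character + W'.toRepresentation.character := by
      ext g
      exact trace_eq_add_trace_restrict hc (ρ g) (fun v hv => W.apply_mem_toSubmodule g hv)
        (fun v hv => W'.apply_mem_toSubmodule g hv)
    have hlt : ∀ U : Subrepresentation ρ, U ≠ ⊤ → Module.finrank ℂ U.toSubmodule < n := by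
      intro U hU
      rw [← hn]
      refine Submodule.finrank_lt fun h => hU ?_
      exact Subrepresentation.toSubmodule_injective h
    rw [hchar]
    refine add_mem (ih _ (hlt W htop) _ _ rfl) (ih _ (hlt W' ?_) _ _ rfl)
    rintro rfl
    exact hbot (by simpa using hW.inf_eq_bot)

open Representation in
theorem irreducibleCharacters_orthonormal {G : Type} [Group G] [Fintype G] {f f' : G → ℂ}
    (hf : f ∈ irreducibleCharacters G) (hf' : f' ∈ irreducibleCharacters G) [Decidable (f = f')] :
    (Nat.card G : ℂ)⁻¹ * ∑ g, f g * f' g⁻¹ = if f = f' then 1 else 0 := by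
  classical
  obtain ⟨V, _, _, _, ρ, hρ, rfl⟩ := hf
  obtain ⟨W, _, _, _, σ, hσ, rfl⟩ := hf'
  have : Invertible (Nat.card G : ℂ) :=
    invertibleOfNonzero (by exact_mod_cast Nat.card_pos.ne')
  split_ifs with h
  · rw [← h, char_orthonormal ρ ρ]
    simp [Nonempty.intro (Representation.Equiv.refl ρ)]
  · rw [char_orthonormal ρ σ, if_neg]
    rintro ⟨φ⟩
    exact h (char_iso φ).symm

open Representation in
/-- A virtual character of norm one is, up to sign, the character of a representation. -/
theorem exists_character_eq_or_neg {G : Type} [Group G] [Fintype G] {χ : G → ℂ}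
    (hχ : χ ∈ AddSubgroup.closure (irreducibleCharacters G))
    (hnorm : (Nat.card G : ℂ)⁻¹ * ∑ g, χ g * χ g⁻¹ = 1) :
    ∃ (V : Type) (_ : AddCommGroup V) (_ : Module ℂ V) (_ : FiniteDimensional ℂ V)
      (ρ : Representation ℂ G V), ∃ ε : ℤ, (ε = 1 ∨ ε = -1) ∧ ∀ g, ρ.character g = ε * χ g := by
  classical
  rw [← Submodule.span_int_eq_addSubgroupClosure, Submodule.mem_toAddSubgroup,
    ← Subtype.range_coe (s := irreducibleCharacters G), Finsupp.mem_span_range_iff_exists_finsupp]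
    at hχ
  obtain ⟨c, hc⟩ := hχ
  have hval : ∀ g, χ g = ∑ f ∈ c.support, (c f : ℂ) * (f : G → ℂ) g := by
    intro g
    rw [← hc, Finsupp.sum, Finset.sum_apply]
    simp
  have hsq : ∑ f ∈ c.support, (c f) ^ 2 = 1 := by
    have : (Nat.card G : ℂ)⁻¹ * ∑ g, χ g * χ g⁻¹ = ∑ f ∈ c.support, (c f : ℂ) ^ 2 := by
      simp_rw [hval, Finset.sum_mul_sum]
      rw [Finset.sum_comm, Finset.mul_sum]
      refine Finset.sum_congr rfl fun f hf => ?_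
      rw [Finset.sum_comm, Finset.mul_sum, Finset.sum_eq_single_of_mem f hf]
      · have := irreducibleCharacters_orthonormal f.2 f.2
        rw [if_pos rfl] at this
        calc _ = (c f : ℂ) ^ 2 * ((Nat.card G : ℂ)⁻¹ * ∑ g, (f : G → ℂ) g * (f : G → ℂ) g⁻¹) := by
              rw [Finset.mul_sum, Finset.mul_sum, Finset.mul_sum]
              exact Finset.sum_congr rfl fun _ _ => by ring
          _ = _ := by rw [this, mul_one]
      · intro f' _ hne
        have := irreducibleCharacters_orthonormal f.2 f'.2
        rw [if_neg (fun h => hne (Subtype.ext h.symm))] at this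
        calc _ = (c f : ℂ) * c f' *
                ((Nat.card G : ℂ)⁻¹ * ∑ g, (f : G → ℂ) g * (f' : G → ℂ) g⁻¹) := by
              rw [Finset.mul_sum, Finset.mul_sum, Finset.mul_sum]
              exact Finset.sum_congr rfl fun _ _ => by ring
          _ = _ := by rw [this, mul_zero]
    rw [hnorm] at this
    exact_mod_cast this.symm
  have hone : ∀ f ∈ c.support, 1 ≤ (c f) ^ 2 := fun f hf => by
    have := Finsupp.mem_support_iff.1 hf
    have := sq_pos_of_ne_zero this
    lia
  have hcard : c.support.card = 1 := by
    have h1 := Finset.sum_le_sum hone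
    rw [hsq] at h1
    have h2 : c.support.card ≠ 0 := by
      rw [Finset.card_ne_zero]
      by_contra hemp
      rw [Finset.not_nonempty_iff_eq_empty] at hemp
      simp [hemp] at hsq
    simp at h1
    lia
  obtain ⟨f, hf⟩ := Finset.card_eq_one.1 hcard
  rw [hf, Finset.sum_singleton, sq_eq_one_iff] at hsq
  obtain ⟨V, _, _, _, ρ, -, hρ⟩ := f.2
  refine ⟨V, _, _, inferInstance, ρ, c f, hsq, fun g => ?_⟩
  rw [hval, hf, Finset.sum_singleton, ← hρ]
  rcases hsq with h | h <;> simp [h]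

/-- If `θ` is an involution commuting with the idempotent `e`, then `|tr (θ e)| ≤ tr e`. -/
theorem exists_trace_involution_idempotent {V : Type*} [AddCommGroup V] [Module ℂ V]
    [FiniteDimensional ℂ V] (e θ : V →ₗ[ℂ] V) (he : e * e = e) (hθ : θ * θ = 1)
    (hcomm : θ * e = e * θ) :
    ∃ a b : ℕ, LinearMap.trace ℂ V e = a + b ∧ LinearMap.trace ℂ V (θ * e) = a - b := by
  have key : ∀ s : ℂ, s * s = 1 → ∃ a : ℕ,
      LinearMap.trace ℂ V ((2⁻¹ : ℂ) • (e + s • (θ * e))) = a := by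
    intro s hs
    have hid : IsIdempotentElem ((2⁻¹ : ℂ) • (e + s • (θ * e))) := by
      have h1 : e * (θ * e) = θ * e := by rw [← mul_assoc, ← hcomm, mul_assoc, he]
      have h2 : θ * e * (θ * e) = e := by rw [mul_assoc, h1, ← mul_assoc, hθ, one_mul]
      have h3 : θ * e * e = θ * e := by rw [mul_assoc, he]
      rw [IsIdempotentElem, smul_mul_smul_comm, add_mul, mul_add, mul_add, he, smul_mul_smul_comm,
        h2, hs, mul_smul_comm, h1, smul_mul_assoc, h3, one_smul]
      module
    exact ⟨_, (LinearMap.IsIdempotentElem.isProj_range _ hid).trace⟩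
  obtain ⟨a, ha⟩ := key 1 (by norm_num)
  obtain ⟨b, hb⟩ := key (-1) (by norm_num)
  simp only [map_smul, map_add, smul_eq_mul] at ha hb
  exact ⟨a, b, by rw [← ha, ← hb]; ring, by rw [← ha, ← hb]; ring⟩

open TensorProduct in
theorem trace_comm_comp_map {V : Type*} [AddCommGroup V] [Module ℂ V]
    [FiniteDimensional ℂ V] (f g : V →ₗ[ℂ] V) :
    LinearMap.trace ℂ (V ⊗[ℂ] V) ((TensorProduct.comm ℂ V V).toLinearMap * TensorProduct.map f g) =
      LinearMap.trace ℂ V (f * g) := by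
  let b := Module.finBasis ℂ V
  have hr : LinearMap.trace ℂ V (f * g) = ∑ i, ∑ j, b.repr (f (b j)) i * b.repr (g (b i)) j := by
    rw [LinearMap.trace_eq_matrix_trace ℂ b, LinearMap.toMatrix_mul, Matrix.trace]
    simp only [Matrix.diag_apply, Matrix.mul_apply, LinearMap.toMatrix_apply]
  rw [hr, LinearMap.trace_eq_matrix_trace ℂ (b.tensorProduct b), Matrix.trace,
    Fintype.sum_prod_type, Finset.sum_comm]
  refine Finset.sum_congr rfl fun i _ => Finset.sum_congr rfl fun j _ => ?_
  simp [LinearMap.toMatrix_apply]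

open TensorProduct Representation in
/-- The block swap acts as an involution on the space of `Perm X × Perm X`-invariants of
`V ⊗ V ⊗ S`; its trace and the dimension of that space are computed by characters. -/
theorem exists_sum_character_swap {X V S : Type} [Fintype X] [DecidableEq X]
    [AddCommGroup V] [Module ℂ V] [FiniteDimensional ℂ V]
    [AddCommGroup S] [Module ℂ S] [FiniteDimensional ℂ S]
    (ρ : Representation ℂ (Equiv.Perm X) V) (σ : Representation ℂ (Equiv.Perm (X ⊕ X)) S) :
    ∃ a b : ℕ,
      ((Nat.card (Equiv.Perm X) : ℂ) ^ 2)⁻¹ * ∑ g : Equiv.Perm X, ∑ h : Equiv.Perm X,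
        ρ.character g * ρ.character h * σ.character (Equiv.Perm.sumCongr g h) = a + b ∧
      ((Nat.card (Equiv.Perm X) : ℂ) ^ 2)⁻¹ * ∑ g : Equiv.Perm X, ∑ h : Equiv.Perm X,
        ρ.character (g * h) *
          σ.character (Equiv.sumComm X X * Equiv.Perm.sumCongr g h) = a - b := by
  classical
  let A : Equiv.Perm X × Equiv.Perm X → (V ⊗[ℂ] V) ⊗[ℂ] S →ₗ[ℂ] (V ⊗[ℂ] V) ⊗[ℂ] S := fun p =>
    TensorProduct.map (TensorProduct.map (ρ p.1) (ρ p.2)) (σ (Equiv.Perm.sumCongr p.1 p.2))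
  let s : Equiv.Perm (X ⊕ X) := Equiv.sumComm X X
  let θ : (V ⊗[ℂ] V) ⊗[ℂ] S →ₗ[ℂ] (V ⊗[ℂ] V) ⊗[ℂ] S :=
    TensorProduct.map (TensorProduct.comm ℂ V V).toLinearMap (σ s)
  let c : ℂ := ((Nat.card (Equiv.Perm X) : ℂ) ^ 2)⁻¹
  let e := c • ∑ p, A p
  have hA : ∀ p q, A p * A q = A (p * q) := by
    intro p q
    simp only [A, Prod.fst_mul, Prod.snd_mul, map_mul, ← Equiv.Perm.sumCongr_mul,
      TensorProduct.map_mul]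
  have hθA : ∀ p : Equiv.Perm X × Equiv.Perm X, θ * A p = A (p.2, p.1) * θ := by
    intro p
    have h1 : s * Equiv.Perm.sumCongr p.1 p.2 = Equiv.Perm.sumCongr p.2 p.1 * s := by
      ext x; cases x <;> simp [s]
    simp only [A, θ, ← TensorProduct.map_mul, ← map_mul, h1]
    congr 1
    ext x y
    simp
  have hc : c * (Nat.card (Equiv.Perm X) : ℂ) ^ 2 = 1 :=
    inv_mul_cancel₀ (pow_ne_zero 2 (by exact_mod_cast Nat.card_pos.ne'))
  have hsum : (∑ p, A p) * (∑ p, A p) = (Nat.card (Equiv.Perm X) : ℂ) ^ 2 • ∑ p, A p := by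
    rw [Finset.sum_mul_sum]
    have : ∀ p : Equiv.Perm X × Equiv.Perm X, ∑ q, A p * A q = ∑ q, A q := fun p => by
      simp_rw [hA]
      exact Fintype.sum_equiv (Equiv.mulLeft p) _ _ fun _ => rfl
    simp_rw [this]
    rw [Finset.sum_const, Finset.card_univ, ← Nat.cast_smul_eq_nsmul ℂ]
    congr 1
    rw [Fintype.card_prod, Nat.card_eq_fintype_card]
    push_cast
    ring
  have he : e * e = e := by
    simp only [e]
    rw [smul_mul_smul_comm, hsum, smul_smul, mul_assoc, hc, mul_one]
  have hθ : θ * θ = 1 := by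
    have h1 : s * s = 1 := by ext x; cases x <;> simp [s]
    simp only [θ, ← TensorProduct.map_mul, ← map_mul, h1, map_one]
    rw [← TensorProduct.map_one]
    congr 1
    ext x y
    simp
  have hcomm : θ * e = e * θ := by
    simp only [e]
    rw [mul_smul_comm, smul_mul_assoc, Finset.mul_sum, Finset.sum_mul]
    congr 1
    simp_rw [hθA]
    exact Fintype.sum_equiv (Equiv.prodComm _ _) _ _ fun _ => rfl
  obtain ⟨a, b, h1, h2⟩ := exists_trace_involution_idempotent e θ he hθ hcomm
  refine ⟨a, b, ?_, ?_⟩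
  · rw [← h1]
    simp only [e, map_smul, map_sum, smul_eq_mul]
    rw [← Fintype.sum_prod_type']
    congr 1
    refine Finset.sum_congr rfl fun p _ => ?_
    simp only [A, LinearMap.trace_tensorProduct', character]
  · rw [← h2]
    simp only [e, mul_smul_comm, Finset.mul_sum, map_smul, map_sum, smul_eq_mul]
    rw [← Fintype.sum_prod_type' (f := fun g h => c * (ρ.character (g * h) *
      σ.character (Equiv.sumComm X X * Equiv.Perm.sumCongr g h)))]
    refine Finset.sum_congr rfl fun p _ => ?_
    simp only [A, θ, ← TensorProduct.map_mul, ← map_mul, LinearMap.trace_tensorProduct',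
      trace_comm_comp_map, character, s]

open Finset in
/-- The number of points of each color. -/
def colorCount {X L : Type*} [Fintype X] [DecidableEq L] (f : X → L) (l : L) : ℕ :=
  #{x | f x = l}

open Finset in
theorem colorCount_comp_perm {X L : Type*} [Fintype X] [DecidableEq L]
    (f : X → L) (g : Equiv.Perm X) : colorCount (f ∘ g) = colorCount f := by
  ext l
  exact Finset.card_equiv g (by simp)

theorem exists_perm_comp_eq {X L : Type*} [Fintype X] [DecidableEq L]
    {f f' : X → L} (h : colorCount f = colorCount f') : ∃ g : Equiv.Perm X, f ∘ g = f' := by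
  have e (l : L) : Nonempty ({x // f' x = l} ≃ {x // f x = l}) := by
    classical
    rw [← Fintype.card_eq, Fintype.card_subtype, Fintype.card_subtype]
    exact (congrFun h l).symm
  refine ⟨Equiv.ofFiberEquiv (f := f') (g := f) fun l => (e l).some, ?_⟩
  ext x
  exact Equiv.ofFiberEquiv_map _ _

theorem exists_colorCount_eq {X L : Type*} [Fintype X] [Fintype L] [DecidableEq L]
    (c : L → ℕ) (hc : ∑ l, c l = Fintype.card X) : ∃ f : X → L, colorCount f = c := by
  have : Nonempty (X ≃ Σ l, Fin (c l)) := by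
    rw [← Fintype.card_eq]; simp [hc]
  obtain ⟨e⟩ := this
  refine ⟨fun x => (e x).1, ?_⟩
  ext l
  have h : colorCount (fun x => (e x).1) l = Finset.card {y : Σ l, Fin (c l) | y.1 = l} :=
    Finset.card_equiv e (by simp)
  rw [h, ← Fintype.card_subtype, Fintype.card_congr (Equiv.sigmaSubtype l)]
  simp

open Finset in
theorem card_perm_comp_eq {X L : Type*} [Fintype X] [DecidableEq X] [DecidableEq L]
    {f f' : X → L} (h : colorCount f = colorCount f') :
    #{g : Equiv.Perm X | f' ∘ g = f'} = #{g : Equiv.Perm X | f ∘ g = f'} := by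
  obtain ⟨g₀, hg₀⟩ := exists_perm_comp_eq h
  refine Finset.card_equiv (Equiv.mulLeft g₀) fun g => ?_
  simp [Equiv.Perm.coe_mul, ← Function.comp_assoc, hg₀]

open Finset in
/-- Burnside's count for the action on colorings with a given number of points of each color. -/
theorem sum_card_fixed_colorings {X L : Type*} [Fintype X] [DecidableEq X] [Fintype L]
    [DecidableEq L] (c : L → ℕ) (hc : ∑ l, c l = Fintype.card X) :
    ∑ f : X → L with colorCount f = c, #{g : Equiv.Perm X | f ∘ g = f} =
      (Fintype.card X).factorial := by
  obtain ⟨f₀, rfl⟩ := exists_colorCount_eq c hc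
  rw [← Fintype.card_perm, ← Finset.card_univ, Finset.card_eq_sum_card_fiberwise
    (s := univ) (t := {f : X → L | colorCount f = colorCount f₀})
    (f := fun g : Equiv.Perm X => f₀ ∘ g)]
  · exact Finset.sum_congr rfl fun f hf => card_perm_comp_eq ((mem_filter.1 hf).2.symm)
  · intro g _
    simp [colorCount_comp_perm]

/-- Laurent polynomials with variables indexed by `K`. -/
abbrev LaurentRing (K : Type*) := AddMonoidAlgebra ℂ (K → ℤ)

namespace LaurentRing

noncomputable section

set_option linter.unusedSectionVars false

open Finset

variable {X Y K K' : Type*} [Fintype X] [DecidableEq X] [Fintype Y] [DecidableEq Y]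
  [Fintype K] [DecidableEq K] [Fintype K'] [DecidableEq K']

/-- The monomial with the given exponent. -/
def mono (e : K → ℤ) : LaurentRing K := AddMonoidAlgebra.single e 1

theorem mono_mul_mono (e e' : K → ℤ) : mono e * mono e' = mono (e + e') := by
  simp [mono, AddMonoidAlgebra.single_mul_single]

theorem coeff_mono (e e' : K → ℤ) : (mono e).coeff e' = if e = e' then 1 else 0 := by
  simp [mono, Finsupp.single_apply]

theorem coeff_mono_mul (e e' : K → ℤ) (F : LaurentRing K) :
    (mono e * F).coeff e' = F.coeff (e' - e) := by
  have := AddMonoidAlgebra.coeff_single_mul_eq_mul_coeff (x := F) (r := (1 : ℂ)) (m₁ := e')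
    (m := e) (m₂ := e' - e) (by
      intro a _
      constructor <;> intro h
      · simp [← h]
      · simp [h])
  simpa [mono] using this

/-- The monomial of a coloring. -/
def colorMono (f : X → K) : LaurentRing K := mono fun k => (colorCount f k : ℤ)

/-- The sum of the monomials of the colorings fixed by a permutation, which is a product of
power sums. -/
def fixedPoly (K : Type*) [Fintype K] [DecidableEq K] (g : Equiv.Perm X) : LaurentRing K :=
  ∑ f : X → K with f ∘ g = f, colorMono f

/-- The complete homogeneous symmetric polynomial. -/
def complete (K : Type*) [Fintype K] [DecidableEq K] (n : ℤ) : LaurentRing K :=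
  if 0 ≤ n then ∑ c ∈ Finset.piAntidiag univ n.toNat, mono fun k : K => (c k : ℤ) else 0

theorem complete_natCast (n : ℕ) :
    complete K n = ∑ c ∈ Finset.piAntidiag univ n, mono fun k : K => (c k : ℤ) := by
  simp [complete]

theorem coeff_fixedPoly (g : Equiv.Perm X) (β : K → ℤ) :
    (fixedPoly K g).coeff β =
      #{f : X → K | f ∘ g = f ∧ (fun k => (colorCount f k : ℤ)) = β} := by
  simp [fixedPoly, colorMono, coeff_mono, AddMonoidAlgebra.coeff_sum, 
    Finsupp.finsetSum_apply, Finset.filter_filter]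

theorem fixedPoly_inv (g : Equiv.Perm X) : fixedPoly K g⁻¹ = fixedPoly K g := by
  refine Finset.sum_congr (Finset.filter_congr fun f _ => ?_) fun _ _ => rfl
  constructor <;> intro h
  · conv_lhs => rw [← h]
    ext x; simp
  · conv_lhs => rw [← h]
    ext x; simp

theorem colorCount_fst (F : X → K' × K) (k : K') :
    colorCount (fun x => (F x).1) k = ∑ k', colorCount F (k, k') := by
  simp only [colorCount]
  rw [Finset.card_eq_sum_card_fiberwise (t := univ) (f := fun x => (F x).2) (by simp)]
  simp [Finset.filter_filter, Prod.ext_iff]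

theorem colorCount_snd (F : X → K' × K) (k : K) :
    colorCount (fun x => (F x).2) k = ∑ k', colorCount F (k', k) := by
  simp only [colorCount]
  rw [Finset.card_eq_sum_card_fiberwise (t := univ) (f := fun x => (F x).1) (by simp)]
  simp [Finset.filter_filter, Prod.ext_iff, and_comm]

theorem mono_sum {ι : Type*} (s : Finset ι) (e : ι → K → ℤ) :
    mono (∑ i ∈ s, e i) = ∏ i ∈ s, mono (e i) := by
  classical
  induction s using Finset.induction_on with
  | empty => rfl
  | insert a s ha ih => rw [sum_insert ha, prod_insert ha, ← ih, mono_mul_mono]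

theorem sum_coeff_fixedPoly_smul_fixedPoly (β : K' → ℤ) (hβ : ∑ k, β k = Fintype.card X) :
    ∑ g : Equiv.Perm X, (fixedPoly K' g).coeff β • fixedPoly K g =
      ((Fintype.card X).factorial : ℂ) • ∏ k, complete K (β k) := by
  by_cases hneg : ∃ k, β k < 0
  · obtain ⟨k, hk⟩ := hneg
    have h1 : ∏ k, complete K (β k) = 0 :=
      prod_eq_zero (mem_univ k) (by simp [complete, not_le.2 hk])
    rw [h1, smul_zero]
    refine sum_eq_zero fun g _ => ?_
    rw [coeff_fixedPoly, filter_eq_empty_iff.2]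
    · simp
    · rintro f _ ⟨_, rfl⟩
      simp at hk
      omega
  push Not at hneg
  obtain ⟨b, rfl⟩ : ∃ b : K' → ℕ, β = fun k => (b k : ℤ) :=
    ⟨fun k => (β k).toNat, by ext k; simp [hneg k]⟩
  have hb : ∑ k, b k = Fintype.card X := by
    have : ∑ k, (b k : ℤ) = Fintype.card X := hβ
    exact_mod_cast this
  have h1 (g : Equiv.Perm X) :
      (fixedPoly K' g).coeff (fun k => (b k : ℤ)) • fixedPoly K g =
        ∑ F : X → K' × K with (colorCount (fun x => (F x).1) = b ∧ F ∘ g = F),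
          colorMono (fun x => (F x).2) := by
    rw [coeff_fixedPoly, Nat.cast_smul_eq_nsmul, ← sum_const, fixedPoly, ← sum_product']
    refine sum_bij' (fun p _ x => (p.1 x, p.2 x)) (fun F _ => (fun x => (F x).1, fun x => (F x).2))
      ?_ ?_ ?_ ?_ ?_
    · rintro ⟨p, q⟩ h
      simp only [mem_product, mem_filter, mem_univ, true_and, funext_iff, Nat.cast_inj,
        Function.comp, Prod.mk.injEq] at h ⊢
      exact ⟨h.1.2, fun x => ⟨h.1.1 x, h.2 x⟩⟩
    · intro F h
      simp only [mem_product, mem_filter, mem_univ, true_and, funext_iff, Nat.cast_inj,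
        Function.comp] at h ⊢
      exact ⟨⟨fun x => by rw [h.2], h.1⟩, fun x => by rw [h.2]⟩
    · intros; rfl
    · intros; rfl
    · intros; rfl
  simp only [h1, complete_natCast]
  rw [Finset.prod_univ_sum, smul_sum]
  have h2 : ∑ g : Equiv.Perm X, ∑ F : X → K' × K with
        (colorCount (fun x => (F x).1) = b ∧ F ∘ g = F), colorMono (fun x => (F x).2) =
      ∑ F : X → K' × K with colorCount (fun x => (F x).1) = b,
        #{g : Equiv.Perm X | F ∘ g = F} • colorMono (fun x => (F x).2) := by
    rw [sum_comm' (t' := {F : X → K' × K | colorCount (fun x => (F x).1) = b})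
      (s' := fun F => {g : Equiv.Perm X | F ∘ g = F}) (by simp [and_comm])]
    simp
  rw [h2, ← sum_fiberwise_of_maps_to
    (t := Fintype.piFinset fun k => piAntidiag (univ : Finset K) (b k))
    (g := fun F k k' => colorCount F (k, k'))]
  · refine sum_congr rfl fun c hc => ?_
    simp only [Fintype.mem_piFinset, mem_piAntidiag] at hc
    have h3 := sum_card_fixed_colorings (X := X) (fun p : K' × K => c p.1 p.2) (by
      rw [Fintype.sum_prod_type, ← hb]
      exact sum_congr rfl fun k _ => (hc k).1)
    have h4 : ({F : X → K' × K | colorCount (fun x => (F x).1) = b} : Finset _).filter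
        (fun F => (fun k k' => colorCount F (k, k')) = c) =
        ({F : X → K' × K | colorCount F = fun p => c p.1 p.2} : Finset _) := by
      ext F
      simp only [mem_filter, mem_univ, true_and, funext_iff, Prod.forall]
      refine ⟨fun h => h.2, fun h => ⟨fun k => ?_, h⟩⟩
      rw [colorCount_fst, ← (hc k).1]
      exact sum_congr rfl fun k' _ => h k k'
    rw [h4, ← h3, Nat.cast_smul_eq_nsmul, sum_smul]
    refine sum_congr rfl fun F hF => ?_
    congr 1
    rw [← mono_sum, colorMono]
    congr 1
    ext k
    have hF' := (mem_filter.1 hF).2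
    rw [colorCount_snd, Finset.sum_apply, hF']
    simp
  · intro F hF
    have hF' := (mem_filter.1 hF).2
    simp only [Fintype.mem_piFinset, mem_piAntidiag]
    intro k
    refine ⟨?_, by simp⟩
    rw [← hF', colorCount_fst]

end

end LaurentRing

namespace LaurentRing

noncomputable section

set_option linter.unusedSectionVars false

open Finset Equiv

variable {X Y K K' : Type*} [Fintype X] [DecidableEq X] [Fintype Y] [DecidableEq Y]
  [Fintype K] [DecidableEq K] [Fintype K'] [DecidableEq K']

theorem colorCount_sum (f : X ⊕ Y → K) (k : K) :
    colorCount f k = colorCount (f ∘ Sum.inl) k + colorCount (f ∘ Sum.inr) k := by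
  simp only [colorCount]
  rw [← Finset.card_disjSum]
  congr 1
  ext x
  rcases x with x | x <;> simp

theorem fixedPoly_sumCongr (g : Perm X) (h : Perm Y) :
    fixedPoly K (Perm.sumCongr g h) = fixedPoly K g * fixedPoly K h := by
  rw [fixedPoly, fixedPoly, fixedPoly, sum_mul_sum, ← sum_product']
  refine sum_bij' (fun f _ => (f ∘ Sum.inl, f ∘ Sum.inr)) (fun p _ => Sum.elim p.1 p.2)
    ?_ ?_ ?_ ?_ ?_
  · intro f hf
    simp only [mem_filter, mem_univ, true_and, mem_product, funext_iff, Function.comp] at hf ⊢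
    exact ⟨fun x => by simpa using hf (Sum.inl x), fun x => by simpa using hf (Sum.inr x)⟩
  · rintro ⟨a, b⟩ hf
    simp only [mem_filter, mem_univ, true_and, mem_product, funext_iff, Function.comp] at hf ⊢
    rintro (x | x)
    · simpa using hf.1 x
    · simpa using hf.2 x
  · intro f _
    simp
  · rintro ⟨a, b⟩ _
    simp
  · intro f _
    rw [colorMono, colorMono, colorMono, mono_mul_mono]
    congr 1
    ext k
    simp [colorCount_sum f k]

theorem coeff_fixedPoly_swap (g h : Perm X) (β : K → ℤ) :
    (fixedPoly K (sumComm X X * Perm.sumCongr g h : Perm (X ⊕ X))).coeff β =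
      #{f : X → K | f ∘ (g * h : Perm X) = f ∧ (fun k => 2 * (colorCount f k : ℤ)) = β} := by
  rw [coeff_fixedPoly]
  congr 1
  have key (b : X → K) (k : K) : colorCount (Sum.elim (b ∘ g) b) k = 2 * colorCount b k := by
    rw [colorCount_sum, Sum.elim_comp_inl, Sum.elim_comp_inr, colorCount_comp_perm, two_mul]
  have split (f : X ⊕ X → K) (hf : f ∘ (sumComm X X * Perm.sumCongr g h : Perm (X ⊕ X)) = f) :
      Sum.elim ((f ∘ Sum.inr) ∘ g) (f ∘ Sum.inr) = f := by
    ext x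
    rcases x with x | x
    · simpa using congrFun hf (Sum.inl x)
    · rfl
  refine Finset.card_bij' (fun f _ => f ∘ Sum.inr) (fun b _ => Sum.elim (b ∘ g) b) ?_ ?_ ?_ ?_
  all_goals simp only [mem_filter, mem_univ, true_and]
  · rintro f ⟨hf, rfl⟩
    have e1 (x : X) : f (Sum.inr (g x)) = f (Sum.inl x) := by simpa using congrFun hf (Sum.inl x)
    have e2 (x : X) : f (Sum.inl (h x)) = f (Sum.inr x) := by simpa using congrFun hf (Sum.inr x)
    refine ⟨funext fun x => by simp [e1, e2], funext fun k => ?_⟩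
    have := key (f ∘ Sum.inr) k
    rw [split f hf] at this
    simp [this]
  · rintro b ⟨hb, rfl⟩
    refine ⟨funext fun x => ?_, funext fun k => ?_⟩
    · rcases x with x | x
      · simp
      · simpa using congrFun hb x
    · rw [key]; simp
  · rintro f ⟨hf, rfl⟩
    exact split f hf
  · intros; rfl

/-- The alternant with exponent `d`. -/
def alternant (d : K → ℤ) : LaurentRing K := ∑ w : Perm K, ((Perm.sign w : ℤ) : ℂ) • mono (d ∘ w)

/-- The virtual character of a permutation group given by the coefficient of `l` in an
alternant times a product of power sums. -/
def virtualCharacter (l d : K → ℤ) (g : Perm X) : ℂ := (alternant d * fixedPoly K g).coeff l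

/-- The Jacobi--Trudi determinant. -/
def jacobiTrudi (K : Type*) [Fintype K] [DecidableEq K] (l d : K' → ℤ) : LaurentRing K :=
  ∑ w : Perm K', ((Perm.sign w : ℤ) : ℂ) • ∏ k, complete K (l k - d (w k))

theorem coeff_alternant_mul (d l : K → ℤ) (F : LaurentRing K) :
    (alternant d * F).coeff l = ∑ w : Perm K, ((Perm.sign w : ℤ) : ℂ) * F.coeff (l - d ∘ w) := by
  rw [alternant, sum_mul, AddMonoidAlgebra.coeff_sum, Finsupp.finsetSum_apply]
  refine sum_congr rfl fun w _ => ?_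
  rw [smul_mul_assoc, AddMonoidAlgebra.coeff_smul, Finsupp.smul_apply, coeff_mono_mul, smul_eq_mul]

theorem virtualCharacter_inv (l d : K → ℤ) (g : Perm X) :
    virtualCharacter l d g⁻¹ = virtualCharacter l d g := by
  rw [virtualCharacter, virtualCharacter, fixedPoly_inv]

theorem sum_virtualCharacter_smul (l d : K' → ℤ) (h : ∑ k, l k - ∑ k, d k = Fintype.card X) :
    ∑ g : Perm X, virtualCharacter l d g • fixedPoly K g =
      ((Fintype.card X).factorial : ℂ) • jacobiTrudi K l d := by
  simp only [virtualCharacter, coeff_alternant_mul, sum_smul, mul_smul, jacobiTrudi, smul_sum]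
  rw [sum_comm]
  refine sum_congr rfl fun w _ => ?_
  rw [← smul_sum, sum_coeff_fixedPoly_smul_fixedPoly, smul_comm]
  · rfl
  · simp only [Pi.sub_apply, sum_sub_distrib, Function.comp]
    rw [Equiv.sum_comp w d, h]

/-- Linearity of the coefficient functional. -/
theorem coeff_mul_sum_smul {ι : Type*} (s : Finset ι) (F : LaurentRing K) (c : ι → ℂ)
    (G : ι → LaurentRing K) (l : K → ℤ) :
    (F * ∑ i ∈ s, c i • G i).coeff l = ∑ i ∈ s, c i * (F * G i).coeff l := by
  rw [mul_sum, AddMonoidAlgebra.coeff_sum, Finsupp.finsetSum_apply]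
  refine sum_congr rfl fun i _ => ?_
  rw [mul_smul_comm, AddMonoidAlgebra.coeff_smul, Finsupp.smul_apply, smul_eq_mul]

theorem sum_virtualCharacter_mul_self (l d : K → ℤ)
    (h : ∑ k, l k - ∑ k, d k = Fintype.card X) :
    (Nat.card (Perm X) : ℂ)⁻¹ * ∑ g : Perm X, virtualCharacter l d g * virtualCharacter l d g⁻¹ =
      (alternant d * jacobiTrudi K l d).coeff l := by
  simp only [virtualCharacter_inv]
  conv_lhs => enter [2, 2, g, 2]; rw [virtualCharacter]
  rw [← coeff_mul_sum_smul, sum_virtualCharacter_smul l d h, mul_smul_comm,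
    AddMonoidAlgebra.coeff_smul, Finsupp.smul_apply, Nat.card_eq_fintype_card, Fintype.card_perm,
    smul_eq_mul, inv_mul_cancel_left₀ (by exact_mod_cast Nat.factorial_ne_zero _)]

theorem sum_virtualCharacter_sumCongr (l d : K → ℤ) (l' d' : K' → ℤ)
    (h : ∑ k, l' k - ∑ k, d' k = Fintype.card X) :
    ((Nat.card (Perm X) : ℂ) ^ 2)⁻¹ * ∑ g : Perm X, ∑ h : Perm X, virtualCharacter l' d' g *
        virtualCharacter l' d' h * virtualCharacter l d (Perm.sumCongr g h) =
      (alternant d * jacobiTrudi K l' d' * jacobiTrudi K l' d').coeff l := by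
  have h1 (g h : Perm X) : virtualCharacter l d (Perm.sumCongr g h) =
      ((alternant d * fixedPoly K g) * fixedPoly K h).coeff l := by
    rw [virtualCharacter, fixedPoly_sumCongr, mul_assoc]
  simp only [h1, mul_assoc (virtualCharacter l' d' _), ← mul_sum]
  simp only [← coeff_mul_sum_smul, sum_virtualCharacter_smul l' d' h]
  simp only [mul_right_comm (alternant d) (fixedPoly K _)]
  rw [← coeff_mul_sum_smul, sum_virtualCharacter_smul l' d' h]
  simp only [mul_smul_comm, smul_mul_assoc, AddMonoidAlgebra.coeff_smul, Finsupp.smul_apply]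
  have hne : ((Fintype.card X).factorial : ℂ) ≠ 0 := by
    exact_mod_cast Nat.factorial_ne_zero _
  rw [Nat.card_eq_fintype_card, Fintype.card_perm, smul_eq_mul, smul_eq_mul]
  field_simp

theorem coeff_fixedPoly_comp_equiv (e : K' ≃ K) (g : Perm X) (β : K → ℤ) :
    (fixedPoly K' g).coeff (β ∘ e) = (fixedPoly K g).coeff β := by
  rw [coeff_fixedPoly, coeff_fixedPoly]
  congr 1
  refine Finset.card_equiv (Equiv.arrowCongr (Equiv.refl X) e) fun f => ?_
  have h1 (k : K') : colorCount (e ∘ f) (e k) = colorCount f k := by simp [colorCount]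
  simp only [mem_filter, mem_univ, true_and, funext_iff, arrowCongr_apply, Function.comp,
    coe_refl, refl_symm, id, EmbeddingLike.apply_eq_iff_eq]
  rw [← e.forall_congr_right (q := fun k => (colorCount (((Equiv.refl X).arrowCongr e) f) k : ℤ) = β k)]
  refine and_congr_right fun _ => forall_congr' fun k => ?_
  rw [← h1]
  rfl

theorem virtualCharacter_comp_equiv (e e' : K' ≃ K) (l d : K → ℤ) (g : Perm X) :
    virtualCharacter (l ∘ e) (d ∘ e') g =
      ((Perm.sign (e.symm.trans e') : ℤ) : ℂ) * virtualCharacter l d g := by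
  rw [virtualCharacter, virtualCharacter, coeff_alternant_mul, coeff_alternant_mul, mul_sum]
  refine Fintype.sum_equiv (Equiv.equivCongr e e') _ _ fun u => ?_
  have h1 : Equiv.equivCongr e e' u = ((e.symm.trans u).trans e).trans (e.symm.trans e') := by
    ext x; simp
  have h2 : Perm.sign (Equiv.equivCongr e e' u) = Perm.sign (e.symm.trans e') * Perm.sign u := by
    rw [h1, Perm.sign_trans, Perm.sign_symm_trans_trans]
  have h3 : (l - d ∘ (Equiv.equivCongr e e' u)) ∘ e = l ∘ e - (d ∘ e') ∘ u := by
    ext x; simp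
  rw [← coeff_fixedPoly_comp_equiv e, h3, h2, ← mul_assoc]
  congr 1
  have : ((Perm.sign (e.symm.trans e') : ℤ) : ℂ) * ((Perm.sign (e.symm.trans e') : ℤ) : ℂ) = 1 := by
    exact_mod_cast Int.units_coe_mul_self _
  push_cast
  rw [← mul_assoc, this, one_mul]

theorem virtualCharacter_swap (l₁ d₁ : K → ℤ) (l₂ d₂ : K' → ℤ) (g h : Perm X) :
    virtualCharacter (Sum.elim (fun k => 2 * l₁ k) (fun k => 2 * l₂ k + 1))
        (Sum.elim (fun k => 2 * d₁ k) (fun k => 2 * d₂ k + 1))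
        (sumComm X X * Perm.sumCongr g h : Perm (X ⊕ X)) =
      ∑ u₁ : Perm K, ∑ u₂ : Perm K', ((Perm.sign u₁ : ℤ) : ℂ) * ((Perm.sign u₂ : ℤ) : ℂ) *
        (fixedPoly (K ⊕ K') (g * h)).coeff (Sum.elim (l₁ - d₁ ∘ u₁) (l₂ - d₂ ∘ u₂)) := by
  rw [virtualCharacter, coeff_alternant_mul, ← Fintype.sum_prod_type']
  symm
  refine Finset.sum_of_injOn (fun u : Perm K × Perm K' => Perm.sumCongr u.1 u.2) ?_ (by simp) ?_ ?_
  · exact (Perm.sumCongrHom_injective (α := K) (β := K')).injOn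
  · intro w _ hw
    rw [coeff_fixedPoly_swap, filter_eq_empty_iff.2]
    · simp
    · rintro f _ ⟨_, hf⟩
      refine hw ?_
      have hr : w ∈ (Perm.sumCongrHom K K').range := by
        refine Perm.mem_sumCongrHom_range_of_perm_mapsTo_inl ?_
        rintro _ ⟨k, rfl⟩
        have := congrFun hf (Sum.inl k)
        rcases hwk : w (Sum.inl k) with k' | k'
        · exact ⟨k', rfl⟩
        · simp [hwk] at this
          omega
      obtain ⟨u, hu⟩ := hr
      exact ⟨u, by simp, hu⟩
  · rintro ⟨u₁, u₂⟩ _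
    rw [coeff_fixedPoly_swap, coeff_fixedPoly, Perm.sign_sumCongr]
    push_cast
    congr 3
    ext f
    simp only [mem_filter, mem_univ, true_and, funext_iff, Sum.forall]
    refine and_congr_right fun _ => and_congr (forall_congr' fun k => ?_) (forall_congr' fun k => ?_)
    · simp
      omega
    · simp
      omega

theorem sum_virtualCharacter_swap {K₁ K₂ : Type*} [Fintype K₁] [DecidableEq K₁] [Fintype K₂]
    [DecidableEq K₂] (l₁ d₁ : K₁ → ℤ) (l₂ d₂ : K₂ → ℤ) (l d : K → ℤ)
    (hs : ∑ k, l₁ k - ∑ k, d₁ k + (∑ k, l₂ k - ∑ k, d₂ k) = Fintype.card X) :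
    ((Nat.card (Perm X) : ℂ) ^ 2)⁻¹ * ∑ g : Perm X, ∑ h : Perm X, virtualCharacter l d (g * h) *
        virtualCharacter (Sum.elim (fun k => 2 * l₁ k) (fun k => 2 * l₂ k + 1))
          (Sum.elim (fun k => 2 * d₁ k) (fun k => 2 * d₂ k + 1))
          (sumComm X X * Perm.sumCongr g h : Perm (X ⊕ X)) =
      (alternant d * jacobiTrudi K l₁ d₁ * jacobiTrudi K l₂ d₂).coeff l := by
  have hne : ((Fintype.card X).factorial : ℂ) ≠ 0 := by
    exact_mod_cast Nat.factorial_ne_zero _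
  simp only [virtualCharacter_swap]
  have h1 (g : Perm X) (φ : Perm X → ℂ) : ∑ h : Perm X, φ (g * h) = ∑ h, φ h :=
    Equiv.sum_comp (Equiv.mulLeft g) φ
  have h2 (g : Perm X) := h1 g (fun k => virtualCharacter l d k *
    ∑ u₁ : Perm K₁, ∑ u₂ : Perm K₂, ((Perm.sign u₁ : ℤ) : ℂ) * ((Perm.sign u₂ : ℤ) : ℂ) *
        (fixedPoly (K₁ ⊕ K₂) k).coeff (Sum.elim (l₁ - d₁ ∘ u₁) (l₂ - d₂ ∘ u₂)))
  simp only [h2, sum_const, card_univ, nsmul_eq_mul, Nat.card_eq_fintype_card, Fintype.card_perm]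
  have h3 (u₁ : Perm K₁) (u₂ : Perm K₂) :
      ∑ k : Perm X, (fixedPoly (K₁ ⊕ K₂) k).coeff (Sum.elim (l₁ - d₁ ∘ u₁) (l₂ - d₂ ∘ u₂)) *
        virtualCharacter l d k = ((Fintype.card X).factorial : ℂ) *
          (alternant d * ((∏ k, complete K (l₁ k - d₁ (u₁ k))) *
            ∏ k, complete K (l₂ k - d₂ (u₂ k)))).coeff l := by
    simp only [virtualCharacter]
    rw [← coeff_mul_sum_smul, sum_coeff_fixedPoly_smul_fixedPoly, mul_smul_comm,
      AddMonoidAlgebra.coeff_smul, Finsupp.smul_apply, smul_eq_mul, Fintype.prod_sum_type]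
    · rfl
    · rw [Fintype.sum_sum_type]
      simp only [Sum.elim_inl, Sum.elim_inr, Pi.sub_apply, Function.comp, sum_sub_distrib]
      rw [Equiv.sum_comp u₁ d₁, Equiv.sum_comp u₂ d₂, hs]
  have h4 : ∑ k : Perm X, virtualCharacter l d k *
      ∑ u₁ : Perm K₁, ∑ u₂ : Perm K₂, ((Perm.sign u₁ : ℤ) : ℂ) * ((Perm.sign u₂ : ℤ) : ℂ) *
        (fixedPoly (K₁ ⊕ K₂) k).coeff (Sum.elim (l₁ - d₁ ∘ u₁) (l₂ - d₂ ∘ u₂)) =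
      ((Fintype.card X).factorial : ℂ) *
        (alternant d * (jacobiTrudi K l₁ d₁ * jacobiTrudi K l₂ d₂)).coeff l := by
    simp only [mul_sum]
    rw [sum_comm, jacobiTrudi, sum_mul, mul_sum, AddMonoidAlgebra.coeff_sum,
      Finsupp.finsetSum_apply, mul_sum]
    refine sum_congr rfl fun u₁ _ => ?_
    rw [sum_comm, jacobiTrudi, mul_sum, mul_sum, AddMonoidAlgebra.coeff_sum,
      Finsupp.finsetSum_apply, mul_sum]
    refine sum_congr rfl fun u₂ _ => ?_
    rw [smul_mul_smul_comm, mul_smul_comm, AddMonoidAlgebra.coeff_smul, Finsupp.smul_apply,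
      smul_eq_mul, mul_left_comm, ← h3, mul_sum]
    exact sum_congr rfl fun k _ => by ring
  rw [h4, ← mul_assoc (alternant d)]
  field_simp

end

end LaurentRing

theorem card_fixed_mem_closure {G H : Type} [Group G] [Finite G] [Fintype H] [DecidableEq H]
    (φ : G →* Equiv.Perm H) :
    (fun g => (Finset.card {x | φ g x = x} : ℂ)) ∈ AddSubgroup.closure (irreducibleCharacters G) := by
  let ρ : Representation ℂ G (H → ℂ) :=
    { toFun := fun g => LinearMap.funLeft ℂ ℂ (φ g⁻¹)
      map_one' := by ext; simp
      map_mul' := fun g h => by ext; simp [LinearMap.funLeft] }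
  have h : ρ.character = fun g => (Finset.card {x | φ g x = x} : ℂ) := by
    ext g
    rw [Representation.character, LinearMap.trace_eq_matrix_trace ℂ (Pi.basisFun ℂ H), Matrix.trace,
      Finset.card_filter, Nat.cast_sum]
    refine Finset.sum_congr rfl fun x _ => ?_
    have hx : (φ g)⁻¹ x = x ↔ φ g x = x := by rw [Equiv.Perm.inv_eq_iff_eq, eq_comm]
    simp only [Matrix.diag_apply, LinearMap.toMatrix_apply, ρ, LinearMap.funLeft, map_inv,
      Pi.basisFun_repr, Pi.basisFun_apply, MonoidHom.coe_mk, OneHom.coe_mk, LinearMap.coe_mk,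
      AddHom.coe_mk, Function.comp, Pi.single_apply, hx, Nat.cast_ite, Nat.cast_one, Nat.cast_zero]
  rw [← h]
  exact character_mem_closure_irreducibleCharacters _ _ ρ rfl

namespace LaurentRing

open Finset Equiv

theorem coeff_fixedPoly_mem_closure {X K : Type} [Fintype X] [DecidableEq X] [Fintype K]
    [DecidableEq K] (β : K → ℤ) :
    (fun g : Perm X => (fixedPoly K g).coeff β) ∈
      AddSubgroup.closure (irreducibleCharacters (Perm X)) := by
  let H := {f : X → K // (fun k => (colorCount f k : ℤ)) = β}
  let act (g : Perm X) (f : H) : H := ⟨f.1 ∘ (g⁻¹ : Perm X), by rw [colorCount_comp_perm]; exact f.2⟩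
  let φ : Perm X →* Perm H := MonoidHom.toHomPerm
    { toFun := act
      map_one' := rfl
      map_mul' := fun _ _ => rfl }
  convert card_fixed_mem_closure φ using 3 with g
  rw [← fixedPoly_inv, coeff_fixedPoly, ← Fintype.card_subtype, ← Fintype.card_subtype]
  congr 1
  refine Fintype.card_congr ((Equiv.subtypeEquivRight fun f => and_comm).trans
    ((Equiv.subtypeSubtypeEquivSubtypeInter _ _).symm.trans
      (Equiv.subtypeEquivRight fun f => ?_)))
  rw [Subtype.ext_iff]
  rfl

theorem virtualCharacter_mem_closure {X K : Type} [Fintype X] [DecidableEq X] [Fintype K]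
    [DecidableEq K] (l d : K → ℤ) :
    (fun g : Perm X => virtualCharacter l d g) ∈
      AddSubgroup.closure (irreducibleCharacters (Perm X)) := by
  have h : (fun g : Perm X => virtualCharacter l d g) =
      ∑ w : Perm K, (Perm.sign w : ℤ) • fun g : Perm X => (fixedPoly K g).coeff (l - d ∘ w) := by
    ext g
    simp [virtualCharacter, coeff_alternant_mul]
  rw [h]
  exact sum_mem fun w _ => zsmul_mem (coeff_fixedPoly_mem_closure _) _

/-- The inequality between multiplicities obtained from the block swap, in terms of
coefficients of products of Jacobi--Trudi determinants. -/
theorem norm_coeff_le_norm_coeff {X K K' K₁ K₂ : Type} [Fintype X] [DecidableEq X] [Fintype K]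
    [DecidableEq K] [Fintype K'] [DecidableEq K'] [Fintype K₁] [DecidableEq K₁] [Fintype K₂]
    [DecidableEq K₂] (l d : K → ℤ) (l' d' : K' → ℤ) (l₁ d₁ : K₁ → ℤ) (l₂ d₂ : K₂ → ℤ)
    (e e' : K₁ ⊕ K₂ ≃ K')
    (hl : l' ∘ e = Sum.elim (fun k => 2 * l₁ k) (fun k => 2 * l₂ k + 1))
    (hd : d' ∘ e' = Sum.elim (fun k => 2 * d₁ k) (fun k => 2 * d₂ k + 1))
    (hs : ∑ k, l k - ∑ k, d k = Fintype.card X)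
    (hs' : ∑ k, l' k - ∑ k, d' k = Fintype.card (X ⊕ X))
    (hs₁₂ : ∑ k, l₁ k - ∑ k, d₁ k + (∑ k, l₂ k - ∑ k, d₂ k) = Fintype.card X)
    (h1 : (alternant d * jacobiTrudi K l d).coeff l = 1)
    (h1' : (alternant d' * jacobiTrudi K' l' d').coeff l' = 1) :
    ‖(alternant d * jacobiTrudi K l₁ d₁ * jacobiTrudi K l₂ d₂).coeff l‖ ≤
      ‖(alternant d' * jacobiTrudi K' l d * jacobiTrudi K' l d).coeff l'‖ := by
  obtain ⟨V, _, _, _, ρ, ε, hε, hρ⟩ := exists_character_eq_or_neg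
    (virtualCharacter_mem_closure (X := X) l d) (by rw [sum_virtualCharacter_mul_self l d hs, h1])
  obtain ⟨S, _, _, _, σ, ε', hε', hσ⟩ := exists_character_eq_or_neg
    (virtualCharacter_mem_closure (X := X ⊕ X) l' d')
    (by rw [sum_virtualCharacter_mul_self l' d' hs', h1'])
  obtain ⟨a, b, hab, hab'⟩ := exists_sum_character_swap ρ σ
  have ns (s : ℤ) (hs : s = 1 ∨ s = -1) : ‖(s : ℂ)‖ = 1 := by
    rcases hs with rfl | rfl <;> simp
  have hD : (a + b : ℂ) = ε * ε * ε' *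
      (alternant d' * jacobiTrudi K' l d * jacobiTrudi K' l d).coeff l' := by
    rw [← hab, ← sum_virtualCharacter_sumCongr (X := X) l' d' l d hs]
    simp only [hρ, hσ, mul_sum]
    exact sum_congr rfl fun g _ => sum_congr rfl fun h _ => by ring
  have hC : (a - b : ℂ) = ε * ε' * ((Perm.sign (e.symm.trans e') : ℤ) : ℂ) *
      (alternant d * jacobiTrudi K l₁ d₁ * jacobiTrudi K l₂ d₂).coeff l := by
    rw [← hab', ← sum_virtualCharacter_swap (X := X) l₁ d₁ l₂ d₂ l d hs₁₂, ← hl, ← hd]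
    have : ((Perm.sign (e.symm.trans e') : ℤ) : ℂ) * ((Perm.sign (e.symm.trans e') : ℤ) : ℂ) =
        1 := by
      exact_mod_cast Int.units_coe_mul_self _
    simp only [virtualCharacter_comp_equiv, hρ, hσ, mul_sum]
    refine sum_congr rfl fun g _ => sum_congr rfl fun h _ => ?_
    generalize ((Perm.sign (e.symm.trans e') : ℤ) : ℂ) = s at this
    linear_combination (-((Nat.card (Perm X) : ℂ) ^ 2)⁻¹ * ε * virtualCharacter l d (g * h) * ε' *
      virtualCharacter l' d' (sumComm X X * Perm.sumCongr g h : Perm (X ⊕ X))) * this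
  have hle : ‖(a - b : ℂ)‖ ≤ ‖(a + b : ℂ)‖ := by
    have e1 : (a - b : ℂ) = ((a - b : ℝ) : ℂ) := by push_cast; ring
    have e2 : (a + b : ℂ) = ((a + b : ℝ) : ℂ) := by push_cast; ring
    rw [e1, e2, Complex.norm_real, Complex.norm_real, Real.norm_eq_abs, Real.norm_eq_abs,
      abs_of_nonneg (by positivity : (0 : ℝ) ≤ a + b), abs_le]
    constructor <;> nlinarith [Nat.cast_nonneg (α := ℝ) a, Nat.cast_nonneg (α := ℝ) b]
  rw [hD, hC] at hle
  simpa only [norm_mul, one_mul, ns ε hε, ns ε' hε', ns _ (Int.isUnit_iff.1 (Units.isUnit _))] using hle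

end LaurentRing

namespace LaurentRing

noncomputable section

set_option linter.unusedSectionVars false

open Finset Equiv

variable {K : Type*} [Fintype K] [DecidableEq K]

/-- Permutation of the variables. -/
def permHom (w : Perm K) : LaurentRing K →+* LaurentRing K :=
  AddMonoidAlgebra.mapDomainRingHom ℂ
    ({ toFun := fun e => e ∘ w, map_zero' := rfl, map_add' := fun _ _ => rfl } :
      (K → ℤ) →+ (K → ℤ))

theorem permHom_mono (w : Perm K) (e : K → ℤ) : permHom w (mono e) = mono (e ∘ w) := by
  simp [permHom, mono]

theorem permHom_smul (w : Perm K) (c : ℂ) (F : LaurentRing K) :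
    permHom w (c • F) = c • permHom w F := by
  simp [permHom]

theorem coeff_permHom (w : Perm K) (F : LaurentRing K) (e : K → ℤ) :
    (permHom w F).coeff (e ∘ w) = F.coeff e := by
  induction F using AddMonoidAlgebra.induction_linear with
  | zero => simp
  | add F G hF hG => simp [hF, hG]
  | single a r =>
    have h : (AddMonoidAlgebra.single a r : LaurentRing K) = r • mono a := by simp [mono]
    have h2 : a ∘ w = e ∘ w ↔ a = e := w.surjective.injective_comp_right.eq_iff
    rw [h, permHom_smul, permHom_mono]
    simp [coeff_mono, h2]

/-- Invariance under permutations of the variables. -/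
def IsSymm (F : LaurentRing K) : Prop := ∀ w, permHom w F = F

/-- Change of sign under transpositions of the variables. -/
def IsAlternating (F : LaurentRing K) : Prop := ∀ i j, i ≠ j → permHom (swap i j) F = -F

theorem IsAlternating.mul {F G : LaurentRing K} (hF : IsAlternating F) (hG : IsSymm G) :
    IsAlternating (F * G) := fun i j h => by rw [map_mul, hF i j h, hG, neg_mul]

theorem IsAlternating.coeff_comp_swap {F : LaurentRing K} (hF : IsAlternating F) {i j : K}
    (h : i ≠ j) (e : K → ℤ) : F.coeff (e ∘ swap i j) = -F.coeff e := by
  rw [← coeff_permHom (swap i j) F e, hF i j h]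
  simp

theorem isAlternating_alternant (d : K → ℤ) : IsAlternating (alternant d) := by
  intro i j h
  rw [alternant, map_sum, ← sum_neg_distrib]
  refine Fintype.sum_equiv (Equiv.mulRight (swap i j)) _ _ fun w => ?_
  rw [permHom_smul, permHom_mono, coe_mulRight, Perm.sign_mul, Perm.sign_swap h]
  simp [Function.comp_assoc]

theorem isSymm_complete (n : ℤ) : IsSymm (complete K n) := by
  intro w
  rw [complete]
  split_ifs
  · rw [map_sum]
    refine sum_equiv (Equiv.arrowCongr w.symm (Equiv.refl ℕ)) (fun c => ?_) fun c _ => ?_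
    · simp only [mem_piAntidiag, mem_univ, implies_true, and_true]
      rw [← Equiv.sum_comp w c]
      rfl
    · rw [permHom_mono]
      rfl
  · simp

theorem IsSymm.mul {F G : LaurentRing K} (hF : IsSymm F) (hG : IsSymm G) :
    IsSymm (F * G) := fun w => by rw [map_mul, hF, hG]

theorem isSymm_prod {ι : Type*} (s : Finset ι) (F : ι → LaurentRing K) (h : ∀ i, IsSymm (F i)) :
    IsSymm (∏ i ∈ s, F i) := fun w => by
  rw [map_prod]; exact prod_congr rfl fun i _ => h i w

theorem isSymm_jacobiTrudi {K' : Type*} [Fintype K'] [DecidableEq K'] (l d : K' → ℤ) :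
    IsSymm (jacobiTrudi K l d) := fun w => by
  rw [jacobiTrudi, map_sum]
  exact sum_congr rfl fun u _ => by
    rw [permHom_smul, isSymm_prod _ _ (fun k => isSymm_complete _)]

/-- Only nonnegative exponents occur. -/
def IsPoly (F : LaurentRing K) : Prop := ∀ e, F.coeff e ≠ 0 → ∀ k, 0 ≤ e k

theorem isPoly_mono {e : K → ℤ} (he : ∀ k, 0 ≤ e k) : IsPoly (mono e) := by
  intro e' h
  rw [coeff_mono] at h
  split_ifs at h with h2
  · exact h2 ▸ he
  · exact absurd rfl h

theorem IsPoly.mul {F G : LaurentRing K} (hF : IsPoly F) (hG : IsPoly G) : IsPoly (F * G) := by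
  intro e he k
  have := AddMonoidAlgebra.support_coeff_mul_subset F G (Finsupp.mem_support_iff.2 he)
  obtain ⟨a, ha, b, hb, rfl⟩ := Finset.mem_add.1 this
  exact add_nonneg (hF a (Finsupp.mem_support_iff.1 ha) k) (hG b (Finsupp.mem_support_iff.1 hb) k)

theorem isPoly_sum {ι : Type*} (s : Finset ι) (F : ι → LaurentRing K)
    (h : ∀ i ∈ s, IsPoly (F i)) : IsPoly (∑ i ∈ s, F i) := by
  intro e he
  rw [AddMonoidAlgebra.coeff_sum, Finsupp.finsetSum_apply] at he
  obtain ⟨i, hi, h2⟩ := exists_ne_zero_of_sum_ne_zero he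
  exact h i hi e h2

theorem isPoly_prod {ι : Type*} (s : Finset ι) (F : ι → LaurentRing K)
    (h : ∀ i, IsPoly (F i)) : IsPoly (∏ i ∈ s, F i) := by
  classical
  induction s using Finset.induction_on with
  | empty => exact isPoly_mono (e := 0) fun _ => le_rfl
  | insert a s ha ih => rw [prod_insert ha]; exact (h a).mul ih

theorem IsPoly.smul {F : LaurentRing K} (hF : IsPoly F) (c : ℂ) : IsPoly (c • F) := by
  intro e he
  refine hF e fun h => he ?_
  simp [h]

theorem isPoly_complete (n : ℤ) : IsPoly (complete K n) := by
  rw [complete]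
  split_ifs
  · exact isPoly_sum _ _ fun c _ => isPoly_mono fun k => by positivity
  · intro e he; simp at he

theorem isPoly_jacobiTrudi {K' : Type*} [Fintype K'] [DecidableEq K'] (l d : K' → ℤ) :
    IsPoly (jacobiTrudi K l d) :=
  isPoly_sum _ _ fun _ _ => (isPoly_prod _ _ fun _ => isPoly_complete _).smul _

theorem isPoly_alternant {d : K → ℤ} (hd : ∀ k, 0 ≤ d k) : IsPoly (alternant d) :=
  isPoly_sum _ _ fun w _ => (isPoly_mono fun k => hd (w k)).smul _

end

end LaurentRing

namespace LaurentRing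

noncomputable section

open Finset Equiv
open scoped Classical

/-- The strictly decreasing exponent attached to a partition. -/
def expo (N : ℕ) (κ : ℕ → ℕ) (i : Fin N) : ℤ := κ i + (N - 1 - i)

theorem complete_fin (N n : ℕ) : complete (Fin N) n =
    ∑ c ∈ piAntidiag (range N) n, mono fun i : Fin N => (c i : ℤ) := by
  rw [complete_natCast]
  refine sum_bij' (fun c _ i => if h : i < N then c ⟨i, h⟩ else 0) (fun c _ i => c i)
    ?_ ?_ ?_ ?_ ?_
  · intro c hc
    simp only [mem_piAntidiag, mem_range] at hc ⊢
    refine ⟨?_, fun i hi => by by_contra h; simp [h] at hi⟩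
    rw [← hc.1, Finset.sum_range]
    simp
  · intro c hc
    simp only [mem_piAntidiag, mem_range, mem_univ, implies_true, and_true] at hc ⊢
    rw [← hc.1, Finset.sum_range]
  · intro c _
    simp
  · intro c hc
    simp only [mem_piAntidiag, mem_range] at hc
    ext i
    by_cases h : i < N
    · simp [h]
    · simp only [h, dite_false]
      by_contra h2
      exact h (hc.2 i (Ne.symm h2))
  · intro c _
    simp

theorem coeff_mul_complete_fin {N : ℕ} (F : LaurentRing (Fin N)) (n : ℕ) (e : Fin N → ℤ) :
    (F * complete (Fin N) n).coeff e =
      ∑ c ∈ piAntidiag (range N) n, F.coeff fun i => e i - c i := by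
  rw [complete_fin, mul_sum, AddMonoidAlgebra.coeff_sum, Finsupp.finsetSum_apply]
  refine sum_congr rfl fun c _ => ?_
  rw [mul_comm, coeff_mono_mul]
  rfl

/-- Exchange two consecutive entries of the exponent `expo N ν - c`. -/
def exchange (ν : ℕ → ℕ) (i : ℕ) (c : ℕ → ℕ) (t : ℕ) : ℕ :=
  if t = i then c (i + 1) + (ν i - ν (i + 1) + 1)
  else if t = i + 1 then c i - (ν i - ν (i + 1) + 1) else c t

theorem sum_exchange {N : ℕ} {ν : ℕ → ℕ} {i : ℕ} {c : ℕ → ℕ} (hi : i + 1 < N)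
    (h : ν i - ν (i + 1) < c i) : ∑ t ∈ range N, exchange ν i c t = ∑ t ∈ range N, c t := by
  have hsub : ({i, i + 1} : Finset ℕ) ⊆ range N := by
    intro t ht
    simp only [mem_insert, mem_singleton, mem_range] at ht ⊢
    omega
  rw [← sum_sdiff hsub, ← sum_sdiff hsub (f := c), sum_pair (by omega), sum_pair (by omega)]
  congr 1
  · refine sum_congr rfl fun t ht => ?_
    simp only [mem_sdiff, mem_insert, mem_singleton, not_or] at ht
    simp [exchange, ht.2.1, ht.2.2]
  · simp only [exchange]
    simp
    omega

theorem sum_bad_eq_zero {N : ℕ} {F : LaurentRing (Fin N)} (hF : IsAlternating F)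
    {ν : ℕ → ℕ} (hν : Antitone ν) (n : ℕ) :
    ∑ c ∈ piAntidiag (range N) n with ∃ i, i + 1 < N ∧ ν i - ν (i + 1) < c i,
      F.coeff (fun i => expo N ν i - c i) = 0 := by
  classical
  let P (c : ℕ → ℕ) (i : ℕ) : Prop := i + 1 < N ∧ ν i - ν (i + 1) < c i
  have hex : ∀ c ∈ (piAntidiag (range N) n).filter (fun c => ∃ i, P c i), ∃ i, P c i :=
    fun c hc => (mem_filter.1 hc).2
  have hmin (c) (hc : ∃ i, P c i) (hc' : ∃ i, P (exchange ν (Nat.find hc) c) i) :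
      Nat.find hc' = Nat.find hc := by
    have hs := Nat.find_spec hc
    rw [Nat.find_eq_iff]
    refine ⟨⟨hs.1, by simp [exchange]; omega⟩, fun t ht h2 => ?_⟩
    have hm := Nat.find_min hc ht
    simp only [P, exchange] at h2 hm
    rw [if_neg (by omega), if_neg (by omega)] at h2
    exact hm h2
  have hexc (c) (hc : ∃ i, P c i) : ∃ i, P (exchange ν (Nat.find hc) c) i := by
    have hs := Nat.find_spec hc
    exact ⟨Nat.find hc, hs.1, by simp [exchange]; omega⟩
  have hsum (c) (hc : c ∈ (piAntidiag (range N) n).filter (fun c => ∃ i, P c i)) :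
      F.coeff (fun i => expo N ν i - c i) +
      F.coeff (fun i => expo N ν i - exchange ν (Nat.find (hex c hc)) c i) = 0 := by
    have hs := Nat.find_spec (hex c hc)
    set i := Nat.find (hex c hc)
    have hne : (⟨i, by omega⟩ : Fin N) ≠ ⟨i + 1, hs.1⟩ := by simp
    rw [← neg_eq_iff_add_eq_zero, ← hF.coeff_comp_swap hne]
    congr 1
    ext t
    have hνi := hν (Nat.le_succ i)
    rcases t with ⟨t, ht⟩
    have := hs.2
    by_cases h1 : t = i
    · subst h1
      simp [expo, exchange, swap_apply_left]
      simp only [Nat.succ_eq_add_one] at hνi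
      omega
    by_cases h2 : t = i + 1
    · subst h2
      simp [expo, exchange, swap_apply_right]
      simp only [Nat.succ_eq_add_one] at hνi
      omega
    · simp [expo, exchange, swap_apply_of_ne_of_ne, h1, h2]
  refine sum_involution (fun c hc => exchange ν (Nat.find (hex c hc)) c) ?_ ?_ ?_ ?_
  · exact hsum
  · intro c hc h0 h1
    have := hsum c hc
    rw [h1] at this
    exact h0 (by linear_combination this / 2)
  · intro c hc
    have hs := Nat.find_spec (hex c hc)
    have hc' := (mem_filter.1 hc).1
    simp only [mem_piAntidiag, mem_range] at hc'
    refine mem_filter.2 ⟨?_, hexc c (hex c hc)⟩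
    simp only [mem_piAntidiag, mem_range]
    refine ⟨by rw [sum_exchange hs.1 hs.2, hc'.1], fun t ht => ?_⟩
    by_contra hN
    rw [exchange, if_neg (by have := hs.1; omega), if_neg (by have := hs.1; omega)] at ht
    exact hN (hc'.2 t ht)
  · intro c hc
    have hs := Nat.find_spec (hex c hc)
    rw [hmin c (hex c hc)]
    ext t
    simp only [exchange]
    by_cases h1 : t = Nat.find (hex c hc)
    · subst h1
      simp
      omega
    by_cases h2 : t = Nat.find (hex c hc) + 1
    · subst h2
      simp
    · simp [h1, h2]

/-- The partitions `κ` with at most `N` parts such that `ν/κ` is a horizontal strip. -/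
def strips (N : ℕ) (ν : ℕ → ℕ) : Finset (ℕ → ℕ) :=
  (Fintype.piFinset fun i : Fin N => Icc (ν (i + 1)) (ν i)).image
    fun c i => if h : i < N then c ⟨i, h⟩ else 0

theorem mem_strips {N : ℕ} {ν κ : ℕ → ℕ} (hN : ∀ i, N ≤ i → ν i = 0) :
    κ ∈ strips N ν ↔ ∀ i, κ i ≤ ν i ∧ ν (i + 1) ≤ κ i := by
  simp only [strips, mem_image, Fintype.mem_piFinset, mem_Icc]
  constructor
  · rintro ⟨c, hc, rfl⟩ i
    by_cases h : i < N
    · simpa [h, and_comm] using hc ⟨i, h⟩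
    · simp [h, hN (i + 1) (by omega)]
  · intro h
    refine ⟨fun i => κ i, fun i => ⟨(h i).2, (h i).1⟩, ?_⟩
    ext i
    by_cases hi : i < N
    · simp [hi]
    · have := (h i).1
      rw [hN i (by omega)] at this
      simp [hi]
      omega

/-- Pieri's rule for alternating polynomials. -/
theorem coeff_mul_complete {N : ℕ} {F : LaurentRing (Fin N)} (hF : IsAlternating F)
    (hF' : IsPoly F) {ν : ℕ → ℕ} (hν : Antitone ν) (hN : ∀ i, N ≤ i → ν i = 0) (n : ℤ) :
    (F * complete (Fin N) n).coeff (expo N ν) =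
      ∑ κ ∈ strips N ν with ∑ i ∈ range N, ((ν i : ℤ) - κ i) = n, F.coeff (expo N κ) := by
  by_cases hn : n < 0
  · rw [complete, if_neg (by omega), filter_eq_empty_iff.2]
    · simp
    · intro κ hκ h
      rw [mem_strips hN] at hκ
      have : 0 ≤ ∑ i ∈ range N, ((ν i : ℤ) - κ i) :=
        sum_nonneg fun i _ => by have := (hκ i).1; omega
      omega
  lift n to ℕ using by omega
  rw [coeff_mul_complete_fin, ← sum_filter_add_sum_filter_not _
    (fun c => ∃ i, i + 1 < N ∧ ν i - ν (i + 1) < c i), sum_bad_eq_zero hF hν, zero_add]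
  symm
  refine sum_of_injOn (fun κ i => ν i - κ i) ?_ ?_ ?_ ?_
  · intro κ hκ κ' hκ' h
    simp only [coe_filter, Set.mem_ofPred_eq, mem_strips hN] at hκ hκ'
    ext i
    have h1 := congrFun h i
    have h2 := hκ.1 i
    have h3 := hκ'.1 i
    simp only at h1
    omega
  · intro κ hκ
    simp only [coe_filter, Set.mem_ofPred_eq, mem_strips hN] at hκ
    simp only [coe_filter, Set.mem_ofPred_eq, mem_piAntidiag, mem_range]
    refine ⟨⟨?_, fun i hi => ?_⟩, ?_⟩
    · zify
      rw [← hκ.2]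
      exact sum_congr rfl fun i _ => by have := (hκ.1 i).1; omega
    · by_contra h
      have := hN i (by omega)
      omega
    · rintro ⟨i, _, h⟩
      have := hκ.1 i
      omega
  · intro c hc hnot
    simp only [mem_filter, mem_piAntidiag, mem_range] at hc
    by_contra hne
    have hpos := hF' _ hne
    refine hnot ⟨fun i => ν i - c i, ?_, ?_⟩
    · have hle (i : ℕ) : c i ≤ ν i - ν (i + 1) := by
        by_cases h1 : i + 1 < N
        · by_contra h2
          exact hc.2 ⟨i, h1, by omega⟩
        · by_cases h2 : i < N
          · have := hpos ⟨i, h2⟩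
            simp only [expo] at this
            rw [hN (i + 1) (by omega)]
            omega
          · by_contra h3
            exact h2 (hc.1.2 i (by omega))
      simp only [coe_filter, Set.mem_ofPred_eq, mem_strips hN]
      have hν' (i : ℕ) := hν (Nat.le_succ i)
      simp only [Nat.succ_eq_add_one] at hν'
      refine ⟨fun i => ?_, ?_⟩
      · have := hle i
        have := hν' i
        omega
      · rw [← hc.1.1]
        push_cast
        exact sum_congr rfl fun i _ => by have := hle i; omega
    · ext i
      simp only
      by_cases h1 : i + 1 < N
      · have : ¬ (ν i - ν (i + 1) < c i) := fun h => hc.2 ⟨i, h1, h⟩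
        omega
      · by_cases h2 : i < N
        · have := hpos ⟨i, h2⟩
          simp only [expo] at this
          omega
        · by_contra h3
          have : c i ≠ 0 := by
            have := hN i (by omega)
            omega
          exact h2 (hc.1.2 i this)
  · intro κ hκ
    simp only [mem_filter, mem_strips hN] at hκ
    congr 1
    ext i
    have := (hκ.1 i).1
    simp only [expo]
    omega

end

end LaurentRing

namespace LaurentRing

noncomputable section

open Finset Equiv
open scoped Classical

/-- Chains of partitions ending in `ν`, constant from step `R` on, in which consecutive terms
differ by horizontal strips. -/
def chains (N : ℕ) : ℕ → (ℕ → ℕ) → Finset (ℕ → ℕ → ℕ)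
  | 0, ν => {fun _ => ν}
  | R + 1, ν => (strips N ν).biUnion fun κ =>
      (chains N R κ).image fun c k => if k ≤ R then c k else ν

/-- The size of the `k`-th strip of a chain. -/
def stripSize (N : ℕ) (c : ℕ → ℕ → ℕ) (k : ℕ) : ℤ := ∑ i ∈ range N, ((c (k + 1) i : ℤ) - c k i)

theorem eq_zero_of_mem_strips {N : ℕ} {ν κ : ℕ → ℕ} (hN : ∀ i, N ≤ i → ν i = 0)
    (h : κ ∈ strips N ν) (i : ℕ) (hi : N ≤ i) : κ i = 0 := by
  have := ((mem_strips hN).1 h i).1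
  have := hN i hi
  omega

theorem antitone_of_mem_strips {N : ℕ} {ν κ : ℕ → ℕ} (hN : ∀ i, N ≤ i → ν i = 0)
    (h : κ ∈ strips N ν) : Antitone κ := by
  refine antitone_nat_of_succ_le fun i => ?_
  have h1 := ((mem_strips hN).1 h i).2
  have h2 := ((mem_strips hN).1 h (i + 1)).1
  omega

theorem mem_chains {N R : ℕ} {ν : ℕ → ℕ} {c : ℕ → ℕ → ℕ} (hN : ∀ i, N ≤ i → ν i = 0) :
    c ∈ chains N R ν ↔ (∀ k, R ≤ k → c k = ν) ∧
      ∀ k < R, ∀ i, c k i ≤ c (k + 1) i ∧ c (k + 1) (i + 1) ≤ c k i := by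
  induction R generalizing ν c with
  | zero => simp [chains, funext_iff]
  | succ R ih =>
    simp only [chains, mem_biUnion, mem_image]
    constructor
    · rintro ⟨κ, hκ, c, hc, rfl⟩
      rw [ih (eq_zero_of_mem_strips hN hκ)] at hc
      refine ⟨fun k hk => if_neg (by omega), fun k hk i => ?_⟩
      by_cases h : k < R
      · simpa [h.le, Nat.succ_le_of_lt h] using hc.2 k h i
      · obtain rfl : k = R := by omega
        simpa [hc.1 k le_rfl] using (mem_strips hN).1 hκ i
    · rintro ⟨h1, h2⟩
      have hκ : c R ∈ strips N ν := by
        rw [mem_strips hN]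
        simpa [h1 (R + 1) le_rfl] using h2 R (by omega)
      refine ⟨c R, hκ, fun k => if k ≤ R then c k else c R, ?_, ?_⟩
      · rw [ih (eq_zero_of_mem_strips hN hκ)]
        refine ⟨fun k hk => ?_, fun k hk i => ?_⟩
        · split_ifs with h
          · rw [le_antisymm h hk]
          · rfl
        · simpa [hk.le, Nat.succ_le_of_lt hk] using h2 k (by omega) i
      · ext k : 1
        by_cases h : k ≤ R
        · simp [h]
        · simp only [h, if_false]
          exact (h1 k (by omega)).symm

theorem coeff_mul_prod_complete {N R : ℕ} {F : LaurentRing (Fin N)} (hF : IsAlternating F)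
    (hF' : IsPoly F) {ν : ℕ → ℕ} (hν : Antitone ν) (hN : ∀ i, N ≤ i → ν i = 0) (β : Fin R → ℤ) :
    (F * ∏ k, complete (Fin N) (β k)).coeff (expo N ν) =
      ∑ c ∈ chains N R ν with ∀ k : Fin R, stripSize N c k = β k, F.coeff (expo N (c 0)) := by
  induction R generalizing ν with
  | zero => simp [chains]
  | succ R ih =>
    rw [Fin.prod_univ_castSucc, ← mul_assoc, coeff_mul_complete
      (hF.mul (isSymm_prod _ _ fun _ => isSymm_complete _))
      (hF'.mul (isPoly_prod _ _ fun _ => isPoly_complete _)) hν hN, chains, sum_filter, sum_filter,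
      sum_biUnion]
    · refine sum_congr rfl fun κ hκ => ?_
      have hκN := eq_zero_of_mem_strips hN hκ
      have hinj : Set.InjOn (fun (c : ℕ → ℕ → ℕ) k => if k ≤ R then c k else ν)
          (chains N R κ) := by
        intro c hc c' hc' h
        rw [mem_coe, mem_chains hκN] at hc hc'
        ext k : 1
        by_cases hk : k ≤ R
        · simpa [hk] using congrFun h k
        · rw [hc.1 k (by omega), hc'.1 k (by omega)]
      rw [sum_image hinj]
      have hsize (c) (hc : c ∈ chains N R κ) :
          (∀ k : Fin (R + 1), stripSize N (fun k => if k ≤ R then c k else ν) k = β k) ↔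
          (∀ k : Fin R, stripSize N c k = β k.castSucc) ∧
            ∑ i ∈ range N, ((ν i : ℤ) - κ i) = β (Fin.last R) := by
        rw [mem_chains hκN] at hc
        rw [Fin.forall_fin_succ']
        refine and_congr (forall_congr' fun k => ?_) ?_
        · have := k.2
          simp [stripSize, this.le, Nat.succ_le_of_lt this]
        · simp [stripSize, hc.1 R le_rfl]
      split_ifs with h
      · rw [ih (antitone_of_mem_strips hN hκ) hκN, sum_filter]
        refine sum_congr rfl fun c hc => ?_
        simp [hsize c hc, h]
      · exact (sum_eq_zero fun c hc => if_neg (by rw [hsize c hc]; exact fun h' => h h'.2)).symm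
    · intro κ hκ κ' hκ' hne
      rw [Function.onFun, disjoint_left]
      intro c hc hc'
      simp only [mem_image] at hc hc'
      obtain ⟨a, ha, rfl⟩ := hc
      obtain ⟨b, hb, h⟩ := hc'
      rw [mem_chains (eq_zero_of_mem_strips hN hκ)] at ha
      rw [mem_chains (eq_zero_of_mem_strips hN hκ')] at hb
      refine hne ?_
      rw [← ha.1 R le_rfl, ← hb.1 R le_rfl]
      simpa using (congrFun h R).symm

/-- The sign of the permutation sorting `v` into `l`, or zero. -/
def sortSign {R : ℕ} (l v : Fin R → ℤ) : ℂ :=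
  ∑ w : Perm (Fin R), if l ∘ w = v then ((Perm.sign w : ℤ) : ℂ) else 0

theorem sortSign_comp_swap {R : ℕ} (l v : Fin R → ℤ) {i j : Fin R} (h : i ≠ j) :
    sortSign l (v ∘ swap i j) = -sortSign l v := by
  rw [sortSign, sortSign, ← sum_neg_distrib]
  refine Fintype.sum_equiv (Equiv.mulRight (swap i j)) _ _ fun w => ?_
  have h1 : l ∘ w = v ∘ swap i j ↔ l ∘ (w * swap i j : Perm (Fin R)) = v := by
    constructor
    · intro h
      rw [Perm.coe_mul, ← Function.comp_assoc, h]
      ext x; simp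
    · intro h
      rw [← h]
      ext x; simp
  simp only [coe_mulRight, h1, Perm.sign_mul, Perm.sign_swap h]
  split_ifs <;> simp

theorem sortSign_of_strictAnti {R : ℕ} {l v : Fin R → ℤ} (hl : StrictAnti l) (hv : StrictAnti v) :
    sortSign l v = if l = v then 1 else 0 := by
  rw [sortSign, sum_eq_single 1]
  · simp
  · intro w _ hw
    rw [if_neg]
    rintro rfl
    refine hw ?_
    have hmono : StrictMono w := fun a b hab => by
      have := hv hab
      exact hl.lt_iff_gt.1 this
    exact Equiv.ext fun _ => hmono.apply_eq
  · simp

theorem coeff_mul_jacobiTrudi {N R : ℕ} {F : LaurentRing (Fin N)} (hF : IsAlternating F)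
    (hF' : IsPoly F) {ν : ℕ → ℕ} (hν : Antitone ν) (hN : ∀ i, N ≤ i → ν i = 0)
    (l d : Fin R → ℤ) :
    (F * jacobiTrudi (Fin N) l d).coeff (expo N ν) =
      ∑ c ∈ chains N R ν, F.coeff (expo N (c 0)) * sortSign l fun k => stripSize N c k + d k := by
  have h1 : jacobiTrudi (Fin N) l d = ∑ w : Perm (Fin R), ((Perm.sign w : ℤ) : ℂ) •
      ∏ k, complete (Fin N) (l (w k) - d k) := by
    refine Fintype.sum_equiv (Equiv.inv _) _ _ fun w => ?_
    rw [Equiv.inv_apply, Perm.sign_inv,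
      ← Equiv.prod_comp w (fun k => complete (Fin N) (l ((w⁻¹ : Perm (Fin R)) k) - d k))]
    simp
  rw [h1, coeff_mul_sum_smul]
  simp only [coeff_mul_prod_complete hF hF' hν hN, sortSign, mul_sum, sum_filter]
  rw [sum_comm]
  refine sum_congr rfl fun c _ => sum_congr rfl fun w _ => ?_
  have h2 : (∀ k : Fin R, stripSize N c k = l (w k) - d k) ↔
      l ∘ w = fun k : Fin R => stripSize N c k + d k := by
    rw [funext_iff]
    refine forall_congr' fun k => ?_
    simp only [Function.comp]
    omega
  simp only [h2]
  split_ifs <;> ring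

end

end LaurentRing

/-- `ν/κ` is a horizontal strip. -/
def IsStrip (κ ν : ℕ → ℕ) : Prop := ∀ i, κ i ≤ ν i ∧ ν (i + 1) ≤ κ i

namespace Toggle

open Finset

/-- Failure of the lattice condition in row `i` for two consecutive strips `M/A` and `B/M`. -/
def Fails (A M B : ℕ → ℕ) (i : ℕ) : Prop :=
  ∑ t ∈ range i, ((M t : ℤ) - A t) < ∑ t ∈ range (i + 1), ((B t : ℤ) - M t)

/-- The bound replacing the length of row `i` when toggling. -/
def pivot (A M B : ℕ → ℕ) (i : ℕ) : ℤ :=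
  B i + ∑ t ∈ range i, ((B t : ℤ) - M t) - ∑ t ∈ range i, ((M t : ℤ) - A t) - 1

/-- The Bender--Knuth type toggle of `M` below row `i`. -/
def row (A M B : ℕ → ℕ) (i t : ℕ) : ℕ :=
  if t < i then M t
  else if t = i then (max (A i : ℤ) (B (i + 1)) + pivot A M B i - M i).toNat
  else max (A t) (B (t + 1)) + min (A (t - 1)) (B t) - M t

variable {A M B : ℕ → ℕ} {i : ℕ}

theorem le_pivot (h : Fails A M B i) : M i ≤ pivot A M B i := by
  simp only [Fails, sum_range_succ] at h
  simp only [pivot]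
  omega

theorem pivot_lt (hA : IsStrip A M) (h : ∀ t < i, ¬ Fails A M B t) : pivot A M B i < B i := by
  cases i with
  | zero => simp [pivot]
  | succ i =>
    have h1 := h i (by omega)
    have h2 := (hA i).1
    simp only [Fails, not_lt, pivot, sum_range_succ] at h1 ⊢
    omega

theorem pivot_lt_pred (hB : IsStrip M B) (h : ∀ t < i + 1, ¬ Fails A M B t) :
    pivot A M B (i + 1) < A i := by
  have h1 := h i (by omega)
  have h2 := (hB i).2
  simp only [Fails, not_lt, pivot, sum_range_succ] at h1 ⊢
  omega

theorem row_of_lt {t : ℕ} (h : t < i) : row A M B i t = M t := if_pos h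

theorem row_self (hA : IsStrip A M) (hB : IsStrip M B) (h : Fails A M B i) :
    (row A M B i i : ℤ) = max (A i : ℤ) (B (i + 1)) + pivot A M B i - M i := by
  have := le_pivot h
  have := (hA i).1
  have := (hB i).2
  simp only [row, lt_irrefl, if_false, if_true]
  omega

theorem row_of_gt {t : ℕ} (h : i < t) :
    row A M B i t = max (A t) (B (t + 1)) + min (A (t - 1)) (B t) - M t := by
  rw [row, if_neg (by omega), if_neg (by omega)]

theorem pivot_row : pivot A (row A M B i) B i = pivot A M B i := by
  have h1 : ∑ t ∈ range i, ((B t : ℤ) - row A M B i t) = ∑ t ∈ range i, ((B t : ℤ) - M t) :=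
    sum_congr rfl fun t ht => by rw [row_of_lt (mem_range.1 ht)]
  have h2 : ∑ t ∈ range i, ((row A M B i t : ℤ) - A t) = ∑ t ∈ range i, ((M t : ℤ) - A t) :=
    sum_congr rfl fun t ht => by rw [row_of_lt (mem_range.1 ht)]
  rw [pivot, pivot, h1, h2]

theorem row_bounds (hA : IsStrip A M) (hB : IsStrip M B) (h : Fails A M B i)
    (h' : ∀ t < i, ¬ Fails A M B t) (t : ℕ) :
    A t ≤ row A M B i t ∧ B (t + 1) ≤ row A M B i t ∧ row A M B i t ≤ B t ∧
      row A M B i (t + 1) ≤ A t := by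
  have a0 := hA t
  have a1 := hA (t + 1)
  have b0 := hB t
  have b1 := hB (t + 1)
  rcases lt_trichotomy t i with hlt | rfl | hgt
  · rw [row_of_lt hlt]
    refine ⟨a0.1, b0.2, b0.1, ?_⟩
    rcases (show t + 1 ≤ i from hlt).lt_or_eq with h3 | h3
    · rw [row_of_lt h3]; exact a0.2
    · have h4 := h3 ▸ row_self hA hB h
      have h5 := le_pivot h
      subst h3
      have h6 := pivot_lt_pred hB h'
      omega
  · have h4 := row_self hA hB h
    have h5 := le_pivot h
    have h6 := pivot_lt hA h'
    rw [row_of_gt (Nat.lt_succ_self t)]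
    simp only [Nat.succ_eq_add_one, Nat.add_sub_cancel]
    omega
  · rw [row_of_gt hgt, row_of_gt (by omega : i < t + 1)]
    obtain ⟨s, rfl⟩ : ∃ s, t = s + 1 := ⟨t - 1, by omega⟩
    have a2 := hA s
    simp only [Nat.add_sub_cancel]
    omega

theorem isStrip_row (hA : IsStrip A M) (hB : IsStrip M B) (h : Fails A M B i)
    (h' : ∀ t < i, ¬ Fails A M B t) : IsStrip A (row A M B i) :=
  fun t => ⟨(row_bounds hA hB h h' t).1, (row_bounds hA hB h h' t).2.2.2⟩

theorem isStrip_row' (hA : IsStrip A M) (hB : IsStrip M B) (h : Fails A M B i)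
    (h' : ∀ t < i, ¬ Fails A M B t) : IsStrip (row A M B i) B :=
  fun t => ⟨(row_bounds hA hB h h' t).2.2.1, (row_bounds hA hB h h' t).2.1⟩

theorem fails_row (hA : IsStrip A M) (hB : IsStrip M B) (h : Fails A M B i) :
    Fails A (row A M B i) B i := by
  have h1 : ∑ t ∈ range i, ((B t : ℤ) - row A M B i t) = ∑ t ∈ range i, ((B t : ℤ) - M t) :=
    sum_congr rfl fun t ht => by rw [row_of_lt (mem_range.1 ht)]
  have h2 : ∑ t ∈ range i, ((row A M B i t : ℤ) - A t) = ∑ t ∈ range i, ((M t : ℤ) - A t) :=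
    sum_congr rfl fun t ht => by rw [row_of_lt (mem_range.1 ht)]
  have h3 := row_self hA hB h
  have h4 := (hA i).1
  have h5 := (hB i).2
  rw [Fails, sum_range_succ, h1, h2]
  rw [pivot] at h3
  omega

theorem row_row (hA : IsStrip A M) (hB : IsStrip M B) (h : Fails A M B i)
    (h' : ∀ t < i, ¬ Fails A M B t) : row A (row A M B i) B i = M := by
  ext t
  rcases lt_trichotomy t i with hlt | rfl | hgt
  · rw [row_of_lt hlt, row_of_lt hlt]
  · have h1 := row_self (isStrip_row hA hB h h') (isStrip_row' hA hB h h') (fails_row hA hB h)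
    have h2 := row_self hA hB h
    rw [pivot_row] at h1
    omega
  · rw [row_of_gt hgt, row_of_gt hgt]
    obtain ⟨s, rfl⟩ : ∃ s, t = s + 1 := ⟨t - 1, by omega⟩
    have a0 := hA s
    have a1 := hA (s + 1)
    have b1 := hB (s + 1)
    simp only [Nat.add_sub_cancel]
    omega

theorem sum_row_aux (hA : IsStrip A M) (hB : IsStrip M B) (h : Fails A M B i)
    (n : ℕ) (hn : i + 1 ≤ n) :
    ∑ t ∈ range n, ((row A M B i t : ℤ) + M t) + min (A (n - 1) : ℤ) (B n) =
      ∑ t ∈ range n, (A t : ℤ) + ∑ t ∈ range (n + 1), (B t : ℤ) - 1 := by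
  induction n, hn using Nat.le_induction with
  | base =>
    have h1 : ∑ t ∈ range i, (row A M B i t : ℤ) = ∑ t ∈ range i, (M t : ℤ) :=
      sum_congr rfl fun t ht => by rw [row_of_lt (mem_range.1 ht)]
    have h3 := row_self hA hB h
    rw [pivot] at h3
    simp only [sum_sub_distrib] at h3
    simp only [sum_range_succ, h1, h3, sum_add_distrib, Nat.add_sub_cancel]
    omega
  | succ n hn ih =>
    rw [sum_range_succ, sum_range_succ (n := n), sum_range_succ (n := n + 1), row_of_gt (by omega)]
    obtain ⟨s, rfl⟩ : ∃ s, n = s + 1 := ⟨n - 1, by omega⟩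
    have a0 := hA s
    have a1 := hA (s + 1)
    have b1 := hB (s + 1)
    simp only [Nat.add_sub_cancel] at ih ⊢
    omega

theorem sum_row (hA : IsStrip A M) (hB : IsStrip M B) (h : Fails A M B i)
    (h' : ∀ t < i, ¬ Fails A M B t) {N : ℕ} (hN : ∀ t, N ≤ t → B t = 0) :
    ∑ t ∈ range N, (row A M B i t : ℤ) + ∑ t ∈ range N, (M t : ℤ) =
      ∑ t ∈ range N, (A t : ℤ) + ∑ t ∈ range N, (B t : ℤ) - 1 := by
  have hi : i < N := by
    by_contra hi
    have h1 := le_pivot h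
    have h2 := pivot_lt hA h'
    have := hN i (by omega)
    omega
  have := sum_row_aux hA hB h N hi
  rw [sum_range_succ, hN N le_rfl, sum_add_distrib] at this
  omega

end Toggle

namespace LaurentRing

noncomputable section

open Finset Equiv
open scoped Classical

/-- Failure of the lattice condition for the letters `k`, `k + 1` in row `i`. -/
def Violates (R : ℕ) (c : ℕ → ℕ → ℕ) (i k : ℕ) : Prop :=
  k + 2 ≤ R ∧ Toggle.Fails (c k) (c (k + 1)) (c (k + 2)) i

/-- `k` is the last letter violating the lattice condition in the first possible row `i`. -/
structure IsFirstViolation (R : ℕ) (c : ℕ → ℕ → ℕ) (p : ℕ × ℕ) : Prop where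
  violates : Violates R c p.1 p.2
  of_lt : ∀ i < p.1, ∀ k, ¬ Violates R c i k
  of_gt : ∀ k > p.2, ¬ Violates R c p.1 k

theorem exists_isFirstViolation {R : ℕ} {c : ℕ → ℕ → ℕ} (h : ∃ i k, Violates R c i k) :
    ∃ p, IsFirstViolation R c p := by
  obtain ⟨k, hk⟩ := Nat.find_spec h
  refine ⟨(Nat.find h, Nat.findGreatest (Violates R c (Nat.find h)) R),
    Nat.findGreatest_spec (m := k) (by have := hk.1; omega) hk, ?_, ?_⟩
  · intro i hi k hk
    exact Nat.find_min h hi ⟨k, hk⟩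
  · intro k hk h'
    have hR : k ≤ R := by
      have := h'.1
      omega
    exact absurd (Nat.le_findGreatest hR h') (by simpa using hk)

theorem IsFirstViolation.unique {R : ℕ} {c : ℕ → ℕ → ℕ} {p q : ℕ × ℕ}
    (hp : IsFirstViolation R c p) (hq : IsFirstViolation R c q) : p = q := by
  have h1 : p.1 = q.1 := by
    by_contra h
    rcases lt_or_gt_of_ne h with h | h
    · exact hq.of_lt _ h _ hp.violates
    · exact hp.of_lt _ h _ hq.violates
  refine Prod.ext h1 ?_
  by_contra h
  rcases lt_or_gt_of_ne h with h | h
  · exact hp.of_gt _ h (h1 ▸ hq.violates)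
  · exact hq.of_gt _ h (h1 ▸ hp.violates)

/-- Toggle the chain `c` at level `p.2 + 1` from row `p.1` on. -/
def toggle (c : ℕ → ℕ → ℕ) (p : ℕ × ℕ) : ℕ → ℕ → ℕ :=
  Function.update c (p.2 + 1) (Toggle.row (c p.2) (c (p.2 + 1)) (c (p.2 + 2)) p.1)

theorem toggle_self (c : ℕ → ℕ → ℕ) (p : ℕ × ℕ) :
    toggle c p (p.2 + 1) = Toggle.row (c p.2) (c (p.2 + 1)) (c (p.2 + 2)) p.1 := by
  simp [toggle]

theorem toggle_of_ne (c : ℕ → ℕ → ℕ) {p : ℕ × ℕ} {k : ℕ} (h : k ≠ p.2 + 1) :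
    toggle c p k = c k := by
  simp [toggle, h]

theorem toggle_of_lt (c : ℕ → ℕ → ℕ) {p : ℕ × ℕ} {k t : ℕ} (h : t < p.1) :
    toggle c p k t = c k t := by
  by_cases hk : k = p.2 + 1
  · rw [hk, toggle_self, Toggle.row_of_lt h]
  · rw [toggle_of_ne c hk]

section

variable {N R : ℕ} {ν : ℕ → ℕ} {c : ℕ → ℕ → ℕ} {p : ℕ × ℕ}

theorem isStrip_of_mem_chains (hN : ∀ i, N ≤ i → ν i = 0) (hc : c ∈ chains N R ν) {k : ℕ}
    (hk : k < R) : IsStrip (c k) (c (k + 1)) := ((mem_chains hN).1 hc).2 k hk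

theorem eq_zero_of_mem_chains (hN : ∀ i, N ≤ i → ν i = 0) (hc : c ∈ chains N R ν) (k i : ℕ)
    (hi : N ≤ i) : c k i = 0 := by
  obtain ⟨n, hn⟩ : ∃ n, R ≤ k + n := ⟨R, by omega⟩
  induction n generalizing k with
  | zero => rw [((mem_chains hN).1 hc).1 k hn, hN i hi]
  | succ n ih =>
    rcases le_or_gt R k with h | h
    · rw [((mem_chains hN).1 hc).1 k h, hN i hi]
    · have h1 := (isStrip_of_mem_chains hN hc h i).1
      have h2 := ih (k + 1) (by omega)
      omega

theorem IsFirstViolation.not_fails (hp : IsFirstViolation R c p) (t : ℕ) (ht : t < p.1) :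
    ¬ Toggle.Fails (c p.2) (c (p.2 + 1)) (c (p.2 + 2)) t :=
  fun h => hp.of_lt t ht p.2 ⟨hp.violates.1, h⟩

theorem toggle_mem_chains (hN : ∀ i, N ≤ i → ν i = 0) (hc : c ∈ chains N R ν)
    (hp : IsFirstViolation R c p) : toggle c p ∈ chains N R ν := by
  have hR := hp.violates.1
  rw [mem_chains hN]
  refine ⟨fun k hk => ?_, fun k hk => ?_⟩
  · rw [toggle_of_ne c (by omega), ((mem_chains hN).1 hc).1 k hk]
  · have hA := isStrip_of_mem_chains hN hc (k := p.2) (by omega)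
    have hB : IsStrip (c (p.2 + 1)) (c (p.2 + 2)) := isStrip_of_mem_chains hN hc (by omega)
    change IsStrip _ _
    by_cases h1 : k = p.2
    · rw [h1, toggle_self, toggle_of_ne c (by omega)]
      exact Toggle.isStrip_row hA hB hp.violates.2 hp.not_fails
    · by_cases h2 : k = p.2 + 1
      · rw [h2, toggle_self, toggle_of_ne c (by omega)]
        exact Toggle.isStrip_row' hA hB hp.violates.2 hp.not_fails
      · rw [toggle_of_ne c h2, toggle_of_ne c (by omega)]
        exact isStrip_of_mem_chains hN hc hk

theorem fails_congr {A M B A' M' B' : ℕ → ℕ} {i : ℕ} (hA : ∀ t < i, A t = A' t)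
    (hM : ∀ t ≤ i, M t = M' t) (hB : ∀ t ≤ i, B t = B' t) :
    Toggle.Fails A M B i ↔ Toggle.Fails A' M' B' i := by
  have h1 : ∑ t ∈ range i, ((M t : ℤ) - A t) = ∑ t ∈ range i, ((M' t : ℤ) - A' t) :=
    sum_congr rfl fun t ht => by
      have := mem_range.1 ht
      rw [hM t (by omega), hA t this]
  have h2 : ∑ t ∈ range (i + 1), ((B t : ℤ) - M t) = ∑ t ∈ range (i + 1), ((B' t : ℤ) - M' t) :=
    sum_congr rfl fun t ht => by
      have := mem_range.1 ht
      rw [hM t (by omega), hB t (by omega)]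
  rw [Toggle.Fails, Toggle.Fails, h1, h2]

theorem IsFirstViolation.toggle (hN : ∀ i, N ≤ i → ν i = 0) (hc : c ∈ chains N R ν)
    (hp : IsFirstViolation R c p) : IsFirstViolation R (toggle c p) p := by
  have hR := hp.violates.1
  have hA := isStrip_of_mem_chains hN hc (k := p.2) (by omega)
  have hB : IsStrip (c (p.2 + 1)) (c (p.2 + 2)) := isStrip_of_mem_chains hN hc (by omega)
  refine ⟨⟨hR, ?_⟩, fun i hi k hk => hp.of_lt i hi k ⟨hk.1, ?_⟩,
    fun k hk hk' => hp.of_gt k hk ⟨hk'.1, ?_⟩⟩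
  · rw [toggle_self, toggle_of_ne c (by omega), toggle_of_ne c (by omega)]
    exact Toggle.fails_row hA hB hp.violates.2
  · refine (fails_congr ?_ ?_ ?_).1 hk.2
    all_goals
      intro t ht
      exact toggle_of_lt c (by omega)
  · refine (fails_congr ?_ ?_ ?_).1 hk'.2
    · exact fun t ht => toggle_of_lt c ht
    · intro t _
      rw [toggle_of_ne c (by omega)]
    · intro t _
      rw [toggle_of_ne c (by omega)]

theorem toggle_toggle (hN : ∀ i, N ≤ i → ν i = 0) (hc : c ∈ chains N R ν)
    (hp : IsFirstViolation R c p) : toggle (toggle c p) p = c := by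
  have hR := hp.violates.1
  have hA := isStrip_of_mem_chains hN hc (k := p.2) (by omega)
  have hB : IsStrip (c (p.2 + 1)) (c (p.2 + 2)) := isStrip_of_mem_chains hN hc (by omega)
  ext k : 1
  by_cases hk : k = p.2 + 1
  · rw [hk, toggle_self, toggle_self, toggle_of_ne c (by omega), toggle_of_ne c (by omega)]
    exact Toggle.row_row hA hB hp.violates.2 hp.not_fails
  · rw [toggle_of_ne _ hk, toggle_of_ne _ hk]

theorem sortSign_toggle (hN : ∀ i, N ≤ i → ν i = 0) (hc : c ∈ chains N R ν)
    (hp : IsFirstViolation R c p) (l : Fin R → ℤ) :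
    (sortSign l fun k => stripSize N (toggle c p) k + expo R 0 k) =
      -sortSign l fun k => stripSize N c k + expo R 0 k := by
  have hR := hp.violates.1
  have hA := isStrip_of_mem_chains hN hc (k := p.2) (by omega)
  have hB : IsStrip (c (p.2 + 1)) (c (p.2 + 2)) := isStrip_of_mem_chains hN hc (by omega)
  have hsum := Toggle.sum_row hA hB hp.violates.2 hp.not_fails (N := N)
    (eq_zero_of_mem_chains hN hc _)
  have hne : (⟨p.2, by omega⟩ : Fin R) ≠ ⟨p.2 + 1, by omega⟩ := by simp
  rw [← sortSign_comp_swap l _ hne]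
  congr 1
  ext ⟨k, hk⟩
  by_cases h1 : k = p.2
  · subst h1
    simp only [Function.comp, swap_apply_left, stripSize, toggle_self, expo, sum_sub_distrib]
    rw [toggle_of_ne c (by omega)]
    simp [show p.2 + 1 + 1 = p.2 + 2 from rfl]
    omega
  · by_cases h2 : k = p.2 + 1
    · subst h2
      simp only [Function.comp, swap_apply_right, stripSize, toggle_self, expo, sum_sub_distrib]
      rw [toggle_of_ne c (by omega)]
      simp [show p.2 + 1 + 1 = p.2 + 2 from rfl]
      omega
    · rw [Function.comp, swap_apply_of_ne_of_ne (by simpa using h1) (by simpa using h2)]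
      simp only [stripSize]
      rw [toggle_of_ne c (by omega), toggle_of_ne c (by omega)]

theorem sum_violates_eq_zero (hN : ∀ i, N ≤ i → ν i = 0) (G : (ℕ → ℕ) → ℂ) (l : Fin R → ℤ) :
    ∑ c ∈ chains N R ν with ∃ i k, Violates R c i k,
      G (c 0) * (sortSign l fun k => stripSize N c k + expo R 0 k) = 0 := by
  choose! f hf using fun c (h : ∃ i k, Violates R c i k) => exists_isFirstViolation h
  refine sum_involution (fun c _ => toggle c (f c)) ?_ ?_ ?_ ?_
  · intro c hc
    obtain ⟨hc, h⟩ := mem_filter.1 hc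
    rw [sortSign_toggle hN hc (hf c h), toggle_of_ne c (by omega)]
    ring
  · intro c hc h0 heq
    obtain ⟨hc, h⟩ := mem_filter.1 hc
    have := sortSign_toggle hN hc (hf c h) l
    rw [heq] at this
    refine h0 ?_
    rw [self_eq_neg.1 this, mul_zero]
  · intro c hc
    obtain ⟨hc, h⟩ := mem_filter.1 hc
    exact mem_filter.2 ⟨toggle_mem_chains hN hc (hf c h), _, _, ((hf c h).toggle hN hc).violates⟩
  · intro c hc
    obtain ⟨hc, h⟩ := mem_filter.1 hc
    have h1 := (hf c h).toggle hN hc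
    rw [(hf _ ⟨_, _, h1.violates⟩).unique h1]
    exact toggle_toggle hN hc (hf c h)

/-- Chains of horizontal strips satisfying the lattice condition with strip sizes given by `μ`. -/
def latticeChains (N R : ℕ) (μ ν : ℕ → ℕ) : Finset (ℕ → ℕ → ℕ) :=
  {c ∈ chains N R ν | (∀ i k, ¬ Violates R c i k) ∧ ∀ k < R, stripSize N c k = μ k}

theorem mem_latticeChains {μ : ℕ → ℕ} : c ∈ latticeChains N R μ ν ↔
    c ∈ chains N R ν ∧ (∀ i k, ¬ Violates R c i k) ∧ ∀ k < R, stripSize N c k = μ k := mem_filter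

theorem strictAnti_of_not_violates (hN : ∀ i, N ≤ i → ν i = 0) (hc : c ∈ chains N R ν)
    (h : ∀ i k, ¬ Violates R c i k) :
    StrictAnti fun k : Fin R => stripSize N c k + expo R 0 k := by
  have key (k : ℕ) (hk : k + 1 < R) : stripSize N c (k + 1) ≤ stripSize N c k := by
    have h1 : ¬ Toggle.Fails _ _ _ N := fun h' => h N k ⟨hk, h'⟩
    rw [Toggle.Fails, not_lt, sum_range_succ, eq_zero_of_mem_chains hN hc _ N le_rfl,
      eq_zero_of_mem_chains hN hc _ N le_rfl] at h1
    simpa [stripSize] using h1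
  cases R with
  | zero => exact fun a => a.elim0
  | succ R =>
    refine Fin.strictAnti_iff_succ_lt.2 fun k => ?_
    have := key k (by omega)
    simp only [expo, Fin.val_succ, Fin.val_castSucc, Pi.zero_apply]
    push_cast
    omega

theorem strictAnti_expo {μ : ℕ → ℕ} (hμ : Antitone μ) : StrictAnti (expo N μ) := by
  intro a b hab
  have : μ b ≤ μ a := hμ hab.le
  have : (a : ℕ) < b := hab
  simp only [expo]
  omega

theorem coeff_mul_jacobiTrudi_expo {F : LaurentRing (Fin N)} (hF : IsAlternating F)
    (hF' : IsPoly F) (hν : Antitone ν) (hN : ∀ i, N ≤ i → ν i = 0) {μ : ℕ → ℕ} (hμ : Antitone μ) :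
    (F * jacobiTrudi (Fin N) (expo R μ) (expo R 0)).coeff (expo N ν) =
      ∑ c ∈ latticeChains N R μ ν, F.coeff (expo N (c 0)) := by
  rw [coeff_mul_jacobiTrudi hF hF' hν hN,
    ← sum_filter_add_sum_filter_not _ (fun c => ∃ i k, Violates R c i k),
    sum_violates_eq_zero hN (fun κ => F.coeff (expo N κ)), zero_add, latticeChains,
    ← filter_filter, sum_filter (s := filter _ _)]
  refine sum_congr (by simp) fun c hc => ?_
  simp only [mem_filter] at hc
  rw [sortSign_of_strictAnti (strictAnti_expo hμ) (strictAnti_of_not_violates hN hc.1 hc.2)]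
  have : (expo R μ = fun k : Fin R => stripSize N c k + expo R 0 k) ↔
      ∀ k < R, stripSize N c k = μ k := by
    rw [funext_iff, Fin.forall_iff]
    refine forall_congr' fun k => forall_congr' fun hk => ?_
    simp [expo]
    exact eq_comm
  simp [this]

end

end

end LaurentRing

namespace LaurentRing

noncomputable section

open Finset Equiv
open scoped Classical

variable {N R : ℕ} {μ ν κ : ℕ → ℕ} {c : ℕ → ℕ → ℕ}

theorem antitone_of_mem_chains (hν : Antitone ν) (hN : ∀ i, N ≤ i → ν i = 0)
    (hc : c ∈ chains N R ν) (k : ℕ) : Antitone (c k) := by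
  rcases le_or_gt R k with h | h
  · rwa [((mem_chains hN).1 hc).1 k h]
  · refine antitone_nat_of_succ_le fun i => ?_
    have h1 := (isStrip_of_mem_chains hN hc h i).2
    have h2 := (isStrip_of_mem_chains hN hc h (i + 1)).1
    omega

theorem coeff_alternant (l v : Fin N → ℤ) : (alternant l).coeff v = sortSign l v := by
  rw [alternant, AddMonoidAlgebra.coeff_sum, Finsupp.finsetSum_apply, sortSign]
  refine sum_congr rfl fun w _ => ?_
  rw [AddMonoidAlgebra.coeff_smul, Finsupp.smul_apply, coeff_mono]
  simp

theorem expo_injective (hν : ∀ i, N ≤ i → ν i = 0) (hκ : ∀ i, N ≤ i → κ i = 0) :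
    expo N ν = expo N κ ↔ ν = κ := by
  refine ⟨fun h => ?_, fun h => h ▸ rfl⟩
  ext i
  rcases le_or_gt N i with hi | hi
  · rw [hν i hi, hκ i hi]
  · have := congrFun h ⟨i, hi⟩
    simp only [expo] at this
    omega

theorem coeff_alternant_expo (hκ : Antitone κ) (hN : ∀ i, N ≤ i → κ i = 0) :
    (alternant (expo N 0)).coeff (expo N κ) = if κ = 0 then 1 else 0 := by
  rw [coeff_alternant, sortSign_of_strictAnti (strictAnti_expo (μ := 0) antitone_const) (strictAnti_expo hκ)]
  simp only [expo_injective (ν := 0) (fun _ _ => rfl) hN, eq_comm]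

/-- The only lattice chain from `0` with strip sizes `μ`. -/
def truncChain (μ : ℕ → ℕ) (k i : ℕ) : ℕ := if i < k then μ i else 0

theorem truncChain_succ_sub (μ : ℕ → ℕ) (k i : ℕ) :
    (truncChain μ (k + 1) i : ℤ) - truncChain μ k i = if i = k then (μ k : ℤ) else 0 := by
  unfold truncChain
  split_ifs <;> first | omega | (simp_all)

theorem truncChain_mem_latticeChains (hμ : Antitone μ) (hR : ∀ i, R ≤ i → μ i = 0)
    (hN : ∀ i, N ≤ i → μ i = 0) : truncChain μ ∈ latticeChains N R μ μ := by
  rw [latticeChains, mem_filter, mem_chains hN]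
  refine ⟨⟨fun k hk => ?_, fun k hk i => ?_⟩, fun i k h => ?_, fun k hk => ?_⟩
  · ext i
    by_cases h : i < k
    · simp [truncChain, h]
    · simp [truncChain, h, hR i (by omega)]
  · have := hμ (Nat.le_succ i)
    simp only [truncChain]
    split_ifs <;> first | omega | (simp_all; try omega)
  · have h1 := h.2
    simp only [Toggle.Fails, truncChain_succ_sub,
      show k + 2 = (k + 1) + 1 from rfl, sum_ite_eq', mem_range] at h1
    have := hμ (show k ≤ k + 1 by omega)
    split_ifs at h1 <;> omega
  · simp only [stripSize, truncChain_succ_sub, sum_ite_eq', mem_range]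
    split_ifs with h
    · rfl
    · rw [hN k (by omega), Nat.cast_zero]

theorem eq_truncChain (hN : ∀ i, N ≤ i → ν i = 0) (hc : c ∈ latticeChains N R μ ν)
    (h0 : c 0 = 0) (k : ℕ) (hk : k ≤ R) : c k = truncChain μ k := by
  rw [latticeChains, mem_filter] at hc
  obtain ⟨hc, hl, hs⟩ := hc
  have hz (k : ℕ) (hk : k ≤ R) (i : ℕ) (hi : k ≤ i) : c k i = 0 := by
    induction k generalizing i with
    | zero => rw [h0]; rfl
    | succ k ih =>
      obtain ⟨s, rfl⟩ : ∃ s, i = s + 1 := ⟨i - 1, by omega⟩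
      have h1 := (isStrip_of_mem_chains hN hc hk s).2
      have h2 := ih (by omega) s (by omega)
      omega
  have hx (k : ℕ) (hk : k < R) : ∑ t ∈ range k, ((c (k + 1) t : ℤ) - c k t) ≤ 0 := by
    induction k with
    | zero => simp
    | succ k ih =>
      have h1 : ¬ Toggle.Fails _ _ _ k := fun h' => hl k k ⟨hk, h'⟩
      rw [Toggle.Fails, not_lt] at h1
      exact h1.trans (ih (by omega))
  have hy (k : ℕ) (hk : k < R) (i : ℕ) (hi : i < k) : c (k + 1) i = c k i := by
    have h1 : ∀ t ∈ range k, 0 ≤ (c (k + 1) t : ℤ) - c k t := fun t _ => by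
      have := (isStrip_of_mem_chains hN hc hk t).1
      omega
    have h2 := (sum_eq_zero_iff_of_nonneg h1).1 (le_antisymm (hx k hk) (sum_nonneg h1)) i
      (mem_range.2 hi)
    omega
  have hd (k : ℕ) (hk : k < R) : c (k + 1) k = μ k := by
    have h1 := hs k hk
    rw [stripSize] at h1
    rcases lt_or_ge k N with h | h
    · rw [sum_eq_single_of_mem k (mem_range.2 h), hz k hk.le k le_rfl] at h1
      · simpa using h1
      · intro t _ ht
        rcases lt_or_gt_of_ne ht with h2 | h2
        · rw [hy k hk t h2, sub_self]
        · rw [hz k hk.le t h2.le, hz (k + 1) hk t h2, sub_self]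
    · have h2 : ∑ t ∈ range N, ((c (k + 1) t : ℤ) - c k t) = 0 := sum_eq_zero fun t ht => by
        rw [hy k hk t (by have := mem_range.1 ht; omega), sub_self]
      rw [eq_zero_of_mem_chains hN hc _ k h]
      omega
  induction k with
  | zero => ext i; simp [h0, truncChain]
  | succ k ih =>
    ext i
    have h1 := congrFun (ih (by omega)) i
    rcases lt_trichotomy i k with h | rfl | h
    · rw [hy k hk i h, h1, truncChain, truncChain, if_pos h, if_pos (by omega)]
    · rw [hd i hk, truncChain, if_pos (by omega)]
    · rw [hz (k + 1) hk i h, truncChain, if_neg (by omega)]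

theorem coeff_alternant_mul_jacobiTrudi (hν : Antitone ν) (hN : ∀ i, N ≤ i → ν i = 0)
    (hμ : Antitone μ) (hR : ∀ i, R ≤ i → μ i = 0) :
    (alternant (expo N 0) * jacobiTrudi (Fin N) (expo R μ) (expo R 0)).coeff (expo N ν) =
      if ν = μ then 1 else 0 := by
  have hpoly : IsPoly (alternant (expo N 0)) := isPoly_alternant fun k => by
    simp only [expo, Pi.zero_apply]
    omega
  rw [coeff_mul_jacobiTrudi_expo (isAlternating_alternant _) hpoly hν hN hμ]
  have h1 : ∀ c ∈ latticeChains N R μ ν, (alternant (expo N 0)).coeff (expo N (c 0)) =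
      if c 0 = 0 then 1 else 0 := fun c hc => by
    have hc' := (mem_filter.1 hc).1
    exact coeff_alternant_expo (antitone_of_mem_chains hν hN hc' 0) (eq_zero_of_mem_chains hN hc' 0)
  have h2 : ∀ c ∈ latticeChains N R μ ν, c 0 = 0 → ν = μ ∧ c = truncChain μ := by
    intro c hc h0
    have h3 : ∀ k, R ≤ k → truncChain μ k = μ := fun k hk => by
      ext i
      rw [truncChain]
      split_ifs with h
      · rfl
      · rw [hR i (by omega)]
    have h4 := ((mem_chains hN).1 (mem_filter.1 hc).1).1
    have h5 : ν = μ := by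
      rw [← h4 R le_rfl, eq_truncChain hN hc h0 R le_rfl, h3 R le_rfl]
    refine ⟨h5, funext fun k => ?_⟩
    rcases le_or_gt k R with h | h
    · exact eq_truncChain hN hc h0 k h
    · rw [h4 k h.le, h3 k h.le, h5]
  rw [sum_congr rfl h1]
  split_ifs with h
  · subst h
    rw [sum_eq_single_of_mem _ (truncChain_mem_latticeChains hμ hR hN), if_pos]
    · ext i; simp [truncChain]
    · exact fun c hc hne => if_neg fun h0 => hne (h2 c hc h0).2
  · exact sum_eq_zero fun c hc => if_neg fun h0 => h (h2 c hc h0).1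

theorem coeff_alternant_mul_jacobiTrudi_mul_jacobiTrudi {R' : ℕ} (hν : Antitone ν)
    (hN : ∀ i, N ≤ i → ν i = 0) (hκ : Antitone κ) (hR' : ∀ i, R' ≤ i → κ i = 0)
    (hμ : Antitone μ) :
    (alternant (expo N 0) * jacobiTrudi (Fin N) (expo R' κ) (expo R' 0) *
      jacobiTrudi (Fin N) (expo R μ) (expo R 0)).coeff (expo N ν) =
      (#{c ∈ latticeChains N R μ ν | c 0 = κ} : ℂ) := by
  have hpoly : IsPoly (alternant (expo N 0)) := isPoly_alternant fun k => by
    simp only [expo, Pi.zero_apply]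
    omega
  rw [coeff_mul_jacobiTrudi_expo ((isAlternating_alternant _).mul (isSymm_jacobiTrudi _ _))
    (hpoly.mul (isPoly_jacobiTrudi _ _)) hν hN hμ, card_filter]
  push_cast
  refine sum_congr rfl fun c hc => ?_
  have hc' := (mem_filter.1 hc).1
  exact coeff_alternant_mul_jacobiTrudi (antitone_of_mem_chains hν hN hc' 0)
    (eq_zero_of_mem_chains hN hc' 0) hκ hR'

end

end LaurentRing

open Finset

/-- The filling `T` of `ν` is encoded by the chain of partitions `c`, where `c k i` is the number
of entries at most `k` in row `i`. -/
structure Encodes (nu : ℕ → ℕ) (T c : ℕ → ℕ → ℕ) : Prop where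
  zero : ∀ i j, nu i ≤ j → T i j = 0
  le : ∀ k i, c k i ≤ nu i
  iff : ∀ i j k, j < nu i → (T i j ≤ k ↔ j < c k i)

theorem ncard_rows (n : ℕ) (a b : ℕ → ℕ) :
    {p : ℕ × ℕ | p.1 < n ∧ a p.1 ≤ p.2 ∧ p.2 < b p.1}.ncard = ∑ t ∈ range n, (b t - a t) := by
  have h : {p : ℕ × ℕ | p.1 < n ∧ a p.1 ≤ p.2 ∧ p.2 < b p.1} =
      ((range n).biUnion fun t => (Ico (a t) (b t)).image (Prod.mk t) : Finset (ℕ × ℕ)) := by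
    ext ⟨i, j⟩
    simp
    tauto
  rw [h, Set.ncard_coe_finset, card_biUnion]
  · refine sum_congr rfl fun t _ => ?_
    rw [card_image_of_injective _ (Prod.mk_right_injective t), Nat.card_Ico]
  · intro s _ t _ hst
    rw [Function.onFun, disjoint_left]
    rintro ⟨i, j⟩ h1 h2
    simp only [mem_image, Prod.mk.injEq] at h1 h2
    obtain ⟨_, _, rfl, _⟩ := h1
    obtain ⟨_, _, h, _⟩ := h2
    exact hst h.symm

namespace Encodes

variable {lam mu nu : ℕ → ℕ} {T c T' c' : ℕ → ℕ → ℕ} {N R : ℕ}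

theorem left_unique (h : Encodes nu T c) (h' : Encodes nu T' c) : T = T' := by
  ext i j
  rcases le_or_gt (nu i) j with hj | hj
  · rw [h.zero i j hj, h'.zero i j hj]
  · exact le_antisymm ((h.iff i j _ hj).2 ((h'.iff i j _ hj).1 le_rfl))
      ((h'.iff i j _ hj).2 ((h.iff i j _ hj).1 le_rfl))

theorem right_unique (h : Encodes nu T c) (h' : Encodes nu T c') : c = c' := by
  ext k i
  have h1 := h.le k i
  have h2 := h'.le k i
  by_contra hne
  rcases lt_or_gt_of_ne hne with h3 | h3
  · exact lt_irrefl _ ((h.iff i _ k (by omega)).1 ((h'.iff i _ k (by omega)).2 h3))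
  · exact lt_irrefl _ ((h'.iff i _ k (by omega)).1 ((h.iff i _ k (by omega)).2 h3))

theorem mono (h : Encodes nu T c) (i : ℕ) : Monotone fun k => c k i := by
  intro k k' hk
  have h1 := h.le k i
  by_contra! hlt
  have h2 := (h.iff i (c k' i) k (by omega)).2 hlt
  exact lt_irrefl _ ((h.iff i (c k' i) k' (by omega)).1 (h2.trans hk))

theorem cell_iff (h : Encodes nu T c) (h0 : ∀ i, c 0 i = min (lam i) (nu i)) (i j k : ℕ) :
    IsCell lam nu i j ∧ T i j = k + 1 ↔ c k i ≤ j ∧ j < c (k + 1) i := by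
  have h1 := h.le (k + 1) i
  have h2 : c 0 i ≤ c k i := h.mono i (Nat.zero_le k)
  have h3 := h0 i
  by_cases hj : j < nu i
  · have h4 := h.iff i j k hj
    have h5 := h.iff i j (k + 1) hj
    rw [IsCell]
    constructor <;> intro h6 <;> refine ⟨?_, ?_⟩ <;> omega
  · rw [IsCell]
    omega

theorem ncard_letter (h : Encodes nu T c) (h0 : ∀ i, c 0 i = min (lam i) (nu i))
    (hN : ∀ i, N ≤ i → nu i = 0) (k : ℕ) :
    ({p : ℕ × ℕ | IsCell lam nu p.1 p.2 ∧ T p.1 p.2 = k + 1}.ncard : ℤ) =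
      LaurentRing.stripSize N c k := by
  have h1 : {p : ℕ × ℕ | IsCell lam nu p.1 p.2 ∧ T p.1 p.2 = k + 1} =
      {p : ℕ × ℕ | p.1 < N ∧ c k p.1 ≤ p.2 ∧ p.2 < c (k + 1) p.1} := by
    ext p
    simp only [Set.mem_ofPred_eq, h.cell_iff h0, iff_and_self]
    intro h2
    by_contra h3
    have := hN p.1 (by omega)
    have := h.le (k + 1) p.1
    omega
  rw [h1, ncard_rows, LaurentRing.stripSize]
  push_cast
  refine sum_congr rfl fun t _ => ?_
  have : c k t ≤ c (k + 1) t := h.mono t (Nat.le_succ k)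
  omega

theorem ncard_prefix (h : Encodes nu T c) (h0 : ∀ i, c 0 i = min (lam i) (nu i)) (i j k : ℕ) :
    ({p : ℕ × ℕ | IsCell lam nu p.1 p.2 ∧ T p.1 p.2 = k + 1 ∧ ReadLE i j p.1 p.2}.ncard : ℤ) =
      ∑ t ∈ range i, ((c (k + 1) t : ℤ) - c k t) + (c (k + 1) i - max (c k i) j : ℕ) := by
  have h1 : {p : ℕ × ℕ | IsCell lam nu p.1 p.2 ∧ T p.1 p.2 = k + 1 ∧ ReadLE i j p.1 p.2} =
      {p : ℕ × ℕ | p.1 < i + 1 ∧ (if p.1 < i then c k p.1 else max (c k p.1) j) ≤ p.2 ∧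
        p.2 < c (k + 1) p.1} := by
    ext p
    simp only [Set.mem_ofPred_eq, ← and_assoc, h.cell_iff h0, ReadLE]
    split_ifs <;> omega
  rw [h1, ncard_rows _ (fun t => if t < i then c k t else max (c k t) j), sum_range_succ,
    if_neg (lt_irrefl i), Nat.cast_add, Nat.cast_sum]
  congr 1
  refine sum_congr rfl fun t ht => ?_
  have : c k t ≤ c (k + 1) t := h.mono t (Nat.le_succ k)
  rw [if_pos (mem_range.1 ht)]
  omega

theorem zero_eq_min (h : Encodes nu T c) (hT : IsLRTableau lam mu nu T) (i : ℕ) :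
    c 0 i = min (lam i) (nu i) := by
  have key (j : ℕ) (hj : j < nu i) : j < c 0 i ↔ j < lam i := by
    rw [← h.iff i j 0 hj]
    have h1 := hT.1 i j
    have h2 := hT.2.1 i j
    rw [IsCell] at h1 h2
    omega
  have h1 := h.le 0 i
  have h2 := key (c 0 i)
  have h3 := key (min (lam i) (nu i))
  omega

theorem isStrip (h : Encodes nu T c) (hT : IsLRTableau lam mu nu T) (hlam : Antitone lam)
    (hnu : Antitone nu) (k : ℕ) : IsStrip (c k) (c (k + 1)) := by
  intro i
  refine ⟨h.mono i (Nat.le_succ k), ?_⟩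
  have h1 := h.le (k + 1) (i + 1)
  have h2 : nu (i + 1) ≤ nu i := hnu (Nat.le_succ i)
  have h3 : lam (i + 1) ≤ lam i := hlam (Nat.le_succ i)
  by_contra! hlt
  have h4 := (h.iff (i + 1) (c k i) (k + 1) (by omega)).2 hlt
  have h5 : ¬ T i (c k i) ≤ k := by
    rw [h.iff i (c k i) k (by omega)]
    omega
  have h6 : IsCell lam nu i (c k i) := by
    by_contra h6
    have := hT.1 _ _ h6
    omega
  have h7 := hT.2.2.2.1 i (c k i) h6 ⟨h3.trans h6.1, by omega⟩
  omega

theorem eq_of_le (h : Encodes nu T c) (hT : IsLRTableau lam mu nu T)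
    (hN : ∀ i, N ≤ i → nu i = 0) (hR : ∀ i, R ≤ i → mu i = 0) (k : ℕ) (hk : R ≤ k) :
    c k = nu := by
  have h0 := h.zero_eq_min hT
  have hstep (k : ℕ) (hk : R ≤ k) (i : ℕ) : c (k + 1) i = c k i := by
    have h1 := h.ncard_letter h0 hN k
    rw [hT.2.2.2.2.1 k, hR k hk, LaurentRing.stripSize] at h1
    have h2 (i : ℕ) : c k i ≤ c (k + 1) i := h.mono i (Nat.le_succ k)
    rcases le_or_gt N i with hi | hi
    · have := h.le k i
      have := h.le (k + 1) i
      have := hN i hi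
      omega
    · have := (sum_eq_zero_iff_of_nonneg (fun t _ => by have := h2 t; omega)).1 h1.symm i
        (mem_range.2 hi)
      omega
  have hconst (m : ℕ) (i : ℕ) : c (k + m) i = c k i := by
    induction m with
    | zero => rfl
    | succ m ih => rw [← add_assoc, hstep _ (by omega), ih]
  ext i
  refine le_antisymm (h.le k i) ?_
  by_contra! hlt
  have h1 := (h.iff i (c k i) (k + T i (c k i)) hlt).1 (by omega)
  rw [hconst] at h1
  omega

theorem zero_eq (h : Encodes nu T c) (hT : IsLRTableau lam mu nu T)
    (hN : ∀ i, N ≤ i → nu i = 0) (hN' : ∀ i, N ≤ i → lam i = 0) (hR : ∀ i, R ≤ i → mu i = 0)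
    (hsize : ∑ i ∈ range N, lam i + ∑ i ∈ range R, mu i = ∑ i ∈ range N, nu i) : c 0 = lam := by
  have h0 := h.zero_eq_min hT
  have h1 : ∑ k ∈ range R, LaurentRing.stripSize N c k = ∑ k ∈ range R, (mu k : ℤ) :=
    sum_congr rfl fun k _ => by rw [← h.ncard_letter h0 hN, hT.2.2.2.2.1 k]
  have h2 : ∑ k ∈ range R, LaurentRing.stripSize N c k =
      ∑ i ∈ range N, (nu i : ℤ) - ∑ i ∈ range N, (c 0 i : ℤ) := by
    simp only [LaurentRing.stripSize]
    rw [sum_comm, ← sum_sub_distrib]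
    refine sum_congr rfl fun i _ => ?_
    rw [sum_range_sub (fun k => (c k i : ℤ)), h.eq_of_le hT hN hR R le_rfl]
  have h3 : ∑ i ∈ range N, ((lam i : ℤ) - c 0 i) = 0 := by
    rw [sum_sub_distrib]
    zify at hsize
    omega
  ext i
  have h4 := h0 i
  rcases le_or_gt N i with hi | hi
  · have := hN' i hi
    omega
  · have := (sum_eq_zero_iff_of_nonneg (fun t _ => by have := h0 t; omega)).1 h3 i (mem_range.2 hi)
    omega

theorem not_fails (h : Encodes nu T c) (hT : IsLRTableau lam mu nu T) (i k : ℕ) :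
    ¬ Toggle.Fails (c k) (c (k + 1)) (c (k + 2)) i := by
  have h0 := h.zero_eq_min hT
  have hm (t : ℕ) : c (k + 1) t ≤ c (k + 2) t := h.mono t (by omega)
  have hm' (t : ℕ) : c k t ≤ c (k + 1) t := h.mono t (by omega)
  induction i with
  | zero =>
    rw [Toggle.Fails, not_lt]
    rcases (hm 0).lt_or_eq with hlt | heq
    · have h1 := ((h.cell_iff h0 0 (c (k + 1) 0) (k + 1)).2 ⟨le_rfl, hlt⟩).1
      have h2 := hT.2.2.2.2.2 0 (c (k + 1) 0) k h1
      rw [← Nat.cast_le (α := ℤ)] at h2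
      have h3 := h.ncard_prefix h0 0 (c (k + 1) 0) k
      have h4 := h.ncard_prefix h0 0 (c (k + 1) 0) (k + 1)
      simp only [show k + 1 + 1 = k + 2 from rfl] at h4
      rw [h3, h4] at h2
      simp only [range_zero, sum_empty, zero_add, sum_range_one] at h2 ⊢
      have := hm' 0
      omega
    · simp [heq]
  | succ i ih =>
    rw [Toggle.Fails, not_lt] at ih ⊢
    rcases (hm (i + 1)).lt_or_eq with hlt | heq
    · have h1 := ((h.cell_iff h0 (i + 1) (c (k + 1) (i + 1)) (k + 1)).2 ⟨le_rfl, hlt⟩).1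
      have h2 := hT.2.2.2.2.2 (i + 1) (c (k + 1) (i + 1)) k h1
      rw [← Nat.cast_le (α := ℤ)] at h2
      have h3 := h.ncard_prefix h0 (i + 1) (c (k + 1) (i + 1)) k
      have h4 := h.ncard_prefix h0 (i + 1) (c (k + 1) (i + 1)) (k + 1)
      simp only [show k + 1 + 1 = k + 2 from rfl] at h4
      rw [h3, h4] at h2
      rw [sum_range_succ (n := i + 1)]
      have := hm' (i + 1)
      omega
    · rw [sum_range_succ (n := i + 1), heq, sub_self, add_zero]
      refine ih.trans ?_
      rw [sum_range_succ]
      have := hm' i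
      omega

theorem mem_latticeChains (h : Encodes nu T c) (hT : IsLRTableau lam mu nu T)
    (hlam : Antitone lam) (hnu : Antitone nu)
    (hN : ∀ i, N ≤ i → nu i = 0) (hR : ∀ i, R ≤ i → mu i = 0) :
    c ∈ LaurentRing.latticeChains N R mu nu := by
  rw [LaurentRing.mem_latticeChains, LaurentRing.mem_chains hN]
  refine ⟨⟨h.eq_of_le hT hN hR, fun k _ => h.isStrip hT hlam hnu k⟩,
    fun i k hv => h.not_fails hT i k hv.2, fun k _ => ?_⟩
  rw [← h.ncard_letter (h.zero_eq_min hT) hN, hT.2.2.2.2.1 k]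

theorem isLRTableau (h : Encodes nu T c) (hc : c ∈ LaurentRing.latticeChains N R mu nu)
    (h0 : c 0 = lam) (hN : ∀ i, N ≤ i → nu i = 0) (hR : ∀ i, R ≤ i → mu i = 0) :
    IsLRTableau lam mu nu T := by
  rw [LaurentRing.mem_latticeChains, LaurentRing.mem_chains hN] at hc
  obtain ⟨⟨hend, hstrip⟩, hlat, hsize⟩ := hc
  have h0' (i : ℕ) : c 0 i = min (lam i) (nu i) := by
    have := h.le 0 i
    rw [h0] at this ⊢
    omega
  refine ⟨fun i j hij => ?_, fun i j hij => ?_, fun i j j' hj hj' hle => ?_,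
    fun i j hij hij' => ?_, fun k => ?_, fun i j k hij => ?_⟩
  · rcases le_or_gt (nu i) j with hj | hj
    · exact h.zero i j hj
    · refine Nat.le_zero.1 ((h.iff i j 0 hj).2 ?_)
      rw [IsCell] at hij
      rw [h0]
      omega
  · have h1 := (h.iff i j 0 hij.2).1
    have h2 := hij.1
    rw [h0] at h1
    omega
  · have h1 := (h.iff i j' _ hj'.2).1 le_rfl
    exact (h.iff i j _ hj.2).2 (by omega)
  · have h1 := (h.iff (i + 1) j _ hij'.2).1 le_rfl
    obtain ⟨k, hk⟩ : ∃ k, T (i + 1) j = k + 1 := by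
      refine ⟨T (i + 1) j - 1, ?_⟩
      have h2 := (h.iff (i + 1) j 0 hij'.2).1
      have h3 := hij'.1
      rw [h0] at h2
      omega
    rw [hk] at h1 ⊢
    refine Nat.lt_succ_of_le ((h.iff i j k hij.2).2 ?_)
    rcases lt_or_ge k R with hkR | hkR
    · have := (hstrip k hkR i).2
      omega
    · rw [hend k hkR]
      exact hij.2
  · rw [← Nat.cast_inj (R := ℤ), h.ncard_letter h0' hN]
    rcases lt_or_ge k R with hkR | hkR
    · exact hsize k hkR
    · rw [LaurentRing.stripSize, hend k hkR, hend (k + 1) (by omega), hR k hkR]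
      simp
  · rw [← Nat.cast_le (α := ℤ), show k + 2 = k + 1 + 1 from rfl, h.ncard_prefix h0', h.ncard_prefix h0']
    have hm (t : ℕ) : c k t ≤ c (k + 1) t := h.mono t (by omega)
    have hle : ∑ t ∈ range (i + 1), ((c (k + 2) t : ℤ) - c (k + 1) t) ≤
        ∑ t ∈ range i, ((c (k + 1) t : ℤ) - c k t) := by
      rcases lt_or_ge R (k + 2) with hkR | hkR
      · rw [hend (k + 2) (by omega), hend (k + 1) (by omega)]
        simp only [sub_self, sum_const_zero]
        refine sum_nonneg fun t _ => ?_
        have := h.le k t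
        omega
      · exact not_lt.1 fun h' => hlat i k ⟨hkR, h'⟩
    rw [sum_range_succ] at hle
    have : c (k + 1) i ≤ c (k + 2) i := h.mono i (by omega)
    simp only [show k + 1 + 1 = k + 2 from rfl]
    omega

end Encodes

theorem exists_encodes_of_isLRTableau {lam mu nu : ℕ → ℕ} {T : ℕ → ℕ → ℕ}
    (hT : IsLRTableau lam mu nu T) : ∃ c, Encodes nu T c := by
  have key (f : ℕ → ℕ) (n k : ℕ) (hf : ∀ j j', j ≤ j' → j' < n → f j ≤ f j') :
      ∃ m ≤ n, ∀ j < n, f j ≤ k ↔ j < m := by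
    induction n with
    | zero => exact ⟨0, le_rfl, fun j hj => by omega⟩
    | succ n ih =>
      obtain ⟨m, hm, h⟩ := ih fun j j' hj hj' => hf j j' hj (by omega)
      by_cases hn : f n ≤ k
      · refine ⟨n + 1, le_rfl, fun j hj => ⟨fun _ => hj, fun _ => ?_⟩⟩
        exact (hf j n (by omega) (by omega)).trans hn
      · refine ⟨m, by omega, fun j hj => ?_⟩
        rcases (Nat.lt_succ_iff.1 hj).lt_or_eq with h1 | rfl
        · exact h j h1
        · omega
  have hf (i j j' : ℕ) (hj : j ≤ j') (hj' : j' < nu i) : T i j ≤ T i j' := by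
    by_cases h : IsCell lam nu i j
    · exact hT.2.2.1 i j j' h ⟨h.1.trans hj, hj'⟩ hj
    · rw [hT.1 i j h]
      exact Nat.zero_le _
  choose c hc hc' using fun k i => key (T i) (nu i) k (hf i)
  refine ⟨c, fun i j hj => hT.1 i j fun h => ?_, hc, fun i j k hj => hc' k i j hj⟩
  have := h.2
  omega

theorem exists_encodes_of_mem_chains {N R : ℕ} {nu : ℕ → ℕ} {c : ℕ → ℕ → ℕ}
    (hN : ∀ i, N ≤ i → nu i = 0) (hc : c ∈ LaurentRing.chains N R nu) : ∃ T, Encodes nu T c := by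
  rw [LaurentRing.mem_chains hN] at hc
  have hmono (i : ℕ) : Monotone fun k => c k i := monotone_nat_of_le_succ fun k => by
    rcases lt_or_ge k R with h | h
    · exact (hc.2 k h i).1
    · rw [hc.1 k h, hc.1 (k + 1) (by omega)]
  have hle (k i : ℕ) : c k i ≤ nu i := by
    have : c k i ≤ c (k + R) i := hmono i (by omega)
    rwa [hc.1 (k + R) (by omega)] at this
  have hex (i j : ℕ) (hj : j < nu i) : ∃ k, j < c k i := ⟨R, by rwa [hc.1 R le_rfl]⟩
  refine ⟨fun i j => if h : j < nu i then Nat.find (hex i j h) else 0,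
    fun i j hj => dif_neg (by omega), hle, fun i j k hj => ?_⟩
  simp only [hj, dite_true]
  refine ⟨fun h => ?_, fun h => Nat.find_min' _ h⟩
  exact (Nat.find_spec (hex i j hj)).trans_le (hmono i h)

open scoped Classical in
theorem lrCoeff_eq_card {lam mu nu : ℕ → ℕ} {N R : ℕ} (hlam : Antitone lam) (hnu : Antitone nu)
    (hN : ∀ i, N ≤ i → nu i = 0) (hN' : ∀ i, N ≤ i → lam i = 0) (hR : ∀ i, R ≤ i → mu i = 0)
    (hsize : ∑ i ∈ range N, lam i + ∑ i ∈ range R, mu i = ∑ i ∈ range N, nu i) :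
    lrCoeff lam mu nu = #{c ∈ LaurentRing.latticeChains N R mu nu | c 0 = lam} := by
  choose f hf using fun T : {T // IsLRTableau lam mu nu T} => exists_encodes_of_isLRTableau T.2
  rw [← Nat.card_eq_finsetCard]
  refine Nat.card_eq_of_bijective (fun T => ⟨f T, mem_filter.2
    ⟨(hf T).mem_latticeChains T.2 hlam hnu hN hR, (hf T).zero_eq T.2 hN hN' hR hsize⟩⟩) ⟨?_, ?_⟩
  · intro T T' h
    have h1 : f T = f T' := congrArg Subtype.val h
    exact Subtype.ext ((hf T).left_unique (h1 ▸ hf T'))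
  · rintro ⟨c, hc⟩
    obtain ⟨hc, h0⟩ := mem_filter.1 hc
    obtain ⟨T, hT⟩ := exists_encodes_of_mem_chains hN (LaurentRing.mem_latticeChains.1 hc).1
    exact ⟨⟨T, hT.isLRTableau hc h0 hN hR⟩, Subtype.ext ((hf _).right_unique hT)⟩

open Finset

theorem partOfSet_eq_zero (I : Finset ℕ) (t : ℕ) (ht : #I ≤ t) : partOfSet I t = 0 :=
  if_neg (by omega)

theorem partOfSet_of_lt {I : Finset ℕ} {r : ℕ} (hr : #I = r) (t : Fin r) :
    partOfSet I t = I.orderEmbOfFin hr t.rev - (r - t) := by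
  subst hr
  have h : #I - 1 - (t : ℕ) < (I.sort (· ≤ ·)).length := by
    rw [length_sort]
    omega
  rw [partOfSet, if_pos t.2, orderEmbOfFin_apply, List.getD_eq_getElem _ _ h]
  congr 2
  rw [Fin.val_rev]
  omega

theorem succ_le_orderEmbOfFin {I : Finset ℕ} {r : ℕ} (hr : #I = r) (hI : ∀ i ∈ I, 1 ≤ i)
    (p : Fin r) : (p : ℕ) + 1 ≤ I.orderEmbOfFin hr p := by
  obtain ⟨p, hp⟩ := p
  induction p with
  | zero => exact hI _ (orderEmbOfFin_mem I hr _)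
  | succ p ih =>
    have h1 := ih (by omega)
    have h2 : I.orderEmbOfFin hr ⟨p, by omega⟩ < I.orderEmbOfFin hr ⟨p + 1, hp⟩ :=
      (I.orderEmbOfFin hr).strictMono (Fin.mk_lt_mk.2 (Nat.lt_succ_self p))
    simp only at h1 ⊢
    omega

theorem antitone_partOfSet (I : Finset ℕ) : Antitone (partOfSet I) := by
  refine antitone_nat_of_succ_le fun t => ?_
  rcases le_or_gt #I (t + 1) with h | h
  · rw [partOfSet_eq_zero I _ h]
    exact Nat.zero_le _
  · have h1 := partOfSet_of_lt (I := I) rfl ⟨t + 1, h⟩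
    have h2 := partOfSet_of_lt (I := I) rfl ⟨t, by omega⟩
    have h3 : I.orderEmbOfFin rfl (Fin.rev ⟨t + 1, h⟩) <
        I.orderEmbOfFin rfl (Fin.rev ⟨t, by omega⟩) :=
      (I.orderEmbOfFin rfl).strictMono (Fin.rev_lt_rev.2 (Fin.mk_lt_mk.2 (Nat.lt_succ_self t)))
    simp only at h1 h2
    omega

theorem expo_partOfSet {I : Finset ℕ} {r : ℕ} (hr : #I = r) (hI : ∀ i ∈ I, 1 ≤ i) (t : Fin r) :
    LaurentRing.expo r (partOfSet I) t = I.orderEmbOfFin hr t.rev - 1 := by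
  have h1 := succ_le_orderEmbOfFin hr hI t.rev
  rw [LaurentRing.expo, partOfSet_of_lt hr]
  rw [Fin.val_rev] at h1
  omega

theorem exists_expo_partOfSet {I : Finset ℕ} {r : ℕ} (hr : #I = r) (hI : ∀ i ∈ I, 1 ≤ i)
    {i : ℕ} (hi : i ∈ I) : ∃ t, LaurentRing.expo r (partOfSet I) t = i - 1 := by
  have : i ∈ Set.range (I.orderEmbOfFin hr) := by
    rw [range_orderEmbOfFin]
    exact hi
  obtain ⟨p, rfl⟩ := this
  exact ⟨p.rev, by rw [expo_partOfSet hr hI, Fin.rev_rev]⟩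

theorem pos_of_mem_tauSet {I J : Finset ℕ} (hI : ∀ i ∈ I, 1 ≤ i) (hJ : ∀ j ∈ J, 1 ≤ j) :
    ∀ i ∈ tauSet I J, 1 ≤ i := by
  intro i hi
  simp only [tauSet, mem_union, mem_image] at hi
  rcases hi with ⟨a, ha, rfl⟩ | ⟨a, ha, rfl⟩
  · have := hI a ha
    omega
  · have := hJ a ha
    omega

theorem card_tauSet {I J : Finset ℕ} (hI : ∀ i ∈ I, 1 ≤ i) :
    #(tauSet I J) = #I + #J := by
  rw [tauSet, card_union_of_disjoint, card_image_of_injOn, card_image_of_injOn]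
  · intro a _ b _ h
    simpa using h
  · intro a ha b hb h
    have := hI a ha
    have := hI b hb
    simp only at h
    omega
  · rw [disjoint_left]
    intro x hx hy
    simp only [mem_image] at hx hy
    obtain ⟨a, ha, rfl⟩ := hx
    obtain ⟨b, hb, h⟩ := hy
    have := hI a ha
    omega

theorem exists_equiv_comp_eq {A B C : Type*} [Fintype A] [Fintype B] {f : A → C} {g : B → C}
    (hf : Function.Injective f) (hcard : Fintype.card A = Fintype.card B)
    (h : ∀ a, ∃ b, g b = f a) : ∃ e : A ≃ B, g ∘ e = f := by
  choose e he using h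
  have hinj : Function.Injective e := fun a a' haa' => hf (by rw [← he, ← he, haa'])
  exact ⟨Equiv.ofBijective e ((Fintype.bijective_iff_injective_and_card e).2 ⟨hinj, hcard⟩),
    funext he⟩

theorem injective_interleave {A B : Type*} {f : A → ℤ} {g : B → ℤ} (hf : Function.Injective f)
    (hg : Function.Injective g) :
    Function.Injective (Sum.elim (fun a => 2 * f a) fun b => 2 * g b + 1) := by
  rintro (a | a) (b | b) h <;> simp only [Sum.elim_inl, Sum.elim_inr] at h
  · rw [hf (a₁ := a) (a₂ := b) (by omega)]
  · omega
  · omega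
  · rw [hg (a₁ := a) (a₂ := b) (by omega)]

theorem exists_equiv_expo_tauSet {I J : Finset ℕ} {r : ℕ} (hIr : #I = r) (hJr : #J = r)
    (hI : ∀ i ∈ I, 1 ≤ i) (hJ : ∀ j ∈ J, 1 ≤ j) :
    ∃ e : Fin r ⊕ Fin r ≃ Fin (r + r), LaurentRing.expo (r + r) (partOfSet (tauSet I J)) ∘ e =
      Sum.elim (fun k => 2 * LaurentRing.expo r (partOfSet I) k)
        (fun k => 2 * LaurentRing.expo r (partOfSet J) k + 1) := by
  have hcard : #(tauSet I J) = r + r := by rw [card_tauSet hI, hIr, hJr]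
  refine exists_equiv_comp_eq (injective_interleave
    (LaurentRing.strictAnti_expo (antitone_partOfSet I)).injective
    (LaurentRing.strictAnti_expo (antitone_partOfSet J)).injective) (by simp) ?_
  rintro (k | k)
  · rw [Sum.elim_inl, expo_partOfSet hIr hI]
    have h1 := orderEmbOfFin_mem I hIr k.rev
    have h2 := hI _ h1
    obtain ⟨t, ht⟩ := exists_expo_partOfSet hcard (pos_of_mem_tauSet hI hJ)
      (mem_union_left _ (mem_image_of_mem _ h1))
    exact ⟨t, by rw [ht]; omega⟩
  · rw [Sum.elim_inr, expo_partOfSet hJr hJ]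
    have h1 := orderEmbOfFin_mem J hJr k.rev
    have h2 := hJ _ h1
    obtain ⟨t, ht⟩ := exists_expo_partOfSet hcard (pos_of_mem_tauSet hI hJ)
      (mem_union_right _ (mem_image_of_mem _ h1))
    exact ⟨t, by rw [ht]; push_cast; omega⟩

theorem exists_equiv_expo_zero (r : ℕ) :
    ∃ e : Fin r ⊕ Fin r ≃ Fin (r + r), LaurentRing.expo (r + r) 0 ∘ e =
      Sum.elim (fun k => 2 * LaurentRing.expo r 0 k) (fun k => 2 * LaurentRing.expo r 0 k + 1) := by
  have hinj := (LaurentRing.strictAnti_expo (N := r) (μ := 0) antitone_const).injective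
  refine exists_equiv_comp_eq (injective_interleave hinj hinj) (by simp) ?_
  rintro (k | k)
  · refine ⟨⟨2 * k + 1, by omega⟩, ?_⟩
    simp only [LaurentRing.expo, Sum.elim_inl, Pi.zero_apply]
    push_cast
    omega
  · refine ⟨⟨2 * k, by omega⟩, ?_⟩
    simp only [LaurentRing.expo, Sum.elim_inr, Pi.zero_apply]
    push_cast
    omega

theorem partSize_eq_sum {f : ℕ → ℕ} {N : ℕ} (hN : ∀ i, N ≤ i → f i = 0) :
    partSize f = ∑ i ∈ range N, f i := by
  refine finsum_eq_sum_of_support_subset _ fun i hi => ?_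
  by_contra h
  exact hi (hN i (by simpa using h))

theorem sum_expo_sub_sum_expo {f : ℕ → ℕ} {N : ℕ} (hN : ∀ i, N ≤ i → f i = 0) :
    ∑ k, LaurentRing.expo N f k - ∑ k, LaurentRing.expo N 0 k = partSize f := by
  rw [partSize_eq_sum hN, ← sum_sub_distrib, Finset.sum_range]
  push_cast
  exact sum_congr rfl fun k _ => by simp [LaurentRing.expo]

theorem partOfSet_tauSet_eq_zero {I J : Finset ℕ} {r : ℕ} (hIr : #I = r) (hJr : #J = r)
    (hI : ∀ i ∈ I, 1 ≤ i) (i : ℕ) (hi : r + r ≤ i) : partOfSet (tauSet I J) i = 0 :=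
  partOfSet_eq_zero _ _ (by rw [card_tauSet hI, hIr, hJr]; exact hi)

theorem partSize_tauSet {I J : Finset ℕ} {r : ℕ} (hIr : #I = r) (hJr : #J = r)
    (hI : ∀ i ∈ I, 1 ≤ i) (hJ : ∀ j ∈ J, 1 ≤ j) :
    partSize (partOfSet (tauSet I J)) = 2 * (partSize (partOfSet I) + partSize (partOfSet J)) := by
  obtain ⟨e, he⟩ := exists_equiv_expo_tauSet hIr hJr hI hJ
  obtain ⟨e', he'⟩ := exists_equiv_expo_zero r
  have h1 := sum_expo_sub_sum_expo (partOfSet_tauSet_eq_zero hIr hJr hI)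
  have h2 := sum_expo_sub_sum_expo (f := partOfSet I) (N := r)
    fun i hi => partOfSet_eq_zero _ _ (by omega)
  have h3 := sum_expo_sub_sum_expo (f := partOfSet J) (N := r)
    fun i hi => partOfSet_eq_zero _ _ (by omega)
  rw [← Equiv.sum_comp e, ← Equiv.sum_comp e' (LaurentRing.expo (r + r) 0)] at h1
  simp only [funext_iff, Function.comp_apply] at he he'
  simp only [he, he', Fintype.sum_sum_type, Sum.elim_inl, Sum.elim_inr, sum_add_distrib, ← mul_sum] at h1
  omega

theorem lrCoeff_le_lrCoeff_tauSet {I J : Finset ℕ} {r N : ℕ} {nu : ℕ → ℕ} (hIr : #I = r)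
    (hJr : #J = r) (hI : ∀ i ∈ I, 1 ≤ i) (hJ : ∀ j ∈ J, 1 ≤ j) (hnu : Antitone nu)
    (hN : ∀ i, N ≤ i → nu i = 0) (hrN : r ≤ N)
    (hsize : partSize (partOfSet I) + partSize (partOfSet J) = partSize nu) :
    lrCoeff (partOfSet I) (partOfSet J) nu ≤ lrCoeff nu nu (partOfSet (tauSet I J)) := by
  classical
  have hI0 (i : ℕ) (hi : r ≤ i) : partOfSet I i = 0 := partOfSet_eq_zero _ _ (by omega)
  have hJ0 (i : ℕ) (hi : r ≤ i) : partOfSet J i = 0 := partOfSet_eq_zero _ _ (by omega)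
  have hI0' (i : ℕ) (hi : N ≤ i) : partOfSet I i = 0 := hI0 i (by omega)
  have hτ0 := partOfSet_tauSet_eq_zero hIr hJr hI
  have hτ := partSize_tauSet hIr hJr hI hJ
  obtain ⟨e, he⟩ := exists_equiv_expo_tauSet hIr hJr hI hJ
  obtain ⟨e', he'⟩ := exists_equiv_expo_zero r
  have key := LaurentRing.norm_coeff_le_norm_coeff (X := Fin (partSize nu))
    (LaurentRing.expo N nu) (LaurentRing.expo N 0)
    (LaurentRing.expo (r + r) (partOfSet (tauSet I J))) (LaurentRing.expo (r + r) 0)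
    (LaurentRing.expo r (partOfSet I)) (LaurentRing.expo r 0)
    (LaurentRing.expo r (partOfSet J)) (LaurentRing.expo r 0) e e' he he'
    (by rw [sum_expo_sub_sum_expo hN, Fintype.card_fin])
    (by rw [sum_expo_sub_sum_expo hτ0, hτ, Fintype.card_sum, Fintype.card_fin]; omega)
    (by rw [sum_expo_sub_sum_expo hI0, sum_expo_sub_sum_expo hJ0, Fintype.card_fin]; omega)
    (by rw [LaurentRing.coeff_alternant_mul_jacobiTrudi hnu hN hnu hN, if_pos rfl])
    (by rw [LaurentRing.coeff_alternant_mul_jacobiTrudi (antitone_partOfSet _) hτ0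
      (antitone_partOfSet _) hτ0, if_pos rfl])
  rw [LaurentRing.coeff_alternant_mul_jacobiTrudi_mul_jacobiTrudi hnu hN (antitone_partOfSet I) hI0
      (antitone_partOfSet J),
    LaurentRing.coeff_alternant_mul_jacobiTrudi_mul_jacobiTrudi (antitone_partOfSet _) hτ0 hnu hN
      hnu, Complex.norm_natCast, Complex.norm_natCast, Nat.cast_le] at key
  rw [lrCoeff_eq_card (antitone_partOfSet I) hnu hN hI0' hJ0
    (by rw [← partSize_eq_sum hI0', ← partSize_eq_sum hJ0, ← partSize_eq_sum hN, hsize])]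
  refine key.trans ?_
  by_cases hne : ∃ c ∈ LaurentRing.latticeChains (r + r) N nu (partOfSet (tauSet I J)), c 0 = nu
  · obtain ⟨c, hc, h0⟩ := hne
    have hnu0 (i : ℕ) (hi : r + r ≤ i) : nu i = 0 := by
      rw [← h0]
      exact LaurentRing.eq_zero_of_mem_chains hτ0 (LaurentRing.mem_latticeChains.1 hc).1 0 i hi
    rw [lrCoeff_eq_card hnu (antitone_partOfSet _) hτ0 hnu0 hN
      (by rw [← partSize_eq_sum hnu0, ← partSize_eq_sum hN, ← partSize_eq_sum hτ0]; omega)]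
  · rw [filter_false_of_mem fun c hc h0 => hne ⟨c, hc, h0⟩, card_empty]
    exact Nat.zero_le _

theorem stmt11 (lam mu nu : ℕ → ℕ)
    (hlam : IsPartition lam) (hmu : IsPartition mu) (hnu : IsPartition nu)
    (hsize : partSize lam + partSize mu = partSize nu)
    (I J K : Finset ℕ)
    (hIpos : ∀ i ∈ I, 1 ≤ i) (hJpos : ∀ j ∈ J, 1 ≤ j) (hKpos : ∀ k ∈ K, 1 ≤ k)
    (hIJ : I.card = J.card)
    (hI : partOfSet I = lam) (hJ : partOfSet J = mu) (hK : partOfSet K = nu) :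
    lrCoeff lam mu nu ≤
      lrCoeff (partOfSet (tauSet I J)) (partOfSet (tauSet I J)) (partOfSet (tauSet K K)) := by
  subst hI hJ hK
  have h1 := lrCoeff_le_lrCoeff_tauSet (N := max #I #K) rfl hIJ.symm hIpos hJpos
    (antitone_partOfSet K) (fun i hi => partOfSet_eq_zero _ _ (by omega)) (le_max_left _ _) hsize
  have h2 := lrCoeff_le_lrCoeff_tauSet (I := K) (J := K) (N := max #K (#I + #I))
    (nu := partOfSet (tauSet I J)) rfl rfl hKpos hKpos (antitone_partOfSet _)
    (fun i hi => partOfSet_tauSet_eq_zero rfl hIJ.symm hIpos i (by omega)) (le_max_left _ _)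
    (by rw [partSize_tauSet rfl hIJ.symm hIpos hJpos]; omega)
  exact h1.trans h2
end
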